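/- arXiv:1004.3867 — 7 statements merged into one kernel-verified Lean document; each statement's English description precedes it below -/
import Mathlib

section
/- Under Assumptions 1–4, there exists ε₀ > 0 such that for every ε ∈ (0, ε₀) the slow–fast system ẋ = f(x,y,z), ẏ = g(x,y,z), ε ż = x + |z| has a non-constant periodic solution whose orbit contains a point (x̂_ε, ŷ_ε, 0) lying in the plane z = 0, and these periodic solutions can be chosen so that (x̂_ε, ŷ_ε) → (x*, y*) as ε → 0. -/
section
open Set Filter Topology Metric
open scoped NNReal

namespace Canard

/-- Gluing two solutions of an autonomous Lipschitz ODE on overlapping intervals. -/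
theorem glue {E : Type*} [NormedAddCommGroup E] [NormedSpace ℝ E]
    {F : E → E} {K : ℝ≥0} (hF : LipschitzWith K F) {a b c d t₀ : ℝ} {α β : ℝ → E}
    (hα : ∀ t ∈ Ioo a b, HasDerivAt α (F (α t)) t)
    (hβ : ∀ t ∈ Ioo c d, HasDerivAt β (F (β t)) t)
    (hac : a ≤ c) (hbd : b ≤ d) (ht₀ : t₀ ∈ Ioo c b) (h : α t₀ = β t₀) :
    ∃ γ : ℝ → E, (∀ t ∈ Ioo a b, γ t = α t) ∧ (∀ t ∈ Ioo c d, γ t = β t) ∧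
      ∀ t ∈ Ioo a d, HasDerivAt γ (F (γ t)) t := by
  have heq : EqOn α β (Ioo c b) :=
    ODE_solution_unique_of_mem_Ioo (v := fun _ => F) (s := fun _ => univ) (K := K)
      (fun t _ => hF.lipschitzOnWith) ht₀
      (fun t ht => ⟨hα t ⟨lt_of_le_of_lt hac ht.1, ht.2⟩, trivial⟩)
      (fun t ht => ⟨hβ t ⟨ht.1, lt_of_lt_of_le ht.2 hbd⟩, trivial⟩) h
  have h1 : ∀ t ∈ Ioo a b, (fun t => if t < t₀ then α t else β t) t = α t := by
    intro t ht
    by_cases h' : t < t₀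
    · simp [h']
    · simp only [h', if_false]
      exact (heq ⟨lt_of_lt_of_le ht₀.1 (not_lt.1 h'), ht.2⟩).symm
  have h2 : ∀ t ∈ Ioo c d, (fun t => if t < t₀ then α t else β t) t = β t := by
    intro t ht
    by_cases h' : t < t₀
    · simp only [h', if_true]
      exact heq ⟨ht.1, h'.trans ht₀.2⟩
    · simp [h']
  refine ⟨fun t => if t < t₀ then α t else β t, h1, h2, ?_⟩
  intro t ht
  by_cases h' : t < b
  · have hm : t ∈ Ioo a b := ⟨ht.1, h'⟩
    have := hα t hm
    rw [← h1 t hm] at this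
    refine this.congr_of_eventuallyEq ?_
    filter_upwards [Ioo_mem_nhds hm.1 hm.2] with s hs using h1 s hs
  · have hm : t ∈ Ioo c d := ⟨ht₀.1.trans (lt_of_lt_of_le ht₀.2 (not_lt.1 h')), ht.2⟩
    have := hβ t hm
    rw [← h2 t hm] at this
    refine this.congr_of_eventuallyEq ?_
    filter_upwards [Ioo_mem_nhds hm.1 hm.2] with s hs using h2 s hs

theorem local_sol {E : Type*} [NormedAddCommGroup E] [NormedSpace ℝ E] [CompleteSpace E]
    {F : E → E} {K : ℝ≥0} (hF : LipschitzWith K F) (p : E) (c : ℝ) :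
    ∃ α : ℝ → E, α c = p ∧
      ∀ t ∈ Ioo (c - 1 / (2 * (K + 1))) (c + 1 / (2 * (K + 1))), HasDerivAt α (F (α t)) t := by
  set T : ℝ := 1 / (2 * (K + 1)) with hT
  have hTpos : 0 < T := by positivity
  set a : ℝ≥0 := ‖F p‖₊ / (K + 1) + 1 with ha
  set L : ℝ≥0 := ‖F p‖₊ + K * a with hL
  have hpl : IsPicardLindelof (fun _ => F) (tmin := c - T) (tmax := c + T)
      ⟨c, by constructor <;> linarith⟩ p a 0 L K := by
    apply IsPicardLindelof.of_time_independent
    · intro x hx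
      have h1 := hF.dist_le_mul x p
      have h2 : dist x p ≤ a := hx
      calc ‖F x‖ = ‖F p + (F x - F p)‖ := by congr 1; abel
        _ ≤ ‖F p‖ + ‖F x - F p‖ := norm_add_le _ _
        _ ≤ ‖F p‖ + K * a := by
          rw [← dist_eq_norm]
          have : (K : ℝ) * dist x p ≤ K * a := by gcongr
          linarith
        _ = L := by simp [hL]
    · exact hF.lipschitzOnWith
    · have e1 : max (c + T - c) (c - (c - T)) = T := by simp
      simp only [e1]
      have hK : (0:ℝ) < (K:ℝ) + 1 := by positivity
      have e2 : (a : ℝ) * (K + 1) = ‖F p‖ + (K + 1) := by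
        simp [ha]; field_simp
      have e3 : (L : ℝ) = ‖F p‖ + K * a := by simp [hL]
      rw [e3, hT, mul_one_div, div_le_iff₀ (by positivity)]
      have : (0:ℝ) ≤ a := a.2
      simp only [NNReal.coe_zero, sub_zero]
      nlinarith
  obtain ⟨α, h0, hα⟩ := hpl.exists_eq_forall_mem_Icc_hasDerivWithinAt₀
  refine ⟨α, h0, fun t ht => ?_⟩
  exact (hα t (Ioo_subset_Icc_self ht)).hasDerivAt (Icc_mem_nhds ht.1 ht.2)

theorem interval_sol {E : Type*} [NormedAddCommGroup E] [NormedSpace ℝ E] [CompleteSpace E]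
    {F : E → E} {K : ℝ≥0} (hF : LipschitzWith K F) (p : E) (n : ℕ) :
    ∃ α : ℝ → E, α 0 = p ∧
      ∀ t ∈ Ioo (-((n + 2) * (1 / (2 * ((K : ℝ) + 1)) / 2))) ((n + 2) * (1 / (2 * ((K:ℝ) + 1)) / 2)),
        HasDerivAt α (F (α t)) t := by
  set T : ℝ := 1 / (2 * ((K:ℝ) + 1)) with hT
  have hTpos : 0 < T := by positivity
  induction n with
  | zero =>
    obtain ⟨α, h0, hα⟩ := local_sol hF p 0
    refine ⟨α, h0, fun t ht => hα t ?_⟩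
    simp only [← hT]
    push_cast at ht
    constructor <;> [linarith [ht.1]; linarith [ht.2]]
  | succ n ih =>
    obtain ⟨α, h0, hα⟩ := ih
    have hn : (0:ℝ) ≤ n := n.cast_nonneg
    set R : ℝ := (n + 2) * (T / 2) with hR
    have hRT : T ≤ R := by rw [hR]; nlinarith
    have eR : (((n + 1 : ℕ) : ℝ) + 2) * (T / 2) = R + T / 2 := by rw [hR]; push_cast; ring
    rw [eR]
    obtain ⟨β, hb0, hβ⟩ := local_sol hF (α (R - T / 2)) (R - T / 2)
    rw [← hT] at hβ
    obtain ⟨γ, hγ1, -, hγ⟩ := glue (a := -R) (b := R) (c := R - T / 2 - T) (d := R - T/2 + T)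
      (t₀ := R - T / 2) hF hα hβ (by linarith) (by linarith)
      ⟨by linarith, by linarith⟩ hb0.symm
    have hγ0 : γ 0 = p := by rw [hγ1 0 ⟨by linarith, by linarith⟩, h0]
    obtain ⟨β', hb0', hβ'⟩ := local_sol hF (γ (-(R - T / 2))) (-(R - T / 2))
    rw [← hT] at hβ'
    obtain ⟨ζ, -, hζ2, hζ⟩ := glue (a := -(R - T/2) - T) (b := -(R - T / 2) + T) (c := -R)
      (d := R - T/2 + T)
      (t₀ := -(R - T / 2)) hF hβ' hγ (by linarith) (by linarith)
      ⟨by linarith, by linarith⟩ hb0'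
    refine ⟨ζ, by rw [hζ2 0 ⟨by linarith, by linarith⟩, hγ0], fun t ht => hζ t ?_⟩
    constructor <;> [linarith [ht.1]; linarith [ht.2]]

/-- Global existence for a globally Lipschitz autonomous ODE. -/
theorem global_sol {E : Type*} [NormedAddCommGroup E] [NormedSpace ℝ E] [CompleteSpace E]
    {F : E → E} {K : ℝ≥0} (hF : LipschitzWith K F) (p : E) :
    ∃ α : ℝ → E, α 0 = p ∧ ∀ t, HasDerivAt α (F (α t)) t := by
  set T : ℝ := 1 / (2 * ((K:ℝ) + 1)) / 2 with hT
  have hTpos : 0 < T := by positivity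
  choose u hu0 hu using interval_sol hF p
  have hu' : ∀ n : ℕ, ∀ t ∈ Ioo (-(((n:ℝ) + 2) * T)) ((n + 2) * T), HasDerivAt (u n) (F (u n t)) t := hu
  have hagree : ∀ m n : ℕ, m ≤ n → ∀ t ∈ Ioo (-(((m:ℝ) + 2) * T)) ((m + 2) * T), u m t = u n t := by
    intro m n hmn
    have hmn' : (m:ℝ) ≤ n := by exact_mod_cast hmn
    have hle : ((m:ℝ) + 2) * T ≤ (n + 2) * T := by gcongr
    have hpos : 0 < ((m:ℝ) + 2) * T := by positivity
    exact ODE_solution_unique_of_mem_Ioo (v := fun _ => F) (s := fun _ => univ) (K := K) (t₀ := 0)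
      (fun t _ => hF.lipschitzOnWith) ⟨by linarith, hpos⟩
      (fun t ht => ⟨hu' m t ht, trivial⟩)
      (fun t ht => ⟨hu' n t ⟨by linarith [ht.1], by linarith [ht.2]⟩, trivial⟩)
      (by rw [hu0, hu0])
  have hN : ∀ t : ℝ, ∃ n : ℕ, |t| < (n + 2) * T := by
    intro t
    obtain ⟨n, hn⟩ := exists_nat_gt (|t| / T)
    refine ⟨n, ?_⟩
    rw [div_lt_iff₀ hTpos] at hn
    nlinarith
  choose N hN using hN
  have key : ∀ n : ℕ, ∀ t ∈ Ioo (-(((n:ℝ) + 2) * T)) ((n + 2) * T), u (N t) t = u n t := by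
    intro n t ht
    have h1 := abs_lt.1 (hN t)
    rcases le_total n (N t) with h | h
    · exact (hagree n (N t) h t ht).symm
    · exact hagree (N t) n h t h1
  refine ⟨fun t => u (N t) t, hu0 _, fun t => ?_⟩
  have ht := abs_lt.1 (hN t)
  refine (hu' (N t) t ht).congr_of_eventuallyEq ?_
  filter_upwards [Ioo_mem_nhds ht.1 ht.2] with s hs using key (N t) s hs

theorem sol_dist {E : Type*} [NormedAddCommGroup E] [NormedSpace ℝ E]
    {F : E → E} {K : ℝ≥0} (hF : LipschitzWith K F) {u v : ℝ → E}
    (hu : ∀ t, HasDerivAt u (F (u t)) t) (hv : ∀ t, HasDerivAt v (F (v t)) t)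
    {t : ℝ} (ht : 0 ≤ t) : dist (u t) (v t) ≤ dist (u 0) (v 0) * Real.exp (K * t) := by
  have := dist_le_of_trajectories_ODE (v := fun _ => F) (K := K) (a := 0) (b := t)
    (δ := dist (u 0) (v 0)) (fun _ => hF)
    (fun s _ => (hu s).continuousAt.continuousWithinAt) (fun s _ => (hu s).hasDerivWithinAt)
    (fun s _ => (hv s).continuousAt.continuousWithinAt) (fun s _ => (hv s).hasDerivWithinAt)
    le_rfl t ⟨ht, le_rfl⟩
  simpa using this

theorem sol_unique {E : Type*} [NormedAddCommGroup E] [NormedSpace ℝ E]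
    {F : E → E} {K : ℝ≥0} (hF : LipschitzWith K F) {u v : ℝ → E}
    (hu : ∀ t, HasDerivAt u (F (u t)) t) (hv : ∀ t, HasDerivAt v (F (v t)) t)
    {t₀ : ℝ} (h : u t₀ = v t₀) : u = v :=
  ODE_solution_unique_univ (v := fun _ => F) (s := fun _ => univ) (K := K)
    (fun _ => hF.lipschitzOnWith) (fun t => ⟨hu t, trivial⟩) (fun t => ⟨hv t, trivial⟩) h

theorem sol_shift {E : Type*} [NormedAddCommGroup E] [NormedSpace ℝ E]
    {F : E → E} {u : ℝ → E} (hu : ∀ t, HasDerivAt u (F (u t)) t) (s : ℝ) :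
    ∀ t, HasDerivAt (fun t => u (t + s)) (F (u (t + s))) t := by
  intro t
  exact (hu (t + s)).comp_add_const t s

end Canard
end

section
open Set Filter Topology Metric
open scoped NNReal

namespace Canard

theorem cos_pos_diff {φ : ℝ → ℝ} {a b : ℝ} (hφ : ContinuousOn φ (Icc a b))
    (hc : ∀ t ∈ Icc a b, 0 < Real.cos (φ t)) {s t : ℝ} (hs : s ∈ Icc a b) (ht : t ∈ Icc a b) :
    φ t - φ s < Real.pi := by
  by_contra! h
  have hsub : uIcc s t ⊆ Icc a b := by
    intro x hx
    rw [mem_uIcc] at hx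
    rcases hx with hx | hx
    · exact ⟨hs.1.trans hx.1, hx.2.trans ht.2⟩
    · exact ⟨ht.1.trans hx.1, hx.2.trans hs.2⟩
  have hivt := intermediate_value_uIcc (hφ.mono hsub)
  have hmem : φ s + Real.pi ∈ uIcc (φ s) (φ t) := by
    rw [mem_uIcc]; left
    constructor <;> linarith [Real.pi_pos]
  obtain ⟨x, hx, hxe⟩ := hivt hmem
  have h1 := hc x (hsub hx)
  have h2 := hc s hs
  rw [hxe, Real.cos_add_pi] at h1
  linarith

theorem step_lt {a b : ℝ} (h : a - b < Real.pi)
    (hs : 0 < Real.sin b * Real.cos a - Real.cos b * Real.sin a) : a < b := by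
  by_contra! hle
  have : 0 ≤ Real.sin (a - b) := Real.sin_nonneg_of_nonneg_of_le_pi (by linarith) h.le
  rw [Real.sin_sub] at this
  linarith

/-- Two-dimensional Poincaré–Miranda theorem. -/
theorem miranda {δ : ℝ} (hδ : 0 < δ) {H₁ H₂ : ℝ × ℝ → ℝ}
    (hc₁ : ContinuousOn H₁ (Icc (-δ) δ ×ˢ Icc (-δ) δ))
    (hc₂ : ContinuousOn H₂ (Icc (-δ) δ ×ˢ Icc (-δ) δ))
    (hl : ∀ k ∈ Icc (-δ) δ, H₁ (-δ, k) < 0) (hr : ∀ k ∈ Icc (-δ) δ, 0 < H₁ (δ, k))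
    (hb : ∀ h ∈ Icc (-δ) δ, H₂ (h, -δ) < 0) (ht : ∀ h ∈ Icc (-δ) δ, 0 < H₂ (h, δ)) :
    ∃ p ∈ Icc (-δ) δ ×ˢ Icc (-δ) δ, H₁ p = 0 ∧ H₂ p = 0 := by
  by_contra! hne
  have hle : -δ ≤ δ := by linarith
  set cl : ℝ × ℝ → ℝ × ℝ := fun p => (projIcc (-δ) δ hle p.1, projIcc (-δ) δ hle p.2) with hcl
  have hclc : Continuous cl := by
    apply Continuous.prodMk
    · exact continuous_subtype_val.comp (continuous_projIcc.comp continuous_fst)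
    · exact continuous_subtype_val.comp (continuous_projIcc.comp continuous_snd)
  have hclm : ∀ p, cl p ∈ Icc (-δ) δ ×ˢ Icc (-δ) δ := fun p => ⟨(projIcc (-δ) δ hle p.1).2, (projIcc (-δ) δ hle p.2).2⟩
  have hcli : ∀ p ∈ Icc (-δ) δ ×ˢ Icc (-δ) δ, cl p = p := by
    intro p hp
    simp only [hcl]
    rw [projIcc_of_mem hle hp.1, projIcc_of_mem hle hp.2]
  set G : ℝ × ℝ → ℂ := fun p => ⟨H₁ (cl p), H₂ (cl p)⟩ with hG
  have hG1 : Continuous fun p => H₁ (cl p) := hc₁.comp_continuous hclc hclm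
  have hG2 : Continuous fun p => H₂ (cl p) := hc₂.comp_continuous hclc hclm
  have hGc : Continuous G := by
    have : G = fun p => ((H₁ (cl p) : ℝ) : ℂ) + ((H₂ (cl p) : ℝ) : ℂ) * Complex.I := by
      ext p
      apply Complex.ext <;> simp [hG]
    rw [this]
    exact (Complex.continuous_ofReal.comp hG1).add ((Complex.continuous_ofReal.comp hG2).mul continuous_const)
  have hG0 : 0 ∉ G '' univ := by
    rintro ⟨p, -, hp⟩
    have h1 := congrArg Complex.re hp
    have h2 := congrArg Complex.im hp
    simp only [hG, Complex.zero_re, Complex.zero_im] at h1 h2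
    exact hne _ (hclm p) h1 h2
  have hsc : IsSimplyConnected (univ : Set (ℝ × ℝ)) :=
    haveI : ContractibleSpace (univ : Set (ℝ × ℝ)) := convex_univ.contractibleSpace univ_nonempty
    show SimplyConnectedSpace _ from inferInstance
  obtain ⟨L, hLc, hL⟩ := Complex.exists_continuousOn_eqOn_exp_comp hsc isOpen_univ hGc.continuousOn hG0
  rw [continuousOn_univ] at hLc
  set θ : ℝ × ℝ → ℝ := fun p => (L p).im with hθ
  have hθc : Continuous θ := Complex.continuous_im.comp hLc
  have hH1 : ∀ p ∈ Icc (-δ) δ ×ˢ Icc (-δ) δ, H₁ p = Real.exp (L p).re * Real.cos (θ p) := by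
    intro p hp
    have := congrArg Complex.re (hL (mem_univ p))
    simp only [Function.comp, Complex.exp_re, hG, hcli p hp] at this
    exact this.symm
  have hH2 : ∀ p ∈ Icc (-δ) δ ×ˢ Icc (-δ) δ, H₂ p = Real.exp (L p).re * Real.sin (θ p) := by
    intro p hp
    have := congrArg Complex.im (hL (mem_univ p))
    simp only [Function.comp, Complex.exp_im, hG, hcli p hp] at this
    exact this.symm
  have mL : -δ ∈ Icc (-δ) δ := ⟨le_rfl, hle⟩
  have mR : δ ∈ Icc (-δ) δ := ⟨hle, le_rfl⟩
  have cr : ∀ k ∈ Icc (-δ) δ, 0 < Real.cos (θ (δ, k)) := by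
    intro k hk
    have := hr k hk
    rw [hH1 _ ⟨mR, hk⟩] at this
    exact (pos_iff_pos_of_mul_pos this).1 (Real.exp_pos _)
  have cl' : ∀ k ∈ Icc (-δ) δ, Real.cos (θ (-δ, k)) < 0 := by
    intro k hk
    have := hl k hk
    rw [hH1 _ ⟨mL, hk⟩] at this
    exact neg_of_mul_neg_right this (Real.exp_pos _).le
  have ct : ∀ k ∈ Icc (-δ) δ, 0 < Real.sin (θ (k, δ)) := by
    intro k hk
    have := ht k hk
    rw [hH2 _ ⟨hk, mR⟩] at this
    exact (pos_iff_pos_of_mul_pos this).1 (Real.exp_pos _)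
  have cb : ∀ k ∈ Icc (-δ) δ, Real.sin (θ (k, -δ)) < 0 := by
    intro k hk
    have := hb k hk
    rw [hH2 _ ⟨hk, mL⟩] at this
    exact neg_of_mul_neg_right this (Real.exp_pos _).le
  have d12 : θ (δ, -δ) < θ (δ, δ) := by
    apply step_lt
    · exact cos_pos_diff (φ := fun k => θ (δ, k)) (by fun_prop) cr mR mL
    · have := mul_pos (ct δ mR) (cr (-δ) mL)
      have := mul_neg_of_pos_of_neg (cr δ mR) (cb δ mR)
      linarith
  have d23 : θ (δ, δ) < θ (-δ, δ) := by
    apply step_lt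
    · have := cos_pos_diff (φ := fun k => θ (k, δ) - Real.pi / 2) (a := -δ) (b := δ) (by fun_prop)
        (fun t h => by rw [Real.cos_sub_pi_div_two]; exact ct t h) mL mR
      linarith
    · have := mul_pos (ct (-δ) mL) (cr δ mR)
      have := mul_neg_of_neg_of_pos (cl' δ mR) (ct δ mR)
      linarith
  have d34 : θ (-δ, δ) < θ (-δ, -δ) := by
    apply step_lt
    · have := cos_pos_diff (φ := fun k => θ (-δ, k) - Real.pi) (a := -δ) (b := δ) (by fun_prop)
        (fun t h => by rw [Real.cos_sub_pi]; linarith [cl' t h]) mL mR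
      linarith
    · have := mul_pos_of_neg_of_neg (cb (-δ) mL) (cl' δ mR)
      have := mul_neg_of_neg_of_pos (cl' (-δ) mL) (ct (-δ) mL)
      linarith
  have d41 : θ (-δ, -δ) < θ (δ, -δ) := by
    apply step_lt
    · have := cos_pos_diff (φ := fun k => θ (k, -δ) + Real.pi / 2) (a := -δ) (b := δ) (by fun_prop)
        (fun t h => by rw [Real.cos_add_pi_div_two]; linarith [cb t h]) mR mL
      linarith
    · have := mul_pos_of_neg_of_neg (cb δ mR) (cl' (-δ) mL)
      have := mul_neg_of_pos_of_neg (cr (-δ) mL) (cb (-δ) mL)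
      linarith
  linarith

/-- A continuous function on the square vanishing at the centre, whose level sets are in thin
cones, has opposite signs on the two opposite sides. -/
theorem side_signs {δ : ℝ} (hδ : 0 < δ) {ψ : ℝ × ℝ → ℝ}
    (hc : ContinuousOn ψ (Icc (-δ) δ ×ˢ Icc (-δ) δ)) (h0 : ψ (0, 0) = 0)
    (cone : ∀ p ∈ Icc (-δ) δ ×ˢ Icc (-δ) δ, ∀ q ∈ Icc (-δ) δ ×ˢ Icc (-δ) δ, ψ p = ψ q →
      |p.1 - q.1| ≤ |p.2 - q.2| / 3) :
    ∃ c > 0, ∃ σ : ℝ, |σ| = 1 ∧ (∀ k ∈ Icc (-δ) δ, c ≤ σ * ψ (δ, k)) ∧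
      (∀ k ∈ Icc (-δ) δ, σ * ψ (-δ, k) ≤ -c) := by
  have mL : -δ ∈ Icc (-δ) δ := ⟨le_rfl, by linarith⟩
  have mR : δ ∈ Icc (-δ) δ := ⟨by linarith, le_rfl⟩
  have m0 : (0:ℝ) ∈ Icc (-δ) δ := ⟨by linarith, by linarith⟩
  have hne : ∀ h, |h| = δ → h ∈ Icc (-δ) δ → ∀ k ∈ Icc (-δ) δ, ψ (h, k) ≠ 0 := by
    intro h hh hm k hk hz
    have := cone (h, k) ⟨hm, hk⟩ (0, 0) ⟨m0, m0⟩ (by rw [hz, h0])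
    simp only [sub_zero] at this
    have hk' : |k| ≤ δ := abs_le.2 hk
    rw [hh] at this
    linarith
  have hcR : ContinuousOn (fun k => ψ (δ, k)) (Icc (-δ) δ) :=
    hc.comp (by fun_prop) (fun k hk => ⟨mR, hk⟩)
  have hcL : ContinuousOn (fun k => ψ (-δ, k)) (Icc (-δ) δ) :=
    hc.comp (by fun_prop) (fun k hk => ⟨mL, hk⟩)
  have hcH : ContinuousOn (fun h => ψ (h, 0)) (Icc (-δ) δ) :=
    hc.comp (by fun_prop) (fun k hk => ⟨hk, m0⟩)
  have hinj : InjOn (fun h => ψ (h, 0)) (Icc (-δ) δ) := by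
    intro h hh h' hh' he
    have := cone (h, 0) ⟨hh, m0⟩ (h', 0) ⟨hh', m0⟩ he
    simp only [sub_self, abs_zero, zero_div] at this
    have := abs_eq_zero.1 (le_antisymm this (abs_nonneg _))
    linarith
  -- opposite signs at the middle points
  have hσ : ∃ σ : ℝ, |σ| = 1 ∧ 0 < σ * ψ (δ, 0) ∧ σ * ψ (-δ, 0) < 0 := by
    rcases hcH.strictMonoOn_of_injOn_Icc' (by linarith) hinj with hm | hm
    · refine ⟨1, by simp, ?_, ?_⟩
      · have := hm m0 mR hδ
        simp only [h0] at this; linarith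
      · have := hm mL m0 (by linarith)
        simp only [h0] at this; linarith
    · refine ⟨-1, by simp, ?_, ?_⟩
      · have := hm m0 mR hδ
        simp only [h0] at this; linarith
      · have := hm mL m0 (by linarith)
        simp only [h0] at this; linarith
  obtain ⟨σ, hσ1, hp, hn⟩ := hσ
  have hσ0 : σ ≠ 0 := by rintro rfl; simp at hσ1
  have hsR : ∀ k ∈ Icc (-δ) δ, 0 < σ * ψ (δ, k) := by
    intro k hk
    by_contra! hle
    obtain ⟨x, hx, hx0⟩ := isPreconnected_Icc.intermediate_value hk m0
      (continuousOn_const.mul hcR : ContinuousOn (fun k => σ * ψ (δ, k)) _)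
      (show (0:ℝ) ∈ Icc _ _ from ⟨hle, hp.le⟩)
    exact hne δ (abs_of_pos hδ) mR x hx ((mul_eq_zero.1 hx0).resolve_left hσ0)
  have hsL : ∀ k ∈ Icc (-δ) δ, σ * ψ (-δ, k) < 0 := by
    intro k hk
    by_contra! hle
    obtain ⟨x, hx, hx0⟩ := isPreconnected_Icc.intermediate_value m0 hk
      (continuousOn_const.mul hcL : ContinuousOn (fun k => σ * ψ (-δ, k)) _)
      (show (0:ℝ) ∈ Icc _ _ from ⟨hn.le, hle⟩)
    exact hne (-δ) (by rw [abs_neg, abs_of_pos hδ]) mL x hx ((mul_eq_zero.1 hx0).resolve_left hσ0)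
  obtain ⟨a, ha, haM⟩ := isCompact_Icc.exists_isMinOn ⟨0, m0⟩
    (continuousOn_const.mul hcR : ContinuousOn (fun k => σ * ψ (δ, k)) (Icc (-δ) δ))
  obtain ⟨b, hb, hbM⟩ := isCompact_Icc.exists_isMaxOn ⟨0, m0⟩
    (continuousOn_const.mul hcL : ContinuousOn (fun k => σ * ψ (-δ, k)) (Icc (-δ) δ))
  refine ⟨min (σ * ψ (δ, a)) (-(σ * ψ (-δ, b))), lt_min (hsR a ha) (by linarith [hsL b hb]), σ, hσ1, ?_, ?_⟩
  · intro k hk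
    exact (min_le_left _ _).trans (haM hk)
  · intro k hk
    have h1 : σ * ψ (-δ, k) ≤ σ * ψ (-δ, b) := hbM hk
    have h2 := min_le_right (σ * ψ (δ, a)) (-(σ * ψ (-δ, b)))
    linarith

end Canard
end

section
open Set Filter Topology Metric
open scoped NNReal

namespace Canard

structure Sys (M lam : ℝ) (f g : ℝ → ℝ → ℝ → ℝ) : Prop where
  hM : 0 < M
  hlam : 0 ≤ lam
  bf : ∀ x y z, |f x y z| < M
  bg : ∀ x y z, |g x y z| < M
  Lf : ∀ x₁ y₁ z₁ x₂ y₂ z₂ : ℝ,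
      |f x₁ y₁ z₁ - f x₂ y₂ z₂| ≤ lam * (|x₁ - x₂| + |y₁ - y₂| + |z₁ - z₂|)
  Lg : ∀ x₁ y₁ z₁ x₂ y₂ z₂ : ℝ,
      |g x₁ y₁ z₁ - g x₂ y₂ z₂| ≤ lam * (|x₁ - x₂| + |y₁ - y₂| + |z₁ - z₂|)
  g0 : 0 < g 0 0 0
  f0 : ∀ y ≤ 0, 0 ≤ f 0 y 0

/-- Solutions of the slow-fast system in which `z` is replaced by `c z` in `f` and `g`. -/
structure Sol (f g : ℝ → ℝ → ℝ → ℝ) (c : ℝ → ℝ) (ε : ℝ) (x y z : ℝ → ℝ) : Prop where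
  dx : ∀ t, HasDerivAt x (f (x t) (y t) (c (z t))) t
  dy : ∀ t, HasDerivAt y (g (x t) (y t) (c (z t))) t
  dz : ∀ t, HasDerivAt z ((x t + |z t|) / ε) t

/-- Solutions of the limit planar system. -/
structure PSol (f g : ℝ → ℝ → ℝ → ℝ) (p q : ℝ → ℝ) : Prop where
  dp : ∀ t, HasDerivAt p (f (p t) (q t) (min (p t) 0)) t
  dq : ∀ t, HasDerivAt q (g (p t) (q t) (min (p t) 0)) t

theorem fence {u u' B B' : ℝ → ℝ} {a b : ℝ} (hu : ∀ t, HasDerivAt u (u' t) t)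
    (hB : ∀ t, HasDerivAt B (B' t) t) (ha : u a ≤ B a)
    (bd : ∀ t, a ≤ t → t < b → u t = B t → u' t < B' t) : ∀ t, a ≤ t → t ≤ b → u t ≤ B t := by
  intro t h1 h2
  exact image_le_of_deriv_right_lt_deriv_boundary' (f' := u') (B' := B')
    (fun s _ => (hu s).continuousAt.continuousWithinAt) (fun s _ => (hu s).hasDerivWithinAt) ha
    (fun s _ => (hB s).continuousAt.continuousWithinAt) (fun s _ => (hB s).hasDerivWithinAt)
    (fun s hs h => bd s hs.1 hs.2 h) ⟨h1, h2⟩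

/-- First time a function becomes positive. -/
theorem first_time {z : ℝ → ℝ} {a b : ℝ} (hz : Continuous z) (ha : z a ≤ 0)
    (h : ∃ s, a ≤ s ∧ s ≤ b ∧ 0 < z s) :
    ∃ t, a ≤ t ∧ t ≤ b ∧ z t = 0 ∧ (∀ s, a ≤ s → s ≤ t → z s ≤ 0) ∧
      ∀ d, HasDerivAt z d t → 0 ≤ d := by
  set A : Set ℝ := {s | a ≤ s ∧ s ≤ b ∧ 0 < z s} with hA
  have hbd : BddBelow A := ⟨a, fun s hs => hs.1⟩
  have hne : A.Nonempty := h
  set t := sInf A with ht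
  have hat : a ≤ t := le_csInf hne fun s hs => hs.1
  have htb : t ≤ b := by
    obtain ⟨s, hs⟩ := hne
    exact (csInf_le hbd hs).trans hs.2.1
  have hlt : ∀ s, a ≤ s → s < t → z s ≤ 0 := by
    intro s h1 h2
    by_contra! hc
    exact absurd (csInf_le hbd ⟨h1, h2.le.trans htb, hc⟩) (not_le.2 h2)
  have htcl : t ∈ closure A := csInf_mem_closure hne hbd
  have hge : 0 ≤ z t := by
    have : closure A ⊆ {s | 0 ≤ z s} :=
      closure_minimal (fun s hs => hs.2.2.le) (isClosed_le continuous_const hz)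
    exact this htcl
  have hle : z t ≤ 0 := by
    rcases hat.eq_or_lt with h | h
    · rw [← h]; exact ha
    · have hcl : t ∈ closure (Ico a t) := by
        rw [closure_Ico h.ne]; exact ⟨hat, le_rfl⟩
      have : closure (Ico a t) ⊆ {s | z s ≤ 0} :=
        closure_minimal (fun s hs => hlt s hs.1 hs.2) (isClosed_le hz continuous_const)
      exact this hcl
  have hz0 : z t = 0 := le_antisymm hle hge
  refine ⟨t, hat, htb, hz0, ?_, ?_⟩
  · intro s h1 h2
    rcases h2.eq_or_lt with h | h
    · rw [h]; exact hle
    · exact hlt s h1 h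
  · intro d hd
    by_contra! hneg
    have hev : ∀ᶠ s in 𝓝[>] t, z s < 0 := by
      have h1 := hd.hasDerivWithinAt (s := Ioi t)
      rw [hasDerivWithinAt_iff_tendsto_slope' (by simp)] at h1
      have h2 := h1.eventually (gt_mem_nhds hneg)
      filter_upwards [h2, self_mem_nhdsWithin] with s hs1 hs2
      have hs2' : t < s := hs2
      rw [slope_def_field, hz0, sub_zero] at hs1
      exact neg_of_div_neg_left hs1 (by linarith)
    rw [eventually_nhdsWithin_iff, Metric.eventually_nhds_iff] at hev
    obtain ⟨e, he, hev⟩ := hev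
    obtain ⟨s, hs, hst⟩ := exists_lt_of_csInf_lt hne (show sInf A < t + e by linarith)
    have hts : t ≤ s := csInf_le hbd hs
    rcases hts.eq_or_lt with h | h
    · have := hs.2.2; rw [← h] at this; linarith
    · have := hev (y := s) (by rw [Real.dist_eq, abs_of_pos (by linarith)]; linarith) h
      linarith [hs.2.2]

theorem gronwall_le {δ K e x : ℝ} (hδ : 0 ≤ δ) (hK : 0 ≤ K) (he : 0 ≤ e) (hx : 0 ≤ x) :
    gronwallBound δ K e x ≤ (δ + e * x) * Real.exp (K * x) := by
  have hex : 0 < Real.exp (K * x) := Real.exp_pos _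
  rcases hK.eq_or_lt with h | h
  · subst h; simp [gronwallBound_K0]
  · rw [gronwallBound_of_K_ne_0 h.ne']
    have h1 : 1 - K * x ≤ Real.exp (-(K * x)) := by
      have := Real.add_one_le_exp (-(K * x)); linarith
    have h2 : Real.exp (K * x) - 1 ≤ K * x * Real.exp (K * x) := by
      have : Real.exp (K * x) * Real.exp (-(K * x)) = 1 := by rw [← Real.exp_add]; simp
      nlinarith
    have h3 : e / K * (Real.exp (K * x) - 1) ≤ e * x * Real.exp (K * x) := by
      rw [div_mul_eq_mul_div, div_le_iff₀ h]
      nlinarith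
    simp only
    nlinarith

/-- planar limit field -/
noncomputable def Fl (f g : ℝ → ℝ → ℝ → ℝ) (p : ℝ × ℝ) : ℝ × ℝ :=
  (f p.1 p.2 (min p.1 0), g p.1 p.2 (min p.1 0))

noncomputable def F3 (f g : ℝ → ℝ → ℝ → ℝ) (c : ℝ → ℝ) (ε : ℝ) (p : ℝ × ℝ × ℝ) : ℝ × ℝ × ℝ :=
  (f p.1 p.2.1 (c p.2.2), g p.1 p.2.1 (c p.2.2), (p.1 + |p.2.2|) / ε)

variable {M lam : ℝ} {f g : ℝ → ℝ → ℝ → ℝ}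

theorem min_sub_le (a b r : ℝ) : |min a r - min b r| ≤ |a - b| := by
  have := abs_min_sub_min_le_max a r b r
  simpa using this

theorem Fl_lip (S : Sys M lam f g) : LipschitzWith (Real.toNNReal (3 * lam)) (Fl f g) := by
  refine LipschitzWith.of_dist_le_mul fun p q => ?_
  have hl := S.hlam
  rw [Real.coe_toNNReal _ (by positivity)]
  have h1 : |p.1 - q.1| ≤ dist p q := by
    rw [← Real.dist_eq]; exact le_max_left _ _
  have h2 : |p.2 - q.2| ≤ dist p q := by
    rw [← Real.dist_eq]; exact le_max_right _ _
  have h3 := min_sub_le p.1 q.1 0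
  have h4 : lam * (|p.1 - q.1| + |p.2 - q.2| + |min p.1 0 - min q.1 0|) ≤ 3 * lam * dist p q := by
    nlinarith
  rw [Prod.dist_eq, Real.dist_eq, Real.dist_eq]
  exact max_le ((S.Lf _ _ _ _ _ _).trans h4) ((S.Lg _ _ _ _ _ _).trans h4)

theorem F3_lip (S : Sys M lam f g) {c : ℝ → ℝ} (hc : ∀ a b, |c a - c b| ≤ |a - b|) {ε : ℝ}
    (hε : 0 < ε) : LipschitzWith (Real.toNNReal (3 * lam + 2 / ε)) (F3 f g c ε) := by
  refine LipschitzWith.of_dist_le_mul fun p q => ?_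
  have hl := S.hlam
  rw [Real.coe_toNNReal _ (by positivity)]
  have h1 : |p.1 - q.1| ≤ dist p q := by
    rw [← Real.dist_eq]; exact le_max_left _ _
  have h2 : |p.2.1 - q.2.1| ≤ dist p q := by
    rw [← Real.dist_eq]; exact (le_max_left _ _).trans (le_max_right _ _)
  have h3 : |p.2.2 - q.2.2| ≤ dist p q := by
    rw [← Real.dist_eq]; exact (le_max_right _ _).trans (le_max_right _ _)
  have h3' := hc p.2.2 q.2.2
  have hd : 0 ≤ dist p q := dist_nonneg
  have h2e : 0 < 2 / ε := by positivity
  have h4 : lam * (|p.1 - q.1| + |p.2.1 - q.2.1| + |c p.2.2 - c q.2.2|) ≤ (3 * lam + 2 / ε) * dist p q := by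
    nlinarith
  have h5 : |(p.1 + |p.2.2|) / ε - (q.1 + |q.2.2|) / ε| ≤ (3 * lam + 2 / ε) * dist p q := by
    rw [← sub_div, abs_div, abs_of_pos hε, div_le_iff₀ hε]
    have h6 := abs_abs_sub_abs_le_abs_sub p.2.2 q.2.2
    have h7 := abs_add_le (p.1 - q.1) (|p.2.2| - |q.2.2|)
    have h8 : p.1 - q.1 + (|p.2.2| - |q.2.2|) = p.1 + |p.2.2| - (q.1 + |q.2.2|) := by ring
    rw [h8] at h7
    have h9 : (3 * lam + 2 / ε) * dist p q * ε = 3 * lam * dist p q * ε + 2 * dist p q := by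
      field_simp
    have : 0 ≤ 3 * lam * dist p q * ε := by positivity
    linarith
  simp only [Prod.dist_eq, Real.dist_eq, F3] at *
  exact max_le ((S.Lf _ _ _ _ _ _).trans h4) (max_le ((S.Lg _ _ _ _ _ _).trans h4) h5)

theorem Sol.toF3 {c : ℝ → ℝ} {ε : ℝ} {x y z : ℝ → ℝ} (h : Sol f g c ε x y z) :
    ∀ t, HasDerivAt (fun t => (x t, y t, z t)) (F3 f g c ε (x t, y t, z t)) t :=
  fun t => (h.dx t).prodMk ((h.dy t).prodMk (h.dz t))

theorem PSol.toFl {p q : ℝ → ℝ} (h : PSol f g p q) :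
    ∀ t, HasDerivAt (fun t => (p t, q t)) (Fl f g (p t, q t)) t :=
  fun t => (h.dp t).prodMk (h.dq t)

theorem exists_Sol (S : Sys M lam f g) {c : ℝ → ℝ} (hc : ∀ a b, |c a - c b| ≤ |a - b|) {ε : ℝ}
    (hε : 0 < ε) (a b d : ℝ) : ∃ x y z, Sol f g c ε x y z ∧ x 0 = a ∧ y 0 = b ∧ z 0 = d := by
  obtain ⟨α, h0, hα⟩ := global_sol (F3_lip S hc hε) (a, b, d)
  refine ⟨fun t => (α t).1, fun t => (α t).2.1, fun t => (α t).2.2,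
    ⟨fun t => ?_, fun t => ?_, fun t => ?_⟩, by simp [h0], by simp [h0], by simp [h0]⟩
  · exact (hasFDerivAt_fst.comp_hasDerivAt t (hα t) :)
  · exact (hasFDerivAt_fst.comp_hasDerivAt t (hasFDerivAt_snd.comp_hasDerivAt t (hα t)) :)
  · exact (hasFDerivAt_snd.comp_hasDerivAt t (hasFDerivAt_snd.comp_hasDerivAt t (hα t)) :)

theorem exists_PSol (S : Sys M lam f g) (a b : ℝ) : ∃ p q, PSol f g p q ∧ p 0 = a ∧ q 0 = b := by
  obtain ⟨α, h0, hα⟩ := global_sol (Fl_lip S) (a, b)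
  refine ⟨fun t => (α t).1, fun t => (α t).2,
    ⟨fun t => ?_, fun t => ?_⟩, by simp [h0], by simp [h0]⟩
  · exact (hasFDerivAt_fst.comp_hasDerivAt t (hα t) :)
  · exact (hasFDerivAt_snd.comp_hasDerivAt t (hα t) :)

theorem lip_of_deriv {u u' : ℝ → ℝ} {C : ℝ} (hu : ∀ t, HasDerivAt u (u' t) t)
    {a b : ℝ} (hb : ∀ t ∈ uIcc a b, |u' t| ≤ C) : |u b - u a| ≤ C * |b - a| := by
  have := Convex.norm_image_sub_le_of_norm_hasDerivWithin_le (f := u) (f' := u') (s := uIcc a b) (C := C)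
    (fun t _ => (hu t).hasDerivWithinAt) hb (convex_uIcc a b) left_mem_uIcc right_mem_uIcc
  simpa using this

theorem growth_of_deriv {u u' : ℝ → ℝ} {C : ℝ} (hu : ∀ t, HasDerivAt u (u' t) t)
    {a b : ℝ} (hab : a ≤ b) (hb : ∀ t, a ≤ t → t ≤ b → C ≤ u' t) : C * (b - a) ≤ u b - u a := by
  refine Convex.mul_sub_le_image_sub_of_le_deriv (f := u) (D := Icc a b) (convex_Icc a b)
    (fun t _ => (hu t).continuousAt.continuousWithinAt)
    (fun t _ => (hu t).differentiableAt.differentiableWithinAt) ?_ a ⟨le_rfl, hab⟩ b ⟨hab, le_rfl⟩ hab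
  intro t ht
  rw [(hu t).deriv]
  have := interior_subset ht
  exact hb t this.1 this.2

theorem C1 (S : Sys M lam f g) {c : ℝ → ℝ} {ε : ℝ} (hε : 0 < ε) {x y z : ℝ → ℝ}
    (h : Sol f g c ε x y z) (hz : z 0 = 0) (hx : x 0 < 0) :
    ∀ t, 0 ≤ t → x t - ε * M ≤ z t := by
  intro t ht
  refine fence (u := fun t => x t - ε * M) (B := z) (fun s => (h.dx s).sub_const (ε * M)) h.dz
    ?_ ?_ t ht le_rfl
  · simp only [hz]; have := mul_pos hε S.hM; linarith
  · intro s _ _ he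
    have h1 := (abs_lt.1 (S.bf (x s) (y s) (c (z s)))).2
    refine h1.trans_le ?_
    rw [le_div_iff₀ hε]
    have := neg_abs_le (z s)
    linarith

theorem C2 (S : Sys M lam f g) {c : ℝ → ℝ} {ε : ℝ} (hε : 0 < ε) {x y z : ℝ → ℝ}
    (h : Sol f g c ε x y z) (hz : z 0 = 0) {t : ℝ}
    (hneg : ∀ s, 0 ≤ s → s ≤ t → z s ≤ 0) :
    ∀ s, 0 ≤ s → s ≤ t → z s - x s ≤ -x 0 * Real.exp (-(s / ε)) + ε * M := by
  have hB : ∀ s, HasDerivAt (fun s => -x 0 * Real.exp (-(s / ε)) + ε * M)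
      (-x 0 * (Real.exp (-(s / ε)) * (-(1 / ε)))) s := by
    intro s
    have h1 : HasDerivAt (fun s : ℝ => -(s / ε)) (-(1 / ε)) s := ((hasDerivAt_id s).div_const ε).neg
    exact (h1.exp.const_mul _).add_const _
  refine fence (u := fun s => z s - x s) (fun s => (h.dz s).sub (h.dx s)) hB ?_ ?_
  · simp only [hz]; have := mul_pos hε S.hM; simp; linarith
  · intro s h0 hst he
    have h1 := (abs_lt.1 (S.bf (x s) (y s) (c (z s)))).1
    rw [abs_of_nonpos (hneg s h0 hst.le)]
    have h2 : (x s + -z s) / ε = -x 0 * (Real.exp (-(s / ε)) * (-(1 / ε))) - M := by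
      have : x s + -z s = -(-x 0 * Real.exp (-(s / ε)) + ε * M) := by linarith
      rw [this]; field_simp; ring
    rw [h2]; linarith

theorem C3 (S : Sys M lam f g) {ε r : ℝ} (hε : 0 < ε) (hr : r = 4 * M * ε) {x y z : ℝ → ℝ}
    (h : Sol f g (fun w => min w r) ε x y z) (hz : z 0 = 0) (hx : x 0 < 0) {t₀ t η : ℝ}
    (h0 : 0 ≤ t₀) (hxt : 0 ≤ x t₀) (hy : ∀ s, t₀ ≤ s → s ≤ t → y s ≤ 0)
    (hη : 0 < η) (hl : 12 * lam * η < 1) (htη : t - t₀ ≤ 2 * η) :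
    ∀ s, t₀ ≤ s → s ≤ t → -(r / 2) ≤ x s := by
  have hrp : 0 < r := by rw [hr]; have := S.hM; positivity
  have hB : ∀ s, HasDerivAt (fun s => (r / 4) * (1 + (s - t₀) / (2 * η)))
      ((r / 4) * (1 / (2 * η))) s := by
    intro s
    exact ((((hasDerivAt_id s).sub_const t₀).div_const (2 * η)).const_add 1).const_mul _
  have hup : ∀ s, s ≤ t → (r / 4) * (1 + (s - t₀) / (2 * η)) ≤ r / 2 := by
    intro s hs
    have : (s - t₀) / (2 * η) ≤ 1 := by rw [div_le_one (by positivity)]; linarith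
    nlinarith
  have key := fence (u := fun s => -x s) (fun s => (h.dx s).neg) hB (a := t₀) (b := t) ?_ ?_
  · intro s h1 h2
    have := key s h1 h2
    have := hup s h2
    linarith
  · simp only [sub_self, zero_div, add_zero, mul_one]; linarith
  · intro s h1 h2 he
    have hx1 : -x s ≤ r / 2 := by rw [he]; exact hup s h2.le
    have hx2 : 0 < -x s := by
      rw [he]
      have : 0 ≤ (s - t₀) / (2 * η) := div_nonneg (by linarith) (by linarith)
      positivity
    have hz1 := C1 S hε h hz hx s (h0.trans h1)
    have hcz : |min (z s) r| ≤ r := by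
      rw [abs_le]
      refine ⟨le_min ?_ (by linarith), min_le_right _ _⟩
      have : ε * M = r / 4 := by rw [hr]; ring
      linarith
    have hL := S.Lf 0 (y s) 0 (x s) (y s) (min (z s) r)
    have hf0 := S.f0 (y s) (hy s h1 h2.le)
    have h3 := (abs_le.1 hL).2
    simp only [sub_self, abs_zero, zero_sub, abs_neg, add_zero] at h3
    rw [abs_of_neg (by linarith : x s < 0)] at h3
    have h4 : lam * (-x s + |min (z s) r|) ≤ lam * (3 / 2 * r) := by
      apply mul_le_mul_of_nonneg_left _ S.hlam; linarith
    have h5 : lam * (3 / 2 * r) < r / 4 * (1 / (2 * η)) := by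
      rw [mul_one_div, lt_div_iff₀ (by positivity)]
      nlinarith
    linarith

theorem C4 (S : Sys M lam f g) {ε r ω D t₂ : ℝ} {x y z p q : ℝ → ℝ}
    (h : Sol f g (fun w => min w r) ε x y z) (hP : PSol f g p q) (hxp : x 0 = p 0) (hyq : y 0 = q 0)
    (hω : 0 ≤ ω) (hD : 0 ≤ D) {t : ℝ} (ht : t ≤ t₂)
    (hc : ∀ s, ω ≤ s → s ≤ t → |min (z s) r - min (x s) 0| ≤ D) :
    ∀ s, 0 ≤ s → s ≤ t → |x s - p s| ≤ (2 * M * ω + lam * D * t₂) * Real.exp (3 * lam * t₂) ∧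
      |y s - q s| ≤ (2 * M * ω + lam * D * t₂) * Real.exp (3 * lam * t₂) := by
  intro s hs0 hst
  have hM := S.hM
  have hl := S.hlam
  have ht2 : 0 ≤ t₂ := by linarith
  have crude : ∀ s, 0 ≤ s → s ≤ ω → |x s - p s| ≤ 2 * M * ω ∧ |y s - q s| ≤ 2 * M * ω := by
    intro s h0 h1
    have hb : 2 * M * |s - 0| ≤ 2 * M * ω := by
      rw [sub_zero, abs_of_nonneg h0]; gcongr
    have e1 := lip_of_deriv (u := fun t => x t - p t) (C := 2 * M) (a := 0) (b := s)
      (fun t => (h.dx t).sub (hP.dp t)) (fun t _ => by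
        have h1 := S.bf (x t) (y t) (min (z t) r)
        have h2 := S.bf (p t) (q t) (min (p t) 0)
        have := abs_sub (f (x t) (y t) (min (z t) r)) (f (p t) (q t) (min (p t) 0))
        linarith)
    have e2 := lip_of_deriv (u := fun t => y t - q t) (C := 2 * M) (a := 0) (b := s)
      (fun t => (h.dy t).sub (hP.dq t)) (fun t _ => by
        have h1 := S.bg (x t) (y t) (min (z t) r)
        have h2 := S.bg (p t) (q t) (min (p t) 0)
        have := abs_sub (g (x t) (y t) (min (z t) r)) (g (p t) (q t) (min (p t) 0))
        linarith)
    simp only [hxp, hyq, sub_self] at e1 e2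
    rw [sub_zero] at hb e1 e2
    simp only [sub_zero] at *
    exact ⟨e1.trans hb, e2.trans hb⟩
  have hexp : 1 ≤ Real.exp (3 * lam * t₂) := Real.one_le_exp (by positivity)
  rcases le_total s ω with hsω | hsω
  · have hle : 2 * M * ω ≤ (2 * M * ω + lam * D * t₂) * Real.exp (3 * lam * t₂) := by
      have h1 : 0 ≤ lam * D * t₂ := by positivity
      have h2 : 0 ≤ 2 * M * ω := by positivity
      nlinarith
    exact ⟨(crude s hs0 hsω).1.trans hle, (crude s hs0 hsω).2.trans hle⟩
  · have hc0 := crude ω hω le_rfl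
    have key := dist_le_of_approx_trajectories_ODE (v := fun _ => Fl f g) (K := Real.toNNReal (3 * lam))
      (f := fun t => (x t, y t)) (g := fun t => (p t, q t)) (a := ω) (b := s)
      (f' := fun t => (f (x t) (y t) (min (z t) r), g (x t) (y t) (min (z t) r)))
      (g' := fun t => Fl f g (p t, q t)) (εf := lam * D) (εg := 0) (δ := 2 * M * ω)
      (fun _ => Fl_lip S)
      (fun t _ => ((h.dx t).prodMk (h.dy t)).continuousAt.continuousWithinAt)
      (fun t _ => ((h.dx t).prodMk (h.dy t)).hasDerivWithinAt)
      (fun t ht' => by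
        have h1 := hc t ht'.1 (ht'.2.le.trans hst)
        rw [Prod.dist_eq, Real.dist_eq, Real.dist_eq]
        simp only [Fl]
        apply max_le
        · refine (S.Lf _ _ _ _ _ _).trans ?_
          simp only [sub_self, abs_zero, zero_add]
          gcongr
        · refine (S.Lg _ _ _ _ _ _).trans ?_
          simp only [sub_self, abs_zero, zero_add]
          gcongr)
      (fun t _ => (hP.toFl t).continuousAt.continuousWithinAt)
      (fun t _ => (hP.toFl t).hasDerivWithinAt)
      (fun t _ => by simp)
      (by rw [Prod.dist_eq, Real.dist_eq, Real.dist_eq]; exact max_le hc0.1 hc0.2)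
      s ⟨hsω, le_rfl⟩
    rw [Real.coe_toNNReal _ (by positivity), add_zero] at key
    have hg := gronwall_le (δ := 2 * M * ω) (K := 3 * lam) (e := lam * D) (x := s - ω)
      (by positivity) (by positivity) (by positivity) (by linarith)
    have hfin : (2 * M * ω + lam * D * (s - ω)) * Real.exp (3 * lam * (s - ω)) ≤
        (2 * M * ω + lam * D * t₂) * Real.exp (3 * lam * t₂) := by
      have : s - ω ≤ t₂ := by linarith
      gcongr
    rw [Prod.dist_eq, Real.dist_eq, Real.dist_eq] at key
    have k1 := (key.trans hg).trans hfin
    exact ⟨(le_max_left _ _).trans k1, (le_max_right _ _).trans k1⟩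

end Canard
end

section
open Set Filter Topology Metric
open scoped NNReal

namespace Canard

structure PLoc (M lam : ℝ) (f g : ℝ → ℝ → ℝ → ℝ) (t₁ t₂ η c ρ : ℝ) (p q : ℝ → ℝ) : Prop where
  S : Sys M lam f g
  ht₁ : 0 < t₁
  ht₁₂ : t₁ ≤ t₂
  hη : 0 < η
  ht₂ : t₂ - t₁ ≤ 2 * η
  hlη : 12 * lam * η < 1
  hc : 0 < c
  hρ : 0 < ρ
  hlρ : 14 * lam * ρ ≤ g 0 0 0
  P : PSol f g p q
  pneg : ∀ s, 0 ≤ s → s ≤ t₁ → p s ≤ -c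
  q1 : q t₁ ≤ -c
  q2 : c ≤ q t₂
  sp : ∀ s, t₁ ≤ s → s ≤ t₂ → |p s| ≤ ρ
  sq : ∀ s, t₁ ≤ s → s ≤ t₂ → |q s| ≤ ρ

structure Loc (M lam : ℝ) (f g : ℝ → ℝ → ℝ → ℝ) (t₁ t₂ η c ρ ε ω D E : ℝ)
    (x y z p q : ℝ → ℝ) : Prop extends PLoc M lam f g t₁ t₂ η c ρ p q where
  hε : 0 < ε
  hω : 0 < ω
  hωt : ω ≤ t₁
  hE : (2 * M * ω + lam * D * t₂) * Real.exp (3 * lam * t₂) ≤ E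
  hEc : E < c
  hEρ : E ≤ ρ
  hDρ : D ≤ ρ
  hD6 : 6 * M * ε ≤ D
  hDX : ∀ s, ω ≤ s → -x 0 * Real.exp (-(s / ε)) + ε * M ≤ D
  h : Sol f g (fun w => min w (4 * M * ε)) ε x y z
  hx0 : x 0 = p 0
  hy0 : y 0 = q 0
  hz0 : z 0 = 0

variable {M lam : ℝ} {f g : ℝ → ℝ → ℝ → ℝ} {t₁ t₂ η c ρ ε ω D E : ℝ} {x y z p q : ℝ → ℝ}

namespace PLoc

theorem gbound (L : PLoc M lam f g t₁ t₂ η c ρ p q) {a b d : ℝ} (h : |a| + |b| + |d| ≤ 7 * ρ) :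
    g 0 0 0 / 2 ≤ g a b d := by
  have h1 := (abs_le.1 (L.S.Lg 0 0 0 a b d)).2
  simp only [zero_sub, abs_neg] at h1
  have h2 : lam * (|a| + |b| + |d|) ≤ lam * (7 * ρ) := mul_le_mul_of_nonneg_left h L.S.hlam
  linarith [L.hlρ]

theorem qgrow (L : PLoc M lam f g t₁ t₂ η c ρ p q) {a b : ℝ} (ha : t₁ ≤ a) (hab : a ≤ b)
    (hb : b ≤ t₂) : g 0 0 0 / 2 * (b - a) ≤ q b - q a := by
  refine growth_of_deriv L.P.dq hab fun t h1 h2 => L.gbound ?_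
  have e1 := L.sp t (ha.trans h1) (h2.trans hb)
  have e2 := L.sq t (ha.trans h1) (h2.trans hb)
  have e3 : |min (p t) 0| ≤ |p t| := by simpa using min_sub_le (p t) 0 0
  linarith [L.hρ]

theorem exists_T0 (L : PLoc M lam f g t₁ t₂ η c ρ p q) : ∃ T, t₁ ≤ T ∧ T ≤ t₂ ∧ q T = 0 := by
  have hq : Continuous q := continuous_iff_continuousAt.2 fun t => (L.P.dq t).continuousAt
  obtain ⟨T, hT, h⟩ := intermediate_value_Icc L.ht₁₂ hq.continuousOn
    (show (0:ℝ) ∈ Icc (q t₁) (q t₂) from ⟨by linarith [L.q1, L.hc], by linarith [L.q2, L.hc]⟩)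
  exact ⟨T, hT.1, hT.2, h⟩

theorem T_near (L : PLoc M lam f g t₁ t₂ η c ρ p q) {a b : ℝ} (ha : t₁ ≤ a) (ha' : a ≤ t₂)
    (hb : t₁ ≤ b) (hb' : b ≤ t₂) : g 0 0 0 / 2 * |b - a| ≤ |q b - q a| := by
  rcases le_total a b with h | h
  · rw [abs_of_nonneg (by linarith : 0 ≤ b - a)]
    exact (L.qgrow ha h hb').trans (le_abs_self _)
  · rw [abs_sub_comm, abs_sub_comm (q b), abs_of_nonneg (by linarith : 0 ≤ a - b)]
    exact (L.qgrow hb h ha').trans (le_abs_self _)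

end PLoc

namespace Loc

theorem hxneg (L : Loc M lam f g t₁ t₂ η c ρ ε ω D E x y z p q) : x 0 < 0 := by
  have := L.pneg 0 le_rfl L.ht₁.le
  rw [L.hx0]; linarith [L.hc]

theorem rpos (L : Loc M lam f g t₁ t₂ η c ρ ε ω D E x y z p q) : 0 < 4 * M * ε := by
  have := L.S.hM; have := L.hε; positivity

theorem lower (L : Loc M lam f g t₁ t₂ η c ρ ε ω D E x y z p q) {s : ℝ} (hs : 0 ≤ s) :
    x s - ε * M ≤ z s := C1 L.S L.hε L.h L.hz0 L.hxneg s hs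

theorem upper (L : Loc M lam f g t₁ t₂ η c ρ ε ω D E x y z p q) {s : ℝ} (hs : ω ≤ s)
    (hneg : ∀ u, 0 ≤ u → u ≤ s → z u ≤ 0) : z s - x s ≤ D :=
  (C2 L.S L.hε L.h L.hz0 hneg s (L.hω.le.trans hs) le_rfl).trans (L.hDX s hs)

theorem dbd_neg (L : Loc M lam f g t₁ t₂ η c ρ ε ω D E x y z p q) {s : ℝ} (hs : ω ≤ s)
    (hneg : ∀ u, 0 ≤ u → u ≤ s → z u ≤ 0) : |min (z s) (4 * M * ε) - min (x s) 0| ≤ D := by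
  have h0 := L.hω.le.trans hs
  have h1 := L.lower h0
  have h2 := L.upper hs hneg
  have h3 := hneg s h0 le_rfl
  have h4 := L.rpos
  have h5 := L.hD6
  rw [min_eq_left (by linarith), abs_le]
  constructor
  · have := min_le_left (x s) 0; linarith
  · rcases le_total (x s) 0 with h | h
    · rw [min_eq_left h]; exact h2
    · rw [min_eq_right h]; linarith

theorem dbd_pos (L : Loc M lam f g t₁ t₂ η c ρ ε ω D E x y z p q) {s : ℝ} (hs : 0 ≤ s)
    (hx : -(4 * M * ε / 2) ≤ x s) : |min (z s) (4 * M * ε) - min (x s) 0| ≤ D := by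
  have h1 := L.lower hs
  have h4 := L.rpos
  have h5 := L.hD6
  have h6 : -(4 * M * ε / 2) ≤ min (x s) 0 := le_min hx (by linarith)
  have h7 := min_le_right (z s) (4 * M * ε)
  have h8 : x s - ε * M ≤ min (z s) (4 * M * ε) ∨ 0 ≤ min (z s) (4 * M * ε) := by
    rcases le_total (z s) (4 * M * ε) with h | h
    · left; rw [min_eq_left h]; exact h1
    · right; rw [min_eq_right h]; exact h4.le
  have h9 := min_le_left (x s) 0
  have h10 := min_le_right (x s) 0
  rw [abs_le]
  constructor
  · rcases h8 with h | h <;> linarith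
  · linarith

theorem D0 (L : Loc M lam f g t₁ t₂ η c ρ ε ω D E x y z p q) : 0 ≤ D := by
  linarith [L.hD6, L.rpos]

theorem close (L : Loc M lam f g t₁ t₂ η c ρ ε ω D E x y z p q) {t : ℝ} (ht : t ≤ t₂)
    (hc : ∀ s, ω ≤ s → s ≤ t → |min (z s) (4 * M * ε) - min (x s) 0| ≤ D) :
    ∀ s, 0 ≤ s → s ≤ t → |x s - p s| ≤ E ∧ |y s - q s| ≤ E := by
  intro s h1 h2
  have := C4 L.S L.h L.P L.hx0 L.hy0 L.hω.le L.D0 ht hc s h1 h2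
  exact ⟨this.1.trans L.hE, this.2.trans L.hE⟩

theorem contz (L : Loc M lam f g t₁ t₂ η c ρ ε ω D E x y z p q) : Continuous z :=
  continuous_iff_continuousAt.2 fun t => (L.h.dz t).continuousAt

theorem conty (L : Loc M lam f g t₁ t₂ η c ρ ε ω D E x y z p q) : Continuous y :=
  continuous_iff_continuousAt.2 fun t => (L.h.dy t).continuousAt

theorem dich (L : Loc M lam f g t₁ t₂ η c ρ ε ω D E x y z p q) {t : ℝ} (ht : t ≤ t₂)
    (hy : ∀ s, t₁ ≤ s → s ≤ t → y s ≤ 0 ∨ t ≤ t₁) :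
    (∀ s, 0 ≤ s → s ≤ t → z s ≤ 0) ∨ ∃ t₀, t₁ ≤ t₀ ∧ t₀ ≤ t ∧ (∀ s, 0 ≤ s → s ≤ t₀ → z s ≤ 0) ∧
      ∀ s, t₀ ≤ s → s ≤ t → -(4 * M * ε / 2) ≤ x s := by
  by_cases hA : ∀ s, 0 ≤ s → s ≤ t → z s ≤ 0
  · exact Or.inl hA
  · right
    push Not at hA
    obtain ⟨t₀, h0, h1, hz, hneg, hd⟩ := first_time L.contz L.hz0.le hA
    have hx : 0 ≤ x t₀ := by
      have := hd _ (L.h.dz t₀)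
      rw [hz, abs_zero, add_zero] at this
      by_contra! hc
      have := div_neg_of_neg_of_pos hc L.hε
      linarith
    have hcl := L.close (h1.trans ht) (fun s hs hst => L.dbd_neg hs
      (fun u hu hus => hneg u hu (hus.trans hst))) t₀ h0 le_rfl
    have ht0 : t₁ < t₀ := by
      by_contra! hle
      have h2 := L.pneg t₀ h0 hle
      have h3 := (abs_le.1 hcl.1).2
      linarith [L.hEc]
    refine ⟨t₀, ht0.le, h1, hneg, ?_⟩
    refine C3 L.S L.hε rfl L.h L.hz0 L.hxneg h0 hx ?_ L.hη L.hlη ?_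
    · intro s hs hst
      rcases hy s (ht0.le.trans hs) hst with h | h
      · exact h
      · linarith
    · linarith [L.ht₂]

theorem C5 (L : Loc M lam f g t₁ t₂ η c ρ ε ω D E x y z p q) {t : ℝ} (ht : t ≤ t₂)
    (hy : ∀ s, t₁ ≤ s → s ≤ t → y s ≤ 0 ∨ t ≤ t₁) :
    (∀ s, ω ≤ s → s ≤ t → |min (z s) (4 * M * ε) - min (x s) 0| ≤ D) := by
  intro s hs hst
  rcases L.dich ht hy with h | ⟨t₀, h0, h1, hneg, hx⟩
  · exact L.dbd_neg hs fun u h1 h2 => h u h1 (h2.trans hst)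
  · rcases le_total s t₀ with h | h
    · exact L.dbd_neg hs fun u h1 h2 => hneg u h1 (h2.trans h)
    · exact L.dbd_pos (L.hω.le.trans hs) (hx s h hst)

theorem C6 (L : Loc M lam f g t₁ t₂ η c ρ ε ω D E x y z p q) :
    ∃ T, t₁ ≤ T ∧ T ≤ t₂ ∧ y T = 0 ∧ ∀ s, t₁ ≤ s → s ≤ T → y s ≤ 0 := by
  have h1 := L.close L.ht₁₂ (L.C5 L.ht₁₂ fun s _ _ => Or.inr le_rfl) t₁ L.ht₁.le le_rfl
  have hy1 : y t₁ ≤ 0 := by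
    have := (abs_le.1 h1.2).2
    linarith [L.q1, L.hEc]
  by_cases hA : ∀ s, t₁ ≤ s → s ≤ t₂ → y s ≤ 0
  · have h2 := L.close le_rfl (L.C5 le_rfl fun s hs hs' => Or.inl (hA s hs hs')) t₂
      (L.ht₁.le.trans L.ht₁₂) le_rfl
    have := (abs_le.1 h2.2).1
    have := hA t₂ L.ht₁₂ le_rfl
    linarith [L.q2, L.hEc]
  · push Not at hA
    obtain ⟨T, h0, h1, hz, hneg, -⟩ := first_time L.conty hy1 hA
    exact ⟨T, h0, h1, hz, hneg⟩

/-- `T` is the return time. -/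
structure Ret (t₁ t₂ T : ℝ) (y : ℝ → ℝ) : Prop where
  h1 : t₁ ≤ T
  h2 : T ≤ t₂
  hy : y T = 0
  hneg : ∀ s, t₁ ≤ s → s ≤ T → y s ≤ 0

variable {T : ℝ}

theorem closeT (L : Loc M lam f g t₁ t₂ η c ρ ε ω D E x y z p q) (R : Ret t₁ t₂ T y) :
    ∀ s, 0 ≤ s → s ≤ T → |x s - p s| ≤ E ∧ |y s - q s| ≤ E :=
  L.close R.h2 (L.C5 R.h2 fun s h1 h2 => Or.inl (R.hneg s h1 h2))

theorem ygrow (L : Loc M lam f g t₁ t₂ η c ρ ε ω D E x y z p q) (R : Ret t₁ t₂ T y)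
    {a b : ℝ} (ha : t₁ ≤ a) (hab : a ≤ b) (hb : b ≤ T) : g 0 0 0 / 2 * (b - a) ≤ y b - y a := by
  refine growth_of_deriv L.h.dy hab fun t h1 h2 => L.gbound ?_
  have ht1 := ha.trans h1
  have hcl := L.closeT R t (L.ht₁.le.trans ht1) (h2.trans hb)
  have e1 := L.sp t ht1 ((h2.trans hb).trans R.h2)
  have e2 := L.sq t ht1 ((h2.trans hb).trans R.h2)
  have e3 : |min (x t) 0| ≤ |x t| := by simpa using min_sub_le (x t) 0 0
  have e4 := L.C5 R.h2 (fun s h1 h2 => Or.inl (R.hneg s h1 h2)) t (L.hωt.trans ht1) (h2.trans hb)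
  have e5 := abs_sub_abs_le_abs_sub (x t) (p t)
  have e6 := abs_sub_abs_le_abs_sub (y t) (q t)
  have e7 := abs_sub_abs_le_abs_sub (min (z t) (4 * M * ε)) (min (x t) 0)
  have := L.hEρ
  have := L.hDρ
  linarith [hcl.1, hcl.2]

theorem T0_near (L : Loc M lam f g t₁ t₂ η c ρ ε ω D E x y z p q) (R : Ret t₁ t₂ T y) {T₀ : ℝ}
    (h1 : t₁ ≤ T₀) (h2 : T₀ ≤ t₂) (hq : q T₀ = 0) : |T - T₀| ≤ 2 * E / g 0 0 0 := by
  have e1 := L.T_near h1 h2 R.h1 R.h2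
  have e2 := (L.closeT R T (L.ht₁.le.trans R.h1) le_rfl).2
  rw [R.hy, zero_sub, abs_neg] at e2
  rw [hq, sub_zero] at e1
  rw [le_div_iff₀ L.S.g0]
  linarith

theorem X_near (L : Loc M lam f g t₁ t₂ η c ρ ε ω D E x y z p q) (R : Ret t₁ t₂ T y) {T₀ : ℝ}
    (h1 : t₁ ≤ T₀) (h2 : T₀ ≤ t₂) (hq : q T₀ = 0) :
    |x T - p T₀| ≤ E + M * (2 * E / g 0 0 0) := by
  have e1 := L.T0_near R h1 h2 hq
  have e2 := (L.closeT R T (L.ht₁.le.trans R.h1) le_rfl).1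
  have e3 := lip_of_deriv (a := T₀) (b := T) L.P.dp (fun t _ => (L.S.bf _ _ _).le)
  have e4 : M * |T - T₀| ≤ M * (2 * E / g 0 0 0) := mul_le_mul_of_nonneg_left e1 L.S.hM.le
  have := abs_sub_le (x T) (p T) (p T₀)
  linarith

theorem dichT (L : Loc M lam f g t₁ t₂ η c ρ ε ω D E x y z p q) (R : Ret t₁ t₂ T y) :
    (∀ s, 0 ≤ s → s ≤ T → z s ≤ 0) ∨ ∃ t₀, t₁ ≤ t₀ ∧ t₀ ≤ T ∧ (∀ s, 0 ≤ s → s ≤ t₀ → z s ≤ 0) ∧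
      ∀ s, t₀ ≤ s → s ≤ T → -(4 * M * ε / 2) ≤ x s :=
  L.dich R.h2 fun s h1 h2 => Or.inl (R.hneg s h1 h2)

theorem end_alt (L : Loc M lam f g t₁ t₂ η c ρ ε ω D E x y z p q) (R : Ret t₁ t₂ T y) :
    z T ≤ 0 ∨ -(2 * M * ε) ≤ x T := by
  rcases L.dichT R with h | ⟨t₀, h0, h1, hneg, hx⟩
  · exact Or.inl (h T (L.ht₁.le.trans R.h1) le_rfl)
  · right; have := hx T h1 le_rfl; linarith

theorem Zhat_near (L : Loc M lam f g t₁ t₂ η c ρ ε ω D E x y z p q) (R : Ret t₁ t₂ T y) :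
    |min (z T) (4 * M * ε + max (x T) 0) - x T| ≤ D := by
  have h4 := L.rpos
  have h5 := L.hD6
  have hT0 : 0 ≤ T := L.ht₁.le.trans R.h1
  have hl := L.lower hT0
  have hlow : x T - ε * M ≤ min (z T) (4 * M * ε + max (x T) 0) :=
    le_min hl (by have := le_max_left (x T) 0; linarith)
  rw [abs_le]
  refine ⟨by linarith, ?_⟩
  rcases L.dichT R with h | ⟨t₀, h0, h1, hneg, hx⟩
  · have := L.upper (L.hωt.trans R.h1) h
    linarith [min_le_left (z T) (4 * M * ε + max (x T) 0)]
  · have h6 := hx T h1 le_rfl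
    have h7 := min_le_right (z T) (4 * M * ε + max (x T) 0)
    rcases le_total (x T) 0 with h | h
    · rw [max_eq_right h] at h7 ⊢; linarith
    · rw [max_eq_left h] at h7 ⊢; linarith

theorem z_le (L : Loc M lam f g t₁ t₂ η c ρ ε ω D E x y z p q) (R : Ret t₁ t₂ T y)
    (hZ : z T < 4 * M * ε) : ∀ s, 0 ≤ s → s ≤ T → z s ≤ 4 * M * ε := by
  intro s hs hsT
  have h4 := L.rpos
  rcases L.dichT R with h | ⟨t₀, h0, h1, hneg, hx⟩
  · linarith [h s hs hsT]
  · rcases le_total s t₀ with h | h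
    · linarith [hneg s hs h]
    · by_contra! hc
      have := fence (u := fun _ => 4 * M * ε) (u' := fun _ => 0) (B := z) (a := s) (b := T)
        (fun t => hasDerivAt_const _ _) L.h.dz hc.le (fun t ht1 ht2 he => by
          have h6 := hx t (h.trans ht1) ht2.le
          rw [← he, abs_of_pos h4]
          apply div_pos _ L.hε
          linarith) T hsT le_rfl
      linarith

theorem true_sol (L : Loc M lam f g t₁ t₂ η c ρ ε ω D E x y z p q) (R : Ret t₁ t₂ T y)
    (hZ : z T < 4 * M * ε) {x' y' z' : ℝ → ℝ} (h : Sol f g id ε x' y' z')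
    (hx : x' 0 = x 0) (hy : y' 0 = y 0) (hz : z' 0 = 0) : x' T = x T ∧ y' T = 0 ∧ z' T = z T := by
  have hT0 : 0 ≤ T := L.ht₁.le.trans R.h1
  have hzl := L.z_le R hZ
  have key : EqOn (fun t => (x' t, y' t, z' t)) (fun t => (x t, y t, z t)) (Icc 0 T) :=
    ODE_solution_unique (v := fun _ => F3 f g id ε)
      (K := Real.toNNReal (3 * lam + 2 / ε)) (fun _ => F3_lip L.S (fun a b => le_rfl) L.hε)
      (fun t _ => (h.toF3 t).continuousAt.continuousWithinAt)
      (fun t _ => (h.toF3 t).hasDerivWithinAt)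
      (fun t _ => (L.h.toF3 t).continuousAt.continuousWithinAt)
      (fun t ht => by
        have := (L.h.toF3 t).hasDerivWithinAt (s := Ici t)
        simp only [F3] at this ⊢
        rw [min_eq_left (hzl t ht.1 ht.2.le)] at this
        exact this)
      (by simp [hx, hy, hz, L.hz0])
  have := key ⟨hT0, le_rfl⟩
  simp only [Prod.mk.injEq] at this
  exact ⟨this.1, this.2.1.trans R.hy, this.2.2⟩

end Loc

end Canard
end

section
open Set Filter Topology Metric
open scoped NNReal

namespace Canard

variable {M lam : ℝ} {f g : ℝ → ℝ → ℝ → ℝ}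

theorem PSol_dist (S : Sys M lam f g) {p q p' q' : ℝ → ℝ} (h : PSol f g p q) (h' : PSol f g p' q')
    {t t₂ d : ℝ} (ht : 0 ≤ t) (ht₂ : t ≤ t₂) (hp : |p 0 - p' 0| ≤ d) (hq : |q 0 - q' 0| ≤ d) :
    |p t - p' t| ≤ Real.exp (3 * lam * t₂) * d ∧ |q t - q' t| ≤ Real.exp (3 * lam * t₂) * d := by
  have hl := S.hlam
  have key := sol_dist (Fl_lip S) h.toFl h'.toFl ht
  rw [Real.coe_toNNReal _ (by positivity)] at key
  simp only [Prod.dist_eq, Real.dist_eq] at key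
  have hd : max |p 0 - p' 0| |q 0 - q' 0| ≤ d := max_le hp hq
  have hd0 : 0 ≤ d := (abs_nonneg _).trans hp
  have k2 : max |p t - p' t| |q t - q' t| ≤ Real.exp (3 * lam * t₂) * d := by
    refine key.trans ?_
    rw [mul_comm]
    gcongr
  exact ⟨(le_max_left _ _).trans k2, (le_max_right _ _).trans k2⟩

theorem Sol_dist (S : Sys M lam f g) {cc : ℝ → ℝ} (hc : ∀ a b, |cc a - cc b| ≤ |a - b|) {ε : ℝ}
    (hε : 0 < ε) {x y z x' y' z' : ℝ → ℝ} (h : Sol f g cc ε x y z) (h' : Sol f g cc ε x' y' z')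
    {t t₂ d : ℝ} (ht : 0 ≤ t) (ht₂ : t ≤ t₂) (hx : |x 0 - x' 0| ≤ d) (hy : |y 0 - y' 0| ≤ d)
    (hz : z 0 = z' 0) :
    |x t - x' t| ≤ Real.exp ((3 * lam + 2 / ε) * t₂) * d ∧
    |y t - y' t| ≤ Real.exp ((3 * lam + 2 / ε) * t₂) * d ∧
    |z t - z' t| ≤ Real.exp ((3 * lam + 2 / ε) * t₂) * d := by
  have hl := S.hlam
  have key := sol_dist (F3_lip S hc hε) h.toF3 h'.toF3 ht
  rw [Real.coe_toNNReal _ (by positivity)] at key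
  simp only [Prod.dist_eq, Real.dist_eq] at key
  have hd0 : 0 ≤ d := (abs_nonneg _).trans hx
  have hd : max |x 0 - x' 0| (max |y 0 - y' 0| |z 0 - z' 0|) ≤ d :=
    max_le hx (max_le hy (by rw [hz]; simpa using hd0))
  have k2 : max |x t - x' t| (max |y t - y' t| |z t - z' t|) ≤
      Real.exp ((3 * lam + 2 / ε) * t₂) * d := by
    refine key.trans ?_
    rw [mul_comm]
    gcongr
  exact ⟨(le_max_left _ _).trans k2, ((le_max_left _ _).trans (le_max_right _ _)).trans k2,
    ((le_max_right _ _).trans (le_max_right _ _)).trans k2⟩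

theorem limit_pkg (S : Sys M lam f g) {xa ya : ℝ → ℝ}
    (hxa : ∀ t : ℝ, HasDerivAt xa (f (xa t) (ya t) (xa t)) t)
    (hya : ∀ t : ℝ, HasDerivAt ya (g (xa t) (ya t) (xa t)) t)
    (hxa0 : xa 0 = 0) (hya0 : ya 0 = 0) {τ : ℝ} (hτ : τ < 0)
    (hneg : ∀ t, τ ≤ t → t < 0 → xa t < 0) :
    ∃ t₁ t₂ η c ρ R : ℝ, 0 < R ∧ t₁ ≤ -τ ∧ -τ ≤ t₂ ∧
      (∀ p q : ℝ → ℝ, PSol f g p q → |p 0 - xa τ| ≤ R → |q 0 - ya τ| ≤ R →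
        PLoc M lam f g t₁ t₂ η c ρ p q) ∧
      (∀ p q : ℝ → ℝ, PSol f g p q → p 0 = xa τ → q 0 = ya τ → p (-τ) = 0 ∧ q (-τ) = 0) := by
  have hM := S.hM
  have hl := S.hlam
  have hg0 := S.g0
  set T₀ := -τ with hT₀
  have hT0 : 0 < T₀ := by linarith
  obtain ⟨ρ, hρ⟩ : ∃ ρ, ρ = g 0 0 0 / (14 * (lam + 1)) := ⟨_, rfl⟩
  have hρp : 0 < ρ := by rw [hρ]; positivity
  have hlρ : 14 * lam * ρ ≤ g 0 0 0 := by
    have : ρ * (14 * (lam + 1)) = g 0 0 0 := by rw [hρ]; field_simp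
    nlinarith
  -- agreement with the attractive solution
  have agree : ∀ p q : ℝ → ℝ, PSol f g p q → p 0 = xa τ → q 0 = ya τ →
      ∀ t, 0 ≤ t → t ≤ T₀ → p t = xa (t + τ) ∧ q t = ya (t + τ) := by
    intro p q hP hp hq t h1 h2
    have key : EqOn (fun t => (p t, q t)) (fun t => (xa (t + τ), ya (t + τ))) (Icc 0 T₀) :=
      ODE_solution_unique (v := fun _ => Fl f g)
        (K := Real.toNNReal (3 * lam)) (fun _ => Fl_lip S)
        (fun t _ => (hP.toFl t).continuousAt.continuousWithinAt)
        (fun t _ => (hP.toFl t).hasDerivWithinAt)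
        (fun t _ => (((hxa (t + τ)).comp_add_const t τ).prodMk
          ((hya (t + τ)).comp_add_const t τ)).continuousAt.continuousWithinAt)
        (fun t ht => by
          have := (((hxa (t + τ)).comp_add_const t τ).prodMk
            ((hya (t + τ)).comp_add_const t τ)).hasDerivWithinAt (s := Ici t)
          simp only [Fl]
          rw [min_eq_left (hneg (t + τ) (by linarith [ht.1]) (by linarith [ht.2])).le]
          exact this)
        (by simp [hp, hq])
    have := key ⟨h1, h2⟩
    simp only [Prod.mk.injEq] at this
    exact this
  have agree0 : ∀ p q : ℝ → ℝ, PSol f g p q → p 0 = xa τ → q 0 = ya τ → p T₀ = 0 ∧ q T₀ = 0 := by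
    intro p q hP hp hq
    have := agree p q hP hp hq T₀ hT0.le le_rfl
    have e : T₀ + τ = 0 := by rw [hT₀]; ring
    rwa [e, hxa0, hya0] at this
  obtain ⟨p₀, q₀, hP₀, hp₀, hq₀⟩ := exists_PSol S (xa τ) (ya τ)
  have hz := agree0 p₀ q₀ hP₀ hp₀ hq₀
  obtain ⟨η, hη, hη1, hη2, hη3⟩ : ∃ η > 0, η < T₀ ∧ 12 * lam * η < 1 ∧ M * η ≤ ρ / 2 := by
    refine ⟨min (T₀ / 2) (min (1 / (24 * (lam + 1))) (ρ / (2 * M))), by positivity, ?_, ?_, ?_⟩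
    · exact (min_le_left _ _).trans_lt (by linarith)
    · have h1 : min (T₀ / 2) (min (1 / (24 * (lam + 1))) (ρ / (2 * M))) ≤ 1 / (24 * (lam + 1)) :=
        (min_le_right _ _).trans (min_le_left _ _)
      have h2 : 1 / (24 * (lam + 1)) * (24 * (lam + 1)) = 1 := by field_simp
      have h3 : 0 < 1 / (24 * (lam + 1)) := by positivity
      nlinarith
    · have h1 : min (T₀ / 2) (min (1 / (24 * (lam + 1))) (ρ / (2 * M))) ≤ ρ / (2 * M) :=
        (min_le_right _ _).trans (min_le_right _ _)
      calc M * _ ≤ M * (ρ / (2 * M)) := mul_le_mul_of_nonneg_left h1 hM.le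
        _ = ρ / 2 := by field_simp
  have contp : Continuous p₀ := continuous_iff_continuousAt.2 fun t => (hP₀.dp t).continuousAt
  obtain ⟨c₀, hc₀, hpc⟩ : ∃ c₀ > 0, ∀ s, 0 ≤ s → s ≤ T₀ - η → p₀ s ≤ -c₀ := by
    obtain ⟨a, ha, hmax⟩ := isCompact_Icc.exists_isMaxOn (s := Icc 0 (T₀ - η))
      ⟨0, le_rfl, by linarith⟩ contp.continuousOn
    refine ⟨-p₀ a, ?_, fun s h1 h2 => ?_⟩
    · rw [(agree p₀ q₀ hP₀ hp₀ hq₀ a ha.1 (by linarith [ha.2])).1]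
      have := hneg (a + τ) (by linarith [ha.1]) (by linarith [ha.2])
      linarith
    · rw [neg_neg]; exact hmax ⟨h1, h2⟩
  have sp : ∀ s, T₀ - η ≤ s → s ≤ T₀ + η → |p₀ s| ≤ ρ / 2 ∧ |q₀ s| ≤ ρ / 2 := by
    intro s h1 h2
    have hs : |s - T₀| ≤ η := abs_le.2 ⟨by linarith, by linarith⟩
    have e1 := lip_of_deriv (a := T₀) (b := s) hP₀.dp (fun t _ => (S.bf _ _ _).le)
    have e2 := lip_of_deriv (a := T₀) (b := s) hP₀.dq (fun t _ => (S.bg _ _ _).le)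
    rw [hz.1, sub_zero] at e1
    rw [hz.2, sub_zero] at e2
    have : M * |s - T₀| ≤ M * η := mul_le_mul_of_nonneg_left hs hM.le
    constructor <;> linarith
  have grow : ∀ a b, T₀ - η ≤ a → a ≤ b → b ≤ T₀ + η → g 0 0 0 / 2 * (b - a) ≤ q₀ b - q₀ a := by
    intro a b ha hab hb
    refine growth_of_deriv hP₀.dq hab fun t h1 h2 => ?_
    have h3 := (abs_le.1 (S.Lg 0 0 0 (p₀ t) (q₀ t) (min (p₀ t) 0))).2
    simp only [zero_sub, abs_neg] at h3
    have e := sp t (ha.trans h1) (h2.trans hb)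
    have e3 : |min (p₀ t) 0| ≤ |p₀ t| := by simpa using min_sub_le (p₀ t) 0 0
    have h4 : lam * (|p₀ t| + |q₀ t| + |min (p₀ t) 0|) ≤ lam * (7 * ρ) := by
      apply mul_le_mul_of_nonneg_left _ hl; linarith [e.1, e.2]
    linarith
  have q1 := grow (T₀ - η) T₀ le_rfl (by linarith) (by linarith)
  have q2 := grow T₀ (T₀ + η) (by linarith) (by linarith) le_rfl
  rw [hz.2] at q1 q2
  obtain ⟨c, hc, hcc₀, hcη⟩ : ∃ c > 0, 2 * c ≤ c₀ ∧ 2 * c ≤ g 0 0 0 / 2 * η := by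
    refine ⟨min c₀ (g 0 0 0 / 2 * η) / 2, by positivity, ?_, ?_⟩
    · linarith [min_le_left c₀ (g 0 0 0 / 2 * η)]
    · linarith [min_le_right c₀ (g 0 0 0 / 2 * η)]
  refine ⟨T₀ - η, T₀ + η, η, c, ρ, min c (ρ / 2) * Real.exp (-(3 * lam * (T₀ + η))), by positivity,
    by linarith, by linarith, ?_, agree0⟩
  intro p q hP hp hq
  rw [← hp₀] at hp
  rw [← hq₀] at hq
  have hd : ∀ s, 0 ≤ s → s ≤ T₀ + η → |p s - p₀ s| ≤ min c (ρ / 2) ∧ |q s - q₀ s| ≤ min c (ρ / 2) := by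
    intro s h1 h2
    have := PSol_dist S hP hP₀ h1 h2 hp hq
    have e : Real.exp (3 * lam * (T₀ + η)) * (min c (ρ / 2) * Real.exp (-(3 * lam * (T₀ + η)))) =
        min c (ρ / 2) := by
      rw [mul_left_comm, ← Real.exp_add]; simp
    rwa [e] at this
  have m1 := min_le_left c (ρ / 2)
  have m2 := min_le_right c (ρ / 2)
  refine ⟨S, by linarith, by linarith, hη, by linarith, hη2, hc, hρp, hlρ, hP, ?_, ?_, ?_, ?_, ?_⟩
  · intro s h1 h2
    have e1 := (abs_le.1 (hd s h1 (by linarith)).1).2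
    have := hpc s h1 h2
    linarith
  · have e1 := (abs_le.1 (hd (T₀ - η) (by linarith) (by linarith)).2).2
    linarith
  · have e1 := (abs_le.1 (hd (T₀ + η) (by linarith) (by linarith)).2).1
    linarith
  · intro s h1 h2
    have e1 := (hd s (by linarith) h2).1
    have e2 := (sp s h1 h2).1
    have := abs_sub_abs_le_abs_sub (p s) (p₀ s)
    linarith
  · intro s h1 h2
    have e1 := (hd s (by linarith) h2).2
    have e2 := (sp s h1 h2).2
    have := abs_sub_abs_le_abs_sub (q s) (q₀ s)
    linarith

theorem cont_T {B : Set (ℝ × ℝ)} {T : ℝ × ℝ → ℝ} {C : ℝ} (hC : 0 ≤ C)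
    (h : ∀ P ∈ B, ∀ Q ∈ B, |T P - T Q| ≤ C * dist P Q) : ContinuousOn T B := by
  have : LipschitzOnWith (Real.toNNReal C) T B := by
    refine LipschitzOnWith.of_dist_le_mul fun P hP Q hQ => ?_
    rw [Real.coe_toNNReal _ hC, Real.dist_eq]
    exact h P hP Q hQ
  exact this.continuousOn

theorem cont_eval {B : Set (ℝ × ℝ)} {u : ℝ × ℝ → ℝ → ℝ} {T : ℝ × ℝ → ℝ} {C t₂ : ℝ}
    (hu : ∀ P, Continuous (u P))
    (hd : ∀ P ∈ B, ∀ Q ∈ B, ∀ t, 0 ≤ t → t ≤ t₂ → |u P t - u Q t| ≤ C * dist P Q)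
    (hT : ContinuousOn T B) (hT0 : ∀ P ∈ B, 0 ≤ T P ∧ T P ≤ t₂) :
    ContinuousOn (fun P => u P (T P)) B := by
  intro Q hQ
  have h1 : Tendsto (fun P => u Q (T P)) (𝓝[B] Q) (𝓝 (u Q (T Q))) :=
    ((hu Q).tendsto (T Q)).comp (hT Q hQ)
  have h2 : Tendsto (fun P => u P (T P) - u Q (T P)) (𝓝[B] Q) (𝓝 0) := by
    have hz : Tendsto (fun P => C * dist P Q) (𝓝[B] Q) (𝓝 0) := by
      have : Continuous fun P : ℝ × ℝ => C * dist P Q := by fun_prop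
      have := this.tendsto Q
      simp only [dist_self, mul_zero] at this
      exact this.mono_left nhdsWithin_le_nhds
    refine squeeze_zero_norm' ?_ hz
    filter_upwards [self_mem_nhdsWithin] with P hP
    exact hd P hP Q hQ _ (hT0 P hP).1 (hT0 P hP).2
  have := h2.add h1
  simp only [sub_add_cancel, zero_add] at this
  exact this

theorem small {K c : ℝ} (hK : 0 ≤ K) (hc : 0 < c) : ∀ᶠ ω in 𝓝[>] (0:ℝ), K * ω < c := by
  have : Continuous fun ω : ℝ => K * ω := by fun_prop
  have := this.tendsto 0
  simp only [mul_zero] at this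
  exact (this.eventually (gt_mem_nhds hc)).filter_mono nhdsWithin_le_nhds

end Canard
end

section
open Set Filter Topology Metric
open scoped NNReal

namespace Canard

variable {M lam : ℝ} {f g : ℝ → ℝ → ℝ → ℝ}

def HalfEps (M : ℝ) (f g : ℝ → ℝ → ℝ → ℝ) (ξ : ℝ × ℝ → ℝ) (B : Set (ℝ × ℝ)) (η ε : ℝ) : Prop :=
  ∃ X Z T : ℝ × ℝ → ℝ, ContinuousOn X B ∧ ContinuousOn Z B ∧ ∀ P ∈ B, 0 < T P ∧
    |X P - ξ P| ≤ η ∧ |min (Z P) (4 * M * ε + max (X P) 0) - ξ P| ≤ η ∧ X P - ε * M ≤ Z P ∧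
    (Z P ≤ 0 ∨ -(2 * M * ε) ≤ X P) ∧
    (Z P < 4 * M * ε → ∀ x y z : ℝ → ℝ, Sol f g id ε x y z → x 0 = P.1 → y 0 = P.2 → z 0 = 0 →
      x (T P) = X P ∧ y (T P) = 0 ∧ z (T P) = Z P)

def ConeAt (ξ : ℝ × ℝ → ℝ) (w v : ℝ × ℝ) (R : ℝ) : Prop :=
  ∀ κ > 0, ∃ R' > 0, R' ≤ R ∧ ∀ P ∈ closedBall w R', ∀ Q ∈ closedBall w R', ξ P = ξ Q →
    ∃ s : ℝ, |P.1 - Q.1 - s * v.1| ≤ κ * |s| ∧ |P.2 - Q.2 - s * v.2| ≤ κ * |s|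

theorem fst_le_dist (P Q : ℝ × ℝ) : |P.1 - Q.1| ≤ dist P Q := by
  rw [← Real.dist_eq]; exact le_max_left _ _

theorem snd_le_dist (P Q : ℝ × ℝ) : |P.2 - Q.2| ≤ dist P Q := by
  rw [← Real.dist_eq]; exact le_max_right _ _

theorem exp_small {ω : ℝ} (hω : 0 < ω) : Real.exp (-(1 / ω)) ≤ ω := by
  rw [Real.exp_neg, inv_le_comm₀ (Real.exp_pos _) hω]
  have := Real.add_one_le_exp (1 / ω)
  rw [one_div] at *
  linarith

theorem eps_part {w : ℝ × ℝ} {R t₁ t₂ η c ρ : ℝ} {pp qq : ℝ × ℝ → ℝ → ℝ} {T₀ : ℝ × ℝ → ℝ}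
    (S : Sys M lam f g)
    (hR : 0 < R) (hp0 : ∀ P, pp P 0 = P.1) (hq0 : ∀ P, qq P 0 = P.2)
    (hL : ∀ P ∈ closedBall w R, PLoc M lam f g t₁ t₂ η c ρ (pp P) (qq P))
    (hT₀ : ∀ P ∈ closedBall w R, t₁ ≤ T₀ P ∧ T₀ P ≤ t₂ ∧ qq P (T₀ P) = 0)
    {η' : ℝ} (hη' : 0 < η') :
    ∃ ε₁ > 0, ∀ ε, 0 < ε → ε < ε₁ → HalfEps M f g (fun P => pp P (T₀ P)) (closedBall w R) η' ε := by
  have hM := S.hM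
  have hl := S.hlam
  have hg0 := S.g0
  have Lw := hL w (mem_closedBall_self hR.le)
  have ht₁ := Lw.ht₁
  have ht₂ : 0 < t₂ := ht₁.trans_le Lw.ht₁₂
  set D₀ : ℝ := |w.1| + R + 6 * M with hD₀
  have hD₀p : 0 < D₀ := by positivity
  set E₀ : ℝ := (2 * M + lam * D₀ * t₂) * Real.exp (3 * lam * t₂) with hE₀
  have hE₀p : 0 < E₀ := by positivity
  have hev : ∀ᶠ ω in 𝓝[>] (0:ℝ), 0 < ω ∧ 1 * ω < 1 ∧ 1 * ω < t₁ ∧ E₀ * ω < c ∧ E₀ * ω < ρ ∧ D₀ * ω < ρ ∧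
      (E₀ + M * (2 * E₀ / g 0 0 0) + D₀) * ω < η' := by
    filter_upwards [self_mem_nhdsWithin, small (K := 1) zero_le_one one_pos, small (K := 1) zero_le_one ht₁,
      small hE₀p.le Lw.hc, small hE₀p.le Lw.hρ, small hD₀p.le Lw.hρ,
      small (K := E₀ + M * (2 * E₀ / g 0 0 0) + D₀) (by positivity) hη'] with ω h1 h2 h3 h4 h5 h6 h7
    exact ⟨h1, h2, h3, h4, h5, h6, h7⟩
  obtain ⟨m, hm, hsub⟩ := mem_nhdsGT_iff_exists_Ioo_subset.1 hev
  have hm0 : 0 < m := hm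
  refine ⟨m ^ 2, by positivity, fun ε hε hεm => ?_⟩
  obtain ⟨ω, hωdef⟩ : ∃ ω, ω = Real.sqrt ε := ⟨_, rfl⟩
  have hω : 0 < ω := by rw [hωdef]; exact Real.sqrt_pos.2 hε
  have hωm : ω < m := by rw [hωdef]; exact (Real.sqrt_lt' hm0).2 hεm
  have hωε : ω * ω = ε := by rw [hωdef]; exact Real.mul_self_sqrt hε.le
  obtain ⟨-, h1, h3, h4, h5, h6, h7⟩ := hsub ⟨hω, hωm⟩
  rw [one_mul] at h1 h3
  have hεω : ε ≤ ω := by rw [← hωε]; nlinarith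
  have hcl : ∀ a b : ℝ, |min a (4 * M * ε) - min b (4 * M * ε)| ≤ |a - b| := fun a b => min_sub_le a b _
  -- clamped solutions
  choose x y z hsol hx0 hy0 hz0 using fun P : ℝ × ℝ => exists_Sol S hcl hε P.1 P.2 0
  have hLoc : ∀ P ∈ closedBall w R, Loc M lam f g t₁ t₂ η c ρ ε ω (D₀ * ω) (E₀ * ω)
      (x P) (y P) (z P) (pp P) (qq P) := by
    intro P hP
    refine { hL P hP with
      hε := hε, hω := hω, hωt := h3.le, hE := ?_, hEc := h4, hEρ := h5.le, hDρ := h6.le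
      hD6 := ?_, hDX := ?_, h := hsol P, hx0 := by rw [hx0, hp0], hy0 := by rw [hy0, hq0]
      hz0 := hz0 P }
    · apply le_of_eq; rw [hE₀]; ring
    · have : 0 ≤ (|w.1| + R) * ω := by positivity
      rw [hD₀]; nlinarith
    · intro s hs
      have e1 : -x P 0 ≤ |w.1| + R := by
        rw [hx0]
        have h1 : |P.1 - w.1| ≤ R := (fst_le_dist P w).trans hP
        have h2 := (abs_le.1 h1).1
        have h3 := neg_abs_le w.1
        linarith
      have e2 : Real.exp (-(s / ε)) ≤ ω := by
        refine le_trans (Real.exp_le_exp.2 ?_) (exp_small hω)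
        have : 1 / ω ≤ s / ε := by
          rw [div_le_div_iff₀ hω hε, ← hωε]; nlinarith
        linarith
      have e3 : -x P 0 * Real.exp (-(s / ε)) ≤ (|w.1| + R) * ω :=
        mul_le_mul e1 e2 (Real.exp_pos _).le (by positivity)
      have : ε * M ≤ ω * M := by gcongr
      rw [hD₀]; nlinarith
  have hTex : ∀ P : ℝ × ℝ, ∃ T, P ∈ closedBall w R → Loc.Ret t₁ t₂ T (y P) := by
    intro P
    by_cases hP : P ∈ closedBall w R
    · obtain ⟨T, h1, h2, h3, h4⟩ := (hLoc P hP).C6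
      exact ⟨T, fun _ => ⟨h1, h2, h3, h4⟩⟩
    · exact ⟨0, fun h => absurd h hP⟩
  choose T hT using hTex
  set C : ℝ := Real.exp ((3 * lam + 2 / ε) * t₂) with hC
  have hCp : 0 < C := Real.exp_pos _
  have hdist : ∀ P Q : ℝ × ℝ, ∀ t, 0 ≤ t → t ≤ t₂ → |x P t - x Q t| ≤ C * dist P Q ∧
      |y P t - y Q t| ≤ C * dist P Q ∧ |z P t - z Q t| ≤ C * dist P Q := by
    intro P Q t h1 h2
    exact Sol_dist S hcl hε (hsol P) (hsol Q) h1 h2 (by rw [hx0, hx0]; exact fst_le_dist P Q)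
      (by rw [hy0, hy0]; exact snd_le_dist P Q) (by rw [hz0, hz0])
  have hT0 : ∀ P ∈ closedBall w R, 0 ≤ T P ∧ T P ≤ t₂ := fun P hP =>
    ⟨ht₁.le.trans (hT P hP).h1, (hT P hP).h2⟩
  have hTl : ∀ P ∈ closedBall w R, ∀ Q ∈ closedBall w R, T P ≤ T Q →
      T Q - T P ≤ C * 2 / g 0 0 0 * dist P Q := by
    intro P hP Q hQ hle
    have e1 := (hLoc Q hQ).ygrow (hT Q hQ) (hT P hP).h1 hle le_rfl
    have e2 := (hdist P Q (T P) (hT0 P hP).1 (hT0 P hP).2).2.1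
    rw [(hT P hP).hy, zero_sub, abs_neg] at e2
    rw [(hT Q hQ).hy] at e1
    have e3 := neg_abs_le (y Q (T P))
    rw [div_mul_eq_mul_div, le_div_iff₀ hg0]
    linarith
  have hTc : ContinuousOn T (closedBall w R) := by
    refine cont_T (C := C * 2 / g 0 0 0) (by positivity) fun P hP Q hQ => ?_
    rcases le_total (T P) (T Q) with h | h
    · rw [abs_sub_comm, abs_of_nonneg (by linarith)]; exact hTl P hP Q hQ h
    · rw [dist_comm, abs_of_nonneg (by linarith)]; exact hTl Q hQ P hP h
  refine ⟨fun P => x P (T P), fun P => z P (T P), T, ?_, ?_, fun P hP => ?_⟩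
  · exact cont_eval (fun P => continuous_iff_continuousAt.2 fun t => ((hsol P).dx t).continuousAt)
      (fun P _ Q _ t h1 h2 => (hdist P Q t h1 h2).1) hTc hT0
  · exact cont_eval (fun P => continuous_iff_continuousAt.2 fun t => ((hsol P).dz t).continuousAt)
      (fun P _ Q _ t h1 h2 => (hdist P Q t h1 h2).2.2) hTc hT0
  · have L := hLoc P hP
    have Rt := hT P hP
    obtain ⟨a1, a2, a3⟩ := hT₀ P hP
    have b1 := L.X_near Rt a1 a2 a3
    have b2 := L.Zhat_near Rt
    have b3 : (E₀ + M * (2 * E₀ / g 0 0 0) + D₀) * ω =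
        E₀ * ω + M * (2 * (E₀ * ω) / g 0 0 0) + D₀ * ω := by ring
    have b4 : 0 < D₀ * ω := by positivity
    refine ⟨ht₁.trans_le Rt.h1, ?_, ?_, L.lower (hT0 P hP).1, L.end_alt Rt, ?_⟩
    · simp only; linarith
    · have := abs_sub_le (min (z P (T P)) (4 * M * ε + max (x P (T P)) 0)) (x P (T P)) (pp P (T₀ P))
      simp only; linarith
    · intro hZ x' y' z' hs e1 e2 e3
      exact L.true_sol Rt hZ hs (by rw [e1, hx0]) (by rw [e2, hy0]) e3

theorem half (S : Sys M lam f g) {xa ya : ℝ → ℝ}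
    (hxa : ∀ t : ℝ, HasDerivAt xa (f (xa t) (ya t) (xa t)) t)
    (hya : ∀ t : ℝ, HasDerivAt ya (g (xa t) (ya t) (xa t)) t)
    (hxa0 : xa 0 = 0) (hya0 : ya 0 = 0) {τ xs ys : ℝ} (hτ : τ < 0)
    (hneg : ∀ t, τ ≤ t → t < 0 → xa t < 0) (hxs : xa τ = xs) (hys : ya τ = ys) :
    ∃ R > 0, ∃ ξ : ℝ × ℝ → ℝ, ContinuousOn ξ (closedBall (xs, ys) R) ∧ ξ (xs, ys) = 0 ∧
      ConeAt ξ (xs, ys) (f xs ys xs, g xs ys xs) R ∧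
      ∀ η' > 0, ∃ ε₁ > 0, ∀ ε, 0 < ε → ε < ε₁ → HalfEps M f g ξ (closedBall (xs, ys) R) η' ε := by
  have hM := S.hM
  have hl := S.hlam
  have hg0 := S.g0
  obtain ⟨t₁, t₂, η, c, ρ, R, hR, h1, h2, hpk, h0⟩ := limit_pkg S hxa hya hxa0 hya0 hτ hneg
  rw [hxs, hys] at hpk h0
  have hxsn : xs < 0 := by rw [← hxs]; exact hneg τ le_rfl hτ
  choose pp qq hP hp0 hq0 using fun P : ℝ × ℝ => exists_PSol S P.1 P.2
  have hL : ∀ P ∈ closedBall (xs, ys) R, PLoc M lam f g t₁ t₂ η c ρ (pp P) (qq P) := by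
    intro P hPm
    refine hpk _ _ (hP P) ?_ ?_
    · rw [hp0]; exact (fst_le_dist P (xs, ys)).trans hPm
    · rw [hq0]; exact (snd_le_dist P (xs, ys)).trans hPm
  have hTex : ∀ P : ℝ × ℝ, ∃ T, P ∈ closedBall (xs, ys) R → t₁ ≤ T ∧ T ≤ t₂ ∧ qq P T = 0 := by
    intro P
    by_cases hPm : P ∈ closedBall (xs, ys) R
    · obtain ⟨T, h⟩ := (hL P hPm).exists_T0
      exact ⟨T, fun _ => h⟩
    · exact ⟨0, fun h => absurd h hPm⟩
  choose T hT using hTex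
  have hwm : (xs, ys) ∈ closedBall (xs, ys) R := mem_closedBall_self hR.le
  have ht₁ := (hL _ hwm).ht₁
  set C : ℝ := Real.exp (3 * lam * t₂) with hC
  have hCp : 0 < C := Real.exp_pos _
  have hdist : ∀ P Q : ℝ × ℝ, ∀ t, 0 ≤ t → t ≤ t₂ → |pp P t - pp Q t| ≤ C * dist P Q ∧
      |qq P t - qq Q t| ≤ C * dist P Q := by
    intro P Q t h1 h2
    exact PSol_dist S (hP P) (hP Q) h1 h2 (by rw [hp0, hp0]; exact fst_le_dist P Q)
      (by rw [hq0, hq0]; exact snd_le_dist P Q)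
  have hT0 : ∀ P ∈ closedBall (xs, ys) R, 0 ≤ T P ∧ T P ≤ t₂ := fun P hP =>
    ⟨ht₁.le.trans (hT P hP).1, (hT P hP).2.1⟩
  set K : ℝ := C * 2 / g 0 0 0 with hK
  have hKp : 0 < K := by positivity
  have hTl : ∀ P ∈ closedBall (xs, ys) R, ∀ Q ∈ closedBall (xs, ys) R, |T P - T Q| ≤ K * dist P Q := by
    intro P hPm Q hQm
    have e1 := (hL Q hQm).T_near (hT Q hQm).1 (hT Q hQm).2.1 (hT P hPm).1 (hT P hPm).2.1
    have e2 := (hdist P Q (T P) (hT0 P hPm).1 (hT0 P hPm).2).2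
    rw [(hT P hPm).2.2, zero_sub, abs_neg] at e2
    rw [(hT Q hQm).2.2, sub_zero] at e1
    rw [hK, div_mul_eq_mul_div, le_div_iff₀ hg0]
    linarith
  have hTc : ContinuousOn T (closedBall (xs, ys) R) := cont_T hKp.le hTl
  refine ⟨R, hR, fun P => pp P (T P), ?_, ?_, ?_, fun η' hη' => eps_part S hR hp0 hq0 hL hT hη'⟩
  · exact cont_eval (fun P => continuous_iff_continuousAt.2 fun t => ((hP P).dp t).continuousAt)
      (fun P _ Q _ t h1 h2 => (hdist P Q t h1 h2).1) hTc hT0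
  · have e0 := h0 _ _ (hP (xs, ys)) (hp0 _) (hq0 _)
    have e1 := (hL _ hwm).T_near h1 h2 (hT _ hwm).1 (hT _ hwm).2.1
    rw [(hT _ hwm).2.2, e0.2, sub_zero, abs_zero] at e1
    have e2 : |T (xs, ys) - -τ| = 0 := by
      have := abs_nonneg (T (xs, ys) - -τ)
      nlinarith
    have e3 : T (xs, ys) = -τ := by have := abs_eq_zero.1 e2; linarith
    simp only [e3]; exact e0.1
  · intro κ hκ
    set m : ℝ := 3 * lam * (1 + 2 * M * K) + 1 with hm
    have hmp : 0 < m := by positivity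
    refine ⟨min R (κ / m), by positivity, min_le_left _ _, ?_⟩
    set R' := min R (κ / m) with hR'
    have hR'R : R' ≤ R := min_le_left _ _
    have hR'p : 0 < R' := by positivity
    have hR'κ : m * R' ≤ κ := by
      have : R' ≤ κ / m := min_le_right _ _
      rw [le_div_iff₀ hmp] at this; linarith
    intro P hPm Q hQm heq
    have hPR := closedBall_subset_closedBall hR'R hPm
    have hQR := closedBall_subset_closedBall hR'R hQm
    set s := T P - T Q with hs
    have hshift := sol_shift (F := Fl f g) (u := fun t => (pp P t, qq P t)) (hP P).toFl s
    have hagree := sol_unique (Fl_lip S) (u := fun t => (pp P (t + s), qq P (t + s)))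
      (v := fun t => (pp Q t, qq Q t)) hshift (hP Q).toFl (t₀ := T Q) (by
        simp only [hs]
        rw [add_sub_cancel, (hT P hPR).2.2, (hT Q hQR).2.2]
        simp only [Prod.mk.injEq, and_true]
        exact heq)
    have hat0 := congrFun hagree 0
    simp only [zero_add, Prod.mk.injEq, hp0, hq0] at hat0
    have hdPQ : dist P Q ≤ 2 * R' := by
      have := dist_triangle_right P Q (xs, ys)
      have h1 : dist P (xs, ys) ≤ R' := hPm
      have h2 : dist Q (xs, ys) ≤ R' := hQm
      linarith
    have hsb : |s| ≤ K * (2 * R') := (hTl P hPR Q hQR).trans (by gcongr)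
    have hnear : ∀ t ∈ uIcc 0 s, |pp P t - xs| ≤ (1 + 2 * M * K) * R' ∧
        |qq P t - ys| ≤ (1 + 2 * M * K) * R' := by
      intro t ht
      have htab : |t - 0| ≤ |s - 0| := abs_sub_left_of_mem_uIcc ht
      rw [sub_zero, sub_zero] at htab
      have e1 := lip_of_deriv (a := 0) (b := t) (hP P).dp (fun t _ => (S.bf _ _ _).le)
      have e2 := lip_of_deriv (a := 0) (b := t) (hP P).dq (fun t _ => (S.bg _ _ _).le)
      rw [hp0, sub_zero] at e1
      rw [hq0, sub_zero] at e2
      have e3 : |P.1 - xs| ≤ R' := (fst_le_dist P (xs, ys)).trans hPm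
      have e4 : |P.2 - ys| ≤ R' := (snd_le_dist P (xs, ys)).trans hPm
      have e5 : M * |t| ≤ M * (K * (2 * R')) := by gcongr; exact htab.trans hsb
      have e6 := abs_sub_le (pp P t) P.1 xs
      have e7 := abs_sub_le (qq P t) P.2 ys
      have e8 : (1 + 2 * M * K) * R' = R' + M * (K * (2 * R')) := by ring
      rw [e8]
      constructor <;> linarith
    have hbd : ∀ t ∈ uIcc 0 s, lam * (|pp P t - xs| + |qq P t - ys| + |min (pp P t) 0 - xs|) ≤ κ := by
      intro t ht
      obtain ⟨e1, e2⟩ := hnear t ht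
      have e3 : |min (pp P t) 0 - xs| ≤ |pp P t - xs| := by
        have := min_sub_le (pp P t) xs 0
        rwa [min_eq_left hxsn.le] at this
      calc lam * (|pp P t - xs| + |qq P t - ys| + |min (pp P t) 0 - xs|)
          ≤ lam * (3 * ((1 + 2 * M * K) * R')) := by
            apply mul_le_mul_of_nonneg_left _ hl; linarith
        _ ≤ m * R' := by rw [hm]; nlinarith
        _ ≤ κ := hR'κ
    refine ⟨-s, ?_, ?_⟩
    · have := lip_of_deriv (a := 0) (b := s) (u := fun t => pp P t - t * f xs ys xs)
        (u' := fun t => f (pp P t) (qq P t) (min (pp P t) 0) - 1 * f xs ys xs) (C := κ)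
        (fun t => ((hP P).dp t).sub ((hasDerivAt_id t).mul_const _))
        (fun t ht => by
          rw [one_mul]; exact (S.Lf _ _ _ _ _ _).trans (hbd t ht))
      simp only [hat0.1, hp0, sub_zero, zero_mul] at this
      have e : P.1 - Q.1 - -s * f xs ys xs = -(Q.1 - s * f xs ys xs - P.1) := by ring
      simp only [e, abs_neg]
      exact this
    · have := lip_of_deriv (a := 0) (b := s) (u := fun t => qq P t - t * g xs ys xs)
        (u' := fun t => g (pp P t) (qq P t) (min (pp P t) 0) - 1 * g xs ys xs) (C := κ)
        (fun t => ((hP P).dq t).sub ((hasDerivAt_id t).mul_const _))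
        (fun t ht => by
          rw [one_mul]; exact (S.Lg _ _ _ _ _ _).trans (hbd t ht))
      simp only [hat0.2, hq0, sub_zero, zero_mul] at this
      have e : P.2 - Q.2 - -s * g xs ys xs = -(Q.2 - s * g xs ys xs - P.2) := by ring
      simp only [e, abs_neg]
      exact this

end Canard
end

section
open Set Filter Topology Metric
open scoped NNReal

namespace Canard

theorem cramer_bound {M a b c d h m s : ℝ} (hM : 0 < M) (ha : |a| < M) (hb : |b| < M)
    (hc : |c| < M) (hd : |d| < M) (hD : a * d - c * b ≠ 0)
    (h1 : |h * c + m * a| ≤ |a * d - c * b| / (8 * M) * |s|)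
    (h2 : |h * d + m * b| ≤ |a * d - c * b| / (8 * M) * |s|) :
    |h| ≤ |s| / 4 ∧ |m| ≤ |s| / 4 := by
  have hDp : 0 < |a * d - c * b| := abs_pos.2 hD
  set D := |a * d - c * b| with hDdef
  have key : ∀ u v : ℝ, |u| < M → |v| < M → ∀ n : ℝ,
      |n| * D = |(h * c + m * a) * u - (h * d + m * b) * v| → |n| ≤ |s| / 4 := by
    intro u v hu hv n hn
    have e1 : |(h * c + m * a) * u - (h * d + m * b) * v| ≤
        D / (8 * M) * |s| * M + D / (8 * M) * |s| * M := by
      refine (abs_sub _ _).trans ?_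
      rw [abs_mul, abs_mul]
      gcongr
    have e2 : D / (8 * M) * |s| * M + D / (8 * M) * |s| * M = |s| / 4 * D := by
      field_simp; ring
    rw [← hn, e2] at e1
    exact le_of_mul_le_mul_right e1 hDp
  constructor
  · refine key b a hb ha h ?_
    rw [hDdef, ← abs_mul, ← abs_neg]
    congr 1; ring
  · refine key d c hd hc m ?_
    rw [hDdef, ← abs_mul]
    congr 1; ring

theorem matching {X Za Zt r : ℝ} (hr : 0 < r) (h1 : X - r / 4 ≤ Za) (h2 : X - r / 4 ≤ Zt)
    (h3 : Za ≤ 0 ∨ -(r / 2) ≤ X) (h4 : Zt ≤ 0 ∨ -(r / 2) ≤ X)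
    (h5 : min Za (r + max X 0) + min Zt (r + max X 0) = 0) : Za = -Zt ∧ Za < r ∧ Zt < r := by
  have hX0 : 0 ≤ max X 0 := le_max_right _ _
  have hX1 : X ≤ max X 0 := le_max_left _ _
  have aux : ∀ A B : ℝ, X - r / 4 ≤ B → (A ≤ 0 ∨ -(r / 2) ≤ X) →
      min A (r + max X 0) + min B (r + max X 0) = 0 → A ≤ r + max X 0 := by
    intro A B hB hA h
    by_contra! hc
    rw [min_eq_right hc.le] at h
    have hX : -(r / 2) ≤ X := by
      rcases hA with h' | h'
      · linarith
      · exact h'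
    rcases min_choice B (r + max X 0) with h' | h' <;> rw [h'] at h <;> linarith
  have ea := aux Za Zt h2 h3 h5
  have et := aux Zt Za h1 h4 (by linarith)
  rw [min_eq_left ea, min_eq_left et] at h5
  refine ⟨by linarith, ?_, ?_⟩
  · by_contra! hc
    rcases h3 with h' | h' <;> linarith
  · by_contra! hc
    rcases h4 with h' | h' <;> linarith

variable {M lam : ℝ} {f g : ℝ → ℝ → ℝ → ℝ}

theorem Sys.rev (S : Sys M lam f g) (f1 : ∀ y, 0 ≤ y → f 0 y 0 ≤ 0) :
    Sys M lam (fun x y z => -f x (-y) (-z)) (fun x y z => g x (-y) (-z)) where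
  hM := S.hM
  hlam := S.hlam
  bf x y z := by rw [abs_neg]; exact S.bf _ _ _
  bg x y z := S.bg _ _ _
  Lf x₁ y₁ z₁ x₂ y₂ z₂ := by
    have h := S.Lf x₁ (-y₁) (-z₁) x₂ (-y₂) (-z₂)
    have e : ∀ a b : ℝ, |(-a) - (-b)| = |a - b| := fun a b => by
      rw [← abs_neg]; congr 1; ring
    rw [e y₁, e z₁] at h
    rwa [e]
  Lg x₁ y₁ z₁ x₂ y₂ z₂ := by
    have h := S.Lg x₁ (-y₁) (-z₁) x₂ (-y₂) (-z₂)
    have e : ∀ a b : ℝ, |(-a) - (-b)| = |a - b| := fun a b => by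
      rw [← abs_neg]; congr 1; ring
    rwa [e y₁, e z₁] at h
  g0 := by simpa using S.g0
  f0 y hy := by
    have := f1 (-y) (by linarith)
    simp only [neg_zero]
    linarith

theorem Sol.rev {ε : ℝ} {x y z : ℝ → ℝ} (h : Sol f g id ε x y z) :
    Sol (fun x y z => -f x (-y) (-z)) (fun x y z => g x (-y) (-z)) id ε
      (fun t => x (-t)) (fun t => -y (-t)) (fun t => -z (-t)) where
  dx t := by
    have := (h.dx (-t)).scomp t (hasDerivAt_neg t)
    simpa [Function.comp_def] using this
  dy t := by
    have := ((h.dy (-t)).scomp t (hasDerivAt_neg t)).fun_neg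
    simpa [Function.comp_def] using this
  dz t := by
    have := ((h.dz (-t)).scomp t (hasDerivAt_neg t)).fun_neg
    simpa [Function.comp_def] using this

/-- Periodic orbit through `(p, 0)`. -/
def Good (f g : ℝ → ℝ → ℝ → ℝ) (ε : ℝ) (p : ℝ × ℝ) : Prop :=
  ∃ x y z : ℝ → ℝ, ∃ Tp : ℝ, Sol f g id ε x y z ∧
    (∃ s t : ℝ, ¬ (x s = x t ∧ y s = y t ∧ z s = z t)) ∧ 0 < Tp ∧
    (∀ t : ℝ, x (t + Tp) = x t ∧ y (t + Tp) = y t ∧ z (t + Tp) = z t) ∧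
    x 0 = p.1 ∧ y 0 = p.2 ∧ z 0 = 0

theorem good_of_match (S : Sys M lam f g) {ε : ℝ} (hε : 0 < ε) {p : ℝ × ℝ} (hp : p.1 < 0)
    {T T' X Z : ℝ} (hT : 0 < T) (hT' : 0 < T')
    (h1 : ∀ x y z, Sol f g id ε x y z → x 0 = p.1 → y 0 = p.2 → z 0 = 0 →
      x T = X ∧ y T = 0 ∧ z T = Z)
    (h2 : ∀ x y z, Sol f g id ε x y z → x 0 = p.1 → y 0 = p.2 → z 0 = 0 →
      x (-T') = X ∧ y (-T') = 0 ∧ z (-T') = Z) : Good f g ε p := by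
  have hid : ∀ a b : ℝ, |id a - id b| ≤ |a - b| := fun a b => le_rfl
  obtain ⟨x, y, z, hs, hx0, hy0, hz0⟩ := exists_Sol S hid hε p.1 p.2 0
  obtain ⟨a1, a2, a3⟩ := h1 x y z hs hx0 hy0 hz0
  obtain ⟨b1, b2, b3⟩ := h2 x y z hs hx0 hy0 hz0
  refine ⟨x, y, z, T + T', hs, ?_, by linarith, ?_, hx0, hy0, hz0⟩
  · by_contra! hc
    have hz : z = fun _ => z 0 := funext fun t => ((hc t 0).2).2
    have hd := hs.dz 0
    have hd' : HasDerivAt z 0 0 := by rw [hz]; exact hasDerivAt_const _ _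
    have := hd.unique hd'
    rw [hx0, hz0, abs_zero, add_zero, div_eq_zero_iff] at this
    rcases this with h | h <;> linarith
  · have hu := hs.toF3
    have := sol_unique (F3_lip S hid hε) (sol_shift hu (T + T')) hu (t₀ := -T') (by
      have e : -T' + (T + T') = T := by ring
      simp only [e, a1, a2, a3, b1, b2, b3])
    intro t
    have h := congrFun this t
    simp only [Prod.mk.injEq] at h
    exact h

end Canard
end

section
open Set Filter Topology Metric
open scoped NNReal

namespace Canard

variable {M lam : ℝ} {f g : ℝ → ℝ → ℝ → ℝ}

theorem abs_le_of_mem {δ h : ℝ} (hh : h ∈ Icc (-δ) δ) : |h| ≤ δ := abs_le.2 hh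

theorem lin_bound {M a b h k δ : ℝ} (ha : |a| < M) (hb : |b| < M)
    (hh : h ∈ Icc (-δ) δ) (hk : k ∈ Icc (-δ) δ) : |h * a + k * b| ≤ 2 * M * δ := by
  have h1 := abs_le_of_mem hh
  have h2 := abs_le_of_mem hk
  have h3 := (abs_nonneg h).trans h1
  calc |h * a + k * b| ≤ |h| * |a| + |k| * |b| := by
        refine (abs_add_le _ _).trans ?_
        rw [abs_mul, abs_mul]
    _ ≤ δ * M + δ * M := by gcongr
    _ = 2 * M * δ := by ring

theorem sign_pos {σ ψ H c : ℝ} (hσ : |σ| = 1) (hc : 0 < c) (h : c ≤ σ * ψ)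
    (hH : |H - 2 * ψ| ≤ c) : 0 < σ * H := by
  have : |σ * (H - 2 * ψ)| ≤ c := by rw [abs_mul, hσ, one_mul]; exact hH
  have := (abs_le.1 this).1
  nlinarith

theorem sign_neg {σ ψ H c : ℝ} (hσ : |σ| = 1) (hc : 0 < c) (h : σ * ψ ≤ -c)
    (hH : |H - 2 * ψ| ≤ c) : σ * H < 0 := by
  have : |σ * (H - 2 * ψ)| ≤ c := by rw [abs_mul, hσ, one_mul]; exact hH
  have := (abs_le.1 this).2
  nlinarith

theorem canard_near (S : Sys M lam f g) {xs ys : ℝ} (hxs : xs < 0)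
    (hA : f xs ys xs * g xs ys (-xs) - f xs ys (-xs) * g xs ys xs ≠ 0)
    {R₁ R₂ : ℝ} {ξ₁ ξ₂ : ℝ × ℝ → ℝ}
    (c₁ : ContinuousOn ξ₁ (closedBall (xs, ys) R₁)) (z₁ : ξ₁ (xs, ys) = 0)
    (k₁ : ConeAt ξ₁ (xs, ys) (f xs ys xs, g xs ys xs) R₁)
    (H₁ : ∀ η' > 0, ∃ ε₁ > 0, ∀ ε, 0 < ε → ε < ε₁ →
      HalfEps M f g ξ₁ (closedBall (xs, ys) R₁) η' ε)
    (c₂ : ContinuousOn ξ₂ (closedBall (xs, -ys) R₂)) (z₂ : ξ₂ (xs, -ys) = 0)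
    (k₂ : ConeAt ξ₂ (xs, -ys) (-f xs ys (-xs), g xs ys (-xs)) R₂)
    (H₂ : ∀ η' > 0, ∃ ε₁ > 0, ∀ ε, 0 < ε → ε < ε₁ →
      HalfEps M (fun x y z => -f x (-y) (-z)) (fun x y z => g x (-y) (-z)) ξ₂
        (closedBall (xs, -ys) R₂) η' ε) {r : ℝ} (hr : 0 < r) :
    ∃ ε₁ > 0, ∀ ε, 0 < ε → ε < ε₁ → ∃ p : ℝ × ℝ, dist p (xs, ys) ≤ r ∧ Good f g ε p := by
  have hM := S.hM
  set va1 := f xs ys xs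
  set va2 := g xs ys xs
  set vr1 := f xs ys (-xs)
  set vr2 := g xs ys (-xs)
  have b1 : |va1| < M := S.bf _ _ _
  have b2 : |va2| < M := S.bg _ _ _
  have b3 : |vr1| < M := S.bf _ _ _
  have b4 : |vr2| < M := S.bg _ _ _
  set κ := |va1 * vr2 - vr1 * va2| / (8 * M) with hκ
  have hκp : 0 < κ := div_pos (abs_pos.2 hA) (by linarith)
  obtain ⟨Ra, hRa, hRa', ka⟩ := k₁ κ hκp
  obtain ⟨Rr, hRr, hRr', kr⟩ := k₂ κ hκp
  set ρ := min (min Ra Rr) (min r (-xs / 2)) with hρ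
  have hρp : 0 < ρ := lt_min (lt_min hRa hRr) (lt_min hr (by linarith))
  have ρ1 : ρ ≤ Ra := (min_le_left _ _).trans (min_le_left _ _)
  have ρ2 : ρ ≤ Rr := (min_le_left _ _).trans (min_le_right _ _)
  have ρ3 : ρ ≤ r := (min_le_right _ _).trans (min_le_left _ _)
  have ρ4 : ρ ≤ -xs / 2 := (min_le_right _ _).trans (min_le_right _ _)
  set δ := ρ / (2 * M) with hδ
  have hδp : 0 < δ := by positivity
  have hδρ : 2 * M * δ = ρ := by rw [hδ]; field_simp
  set Q := Icc (-δ) δ ×ˢ Icc (-δ) δ with hQ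
  set L : ℝ × ℝ → ℝ × ℝ := fun q => (xs + (q.1 * vr1 + q.2 * va1), ys + (q.1 * vr2 + q.2 * va2))
    with hL
  set N : ℝ × ℝ → ℝ × ℝ := fun q => ((L q).1, -(L q).2) with hN
  have cL : Continuous L := by fun_prop
  have cN : Continuous N := by fun_prop
  have dL : ∀ q ∈ Q, dist (L q) (xs, ys) ≤ ρ := by
    intro q hq
    rw [← hδρ]
    refine max_le ?_ ?_
    · rw [Real.dist_eq]
      simpa [hL] using lin_bound b3 b1 hq.1 hq.2
    · rw [Real.dist_eq]
      simpa [hL] using lin_bound b4 b2 hq.1 hq.2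
  have dN : ∀ q ∈ Q, dist (N q) (xs, -ys) ≤ ρ := by
    intro q hq
    refine max_le ((le_max_left _ _).trans (dL q hq)) ?_
    rw [Real.dist_eq]
    refine le_trans (le_of_eq ?_) ((le_max_right _ _).trans (dL q hq))
    rw [Real.dist_eq, ← abs_neg]
    congr 1
    simp only [hN]; ring
  have mL : MapsTo L Q (closedBall (xs, ys) R₁) := fun q hq =>
    mem_closedBall.2 ((dL q hq).trans (ρ1.trans hRa'))
  have mN : MapsTo N Q (closedBall (xs, -ys) R₂) := fun q hq =>
    mem_closedBall.2 ((dN q hq).trans (ρ2.trans hRr'))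
  obtain ⟨ca, hca, σa, hσa, sa1, sa2⟩ := side_signs hδp (ψ := fun q => ξ₁ (L q))
    (c₁.comp cL.continuousOn mL) (by simpa [hL] using z₁) (by
      intro p hp q hq he
      obtain ⟨s, e1, e2⟩ := ka (L p) (mem_closedBall.2 ((dL p hp).trans ρ1)) (L q)
        (mem_closedBall.2 ((dL q hq).trans ρ1)) he
      obtain ⟨u1, u2⟩ := cramer_bound (h := p.1 - q.1) (m := p.2 - q.2 - s) (s := s)
        hM b1 b2 b3 b4 hA
        (by convert e1 using 2; simp only [hL]; ring)
        (by convert e2 using 2; simp only [hL]; ring)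
      have := abs_sub_abs_le_abs_sub s (p.2 - q.2)
      rw [abs_sub_comm s] at this
      linarith)
  have mswap : ∀ q : ℝ × ℝ, q ∈ Q → q.swap ∈ Q := fun q hq => ⟨hq.2, hq.1⟩
  obtain ⟨cr, hcr, σr, hσr, sr1, sr2⟩ := side_signs hδp (ψ := fun q => ξ₂ (N q.swap))
    (c₂.comp (cN.comp continuous_swap).continuousOn (fun q hq => mN (mswap q hq)))
    (by simpa [hL, hN] using z₂) (by
      intro p hp q hq he
      obtain ⟨s, e1, e2⟩ := kr (N p.swap) (mem_closedBall.2 ((dN _ (mswap p hp)).trans ρ2))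
        (N q.swap) (mem_closedBall.2 ((dN _ (mswap q hq)).trans ρ2)) he
      obtain ⟨u1, u2⟩ := cramer_bound (h := p.2 - q.2 + s) (m := p.1 - q.1) (s := s)
        hM b1 b2 b3 b4 hA
        (by convert e1 using 2; simp only [hL, hN, Prod.fst_swap, Prod.snd_swap]; ring)
        (by rw [← abs_neg]; convert e2 using 2
            simp only [hL, hN, Prod.fst_swap, Prod.snd_swap]; ring)
      have := abs_sub_abs_le_abs_sub s (-(p.2 - q.2))
      rw [abs_neg] at this
      have e : s - -(p.2 - q.2) = p.2 - q.2 + s := by ring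
      rw [e] at this
      linarith)
  set η := min ca cr / 4 with hη
  have hηp : 0 < η := by have := lt_min hca hcr; positivity
  have η1 : 4 * η ≤ ca := by have := min_le_left ca cr; rw [hη]; linarith
  have η2 : 4 * η ≤ cr := by have := min_le_right ca cr; rw [hη]; linarith
  obtain ⟨εa, hεa, Ha⟩ := H₁ η hηp
  obtain ⟨εr, hεr, Hr⟩ := H₂ η hηp
  refine ⟨min εa εr, lt_min hεa hεr, fun ε hε hlt => ?_⟩
  obtain ⟨X, Z, T, cX, cZ, ha⟩ := Ha ε hε (hlt.trans_le (min_le_left _ _))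
  obtain ⟨X', Z', T', cX', cZ', hb⟩ := Hr ε hε (hlt.trans_le (min_le_right _ _))
  set E : ℝ × ℝ → ℝ := fun q => min (Z (L q)) (4 * M * ε + max (X (L q)) 0) +
    min (Z' (N q)) (4 * M * ε + max (X' (N q)) 0) with hE
  set D : ℝ × ℝ → ℝ := fun q => X (L q) - X' (N q) with hD
  have tX : ContinuousOn (fun q => X (L q)) Q := cX.comp cL.continuousOn mL
  have tZ : ContinuousOn (fun q => Z (L q)) Q := cZ.comp cL.continuousOn mL
  have tX' : ContinuousOn (fun q => X' (N q)) Q := cX'.comp cN.continuousOn mN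
  have tZ' : ContinuousOn (fun q => Z' (N q)) Q := cZ'.comp cN.continuousOn mN
  have tD : ContinuousOn D Q := tX.sub tX'
  have tE : ContinuousOn E Q :=
    (ContinuousOn.inf tZ (continuousOn_const.add (ContinuousOn.sup tX continuousOn_const))).add
      (ContinuousOn.inf tZ' (continuousOn_const.add (ContinuousOn.sup tX' continuousOn_const)))
  have est : ∀ q ∈ Q, |(E q + D q) - 2 * ξ₁ (L q)| ≤ ca ∧ |(E q - D q) - 2 * ξ₂ (N q)| ≤ cr := by
    intro q hq
    obtain ⟨-, i1, i2, -⟩ := ha _ (mL hq)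
    obtain ⟨-, j1, j2, -⟩ := hb _ (mN hq)
    rw [abs_le] at i1 i2 j1 j2
    simp only [hE, hD]
    constructor <;> rw [abs_le] <;> constructor <;> linarith [i1.1, i1.2, i2.1, i2.2, j1.1, j1.2, j2.1, j2.2]
  have m1 : δ ∈ Icc (-δ) δ := ⟨by linarith, le_rfl⟩
  have m2 : -δ ∈ Icc (-δ) δ := ⟨le_rfl, by linarith⟩
  obtain ⟨q, hq, g1, g2⟩ := miranda hδp (H₁ := fun q => σa * (E q + D q))
    (H₂ := fun q => σr * (E q - D q)) (continuousOn_const.mul (tE.add tD))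
    (continuousOn_const.mul (tE.sub tD))
    (fun k hk => sign_neg hσa hca (sa2 k hk) (est (-δ, k) ⟨m2, hk⟩).1)
    (fun k hk => sign_pos hσa hca (sa1 k hk) (est (δ, k) ⟨m1, hk⟩).1)
    (fun h hh => sign_neg hσr hcr (sr2 h hh) (est (h, -δ) ⟨hh, m2⟩).2)
    (fun h hh => sign_pos hσr hcr (sr1 h hh) (est (h, δ) ⟨hh, m1⟩).2)
  have nz : ∀ σ : ℝ, |σ| = 1 → σ ≠ 0 := by
    rintro σ h rfl
    simp at h
  have g1' := (mul_eq_zero.1 g1).resolve_left (nz _ hσa)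
  have g2' := (mul_eq_zero.1 g2).resolve_left (nz _ hσr)
  have hE0 : E q = 0 := by linarith
  have hD0 : D q = 0 := by linarith
  have hXX : X (L q) = X' (N q) := by simp only [hD] at hD0; linarith
  obtain ⟨i0, -, -, i3, i4, i5⟩ := ha _ (mL hq)
  obtain ⟨j0, -, -, j3, j4, j5⟩ := hb _ (mN hq)
  simp only [hE] at hE0
  rw [← hXX] at hE0 j3 j4
  have hr4 : 0 < 4 * M * ε := by positivity
  obtain ⟨n1, n2, n3⟩ := matching hr4 (by linarith) (by linarith)
    (i4.imp id fun h => by linarith) (j4.imp id fun h => by linarith) hE0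
  refine ⟨L q, (dL q hq).trans ρ3, ?_⟩
  have hp : (L q).1 < 0 := by
    have := (fst_le_dist (L q) (xs, ys)).trans ((dL q hq).trans ρ4)
    have := (abs_le.1 this).2
    simp only at this
    linarith
  refine good_of_match S hε hp i0 j0 (X := X (L q)) (Z := Z (L q)) (i5 n2) ?_
  intro x y z hs hx hy hz
  obtain ⟨o1, o2, o3⟩ := j5 n3 _ _ _ hs.rev (by simpa [hN] using hx) (by simpa [hN] using hy)
    (by simpa using hz)
  refine ⟨o1.trans hXX.symm, by linarith, by linarith⟩

theorem main
    (M lam : ℝ) (hM : 0 < M) (hlam : 0 ≤ lam)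
    (f g : ℝ → ℝ → ℝ → ℝ)
    (hbound : ∀ x y z : ℝ, |f x y z| < M ∧ |g x y z| < M)
    (hLipf : ∀ x₁ y₁ z₁ x₂ y₂ z₂ : ℝ,
      |f x₁ y₁ z₁ - f x₂ y₂ z₂| ≤ lam * (|x₁ - x₂| + |y₁ - y₂| + |z₁ - z₂|))
    (hLipg : ∀ x₁ y₁ z₁ x₂ y₂ z₂ : ℝ,
      |g x₁ y₁ z₁ - g x₂ y₂ z₂| ≤ lam * (|x₁ - x₂| + |y₁ - y₂| + |z₁ - z₂|))
    (hf000 : f 0 0 0 = 0) (hg000 : 0 < g 0 0 0)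
    (hyf : ∀ y : ℝ, y ≠ 0 → y * f 0 y 0 < 0)
    (xa ya xr yr : ℝ → ℝ)
    (hxa : ∀ t : ℝ, HasDerivAt xa (f (xa t) (ya t) (xa t)) t)
    (hya : ∀ t : ℝ, HasDerivAt ya (g (xa t) (ya t) (xa t)) t)
    (hxr : ∀ t : ℝ, HasDerivAt xr (f (xr t) (yr t) (-(xr t))) t)
    (hyr : ∀ t : ℝ, HasDerivAt yr (g (xr t) (yr t) (-(xr t))) t)
    (hxa0 : xa 0 = 0) (hya0 : ya 0 = 0) (hxr0 : xr 0 = 0) (hyr0 : yr 0 = 0)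
    (Ta Tr : ℝ)
    (hxaneg : ∀ t : ℝ, Ta < t → t < 0 → xa t < 0)
    (hxrneg : ∀ t : ℝ, 0 < t → t < Tr → xr t < 0)
    (τ σ xs ys : ℝ) (hτ₁ : Ta < τ) (hτ₂ : τ < 0) (hσ₁ : 0 < σ) (hσ₂ : σ < Tr)
    (hxaτ : xa τ = xs) (hxrσ : xr σ = xs) (hyaτ : ya τ = ys) (hyrσ : yr σ = ys)
    (hA : f xs ys xs * g xs ys (-xs) - f xs ys (-xs) * g xs ys xs ≠ 0) :
    ∃ ε₀ > (0 : ℝ), ∃ p : ℝ → ℝ × ℝ, (∀ ε : ℝ, 0 < ε → ε < ε₀ → Good f g ε (p ε)) ∧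
      (∀ η > (0 : ℝ), ∃ ε₁ > (0 : ℝ), ∀ ε : ℝ, 0 < ε → ε < ε₁ → ε < ε₀ →
        dist (p ε) (xs, ys) ≤ η) := by
  have f0 : ∀ y ≤ 0, 0 ≤ f 0 y 0 := by
    intro y hy
    rcases hy.eq_or_lt with rfl | h
    · exact hf000.ge
    · have := hyf y h.ne
      by_contra! hc
      nlinarith
  have f1 : ∀ y, 0 ≤ y → f 0 y 0 ≤ 0 := by
    intro y hy
    rcases hy.eq_or_lt with rfl | h
    · exact hf000.le
    · have := hyf y h.ne'
      by_contra! hc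
      nlinarith
  have S : Sys M lam f g := ⟨hM, hlam, fun x y z => (hbound x y z).1, fun x y z => (hbound x y z).2,
    hLipf, hLipg, hg000, f0⟩
  have S' := S.rev f1
  have hxs : xs < 0 := hxaτ ▸ hxaneg τ hτ₁ hτ₂
  obtain ⟨R₁, -, ξ₁, c₁, z₁, k₁, H₁⟩ := half S hxa hya hxa0 hya0 hτ₂
    (fun t h1 h2 => hxaneg t (hτ₁.trans_le h1) h2) hxaτ hyaτ
  obtain ⟨R₂, -, ξ₂, c₂, z₂, k₂, H₂⟩ := half S' (xa := fun t => xr (-t)) (ya := fun t => -yr (-t))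
    (fun t => by
      have := (hxr (-t)).scomp t (hasDerivAt_neg t)
      simpa [Function.comp_def] using this)
    (fun t => by
      have := ((hyr (-t)).scomp t (hasDerivAt_neg t)).fun_neg
      simpa [Function.comp_def] using this)
    (by simpa using hxr0) (by simpa using hyr0) (τ := -σ) (xs := xs) (ys := -ys) (by linarith)
    (fun t h1 h2 => hxrneg (-t) (by linarith) (by linarith)) (by simpa using hxrσ)
    (by simpa using hyrσ)
  have near : ∀ r > 0, ∃ ε₁ > 0, ∀ ε, 0 < ε → ε < ε₁ →
      ∃ p : ℝ × ℝ, dist p (xs, ys) ≤ r ∧ Good f g ε p := fun r hr =>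
    canard_near S hxs hA c₁ z₁ k₁ H₁ c₂ z₂ (by simpa using k₂) H₂ hr
  obtain ⟨ε₀, hε₀, h₀⟩ := near 1 one_pos
  have sel : ∀ ε, ∃ p : ℝ × ℝ, 0 < ε → ε < ε₀ → Good f g ε p ∧
      ∀ q, Good f g ε q → dist p (xs, ys) ≤ dist q (xs, ys) + ε := by
    intro ε
    by_cases h : 0 < ε ∧ ε < ε₀
    · obtain ⟨p₀, -, hp₀⟩ := h₀ ε h.1 h.2
      set A : Set ℝ := (fun p => dist p (xs, ys)) '' {p | Good f g ε p} with hAdef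
      have hbd : BddBelow A := ⟨0, by rintro _ ⟨p, -, rfl⟩; exact dist_nonneg⟩
      have hne : A.Nonempty := ⟨_, p₀, hp₀, rfl⟩
      obtain ⟨_, ⟨p, hp, rfl⟩, hlt⟩ := exists_lt_of_csInf_lt hne (show sInf A < sInf A + ε by linarith [h.1])
      refine ⟨p, fun _ _ => ⟨hp, fun q hq => ?_⟩⟩
      have : sInf A ≤ dist q (xs, ys) := csInf_le hbd ⟨q, hq, rfl⟩
      simp only at hlt
      linarith
    · exact ⟨0, fun h1 h2 => absurd ⟨h1, h2⟩ h⟩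
  choose p hp using sel
  refine ⟨ε₀, hε₀, p, fun ε h1 h2 => (hp ε h1 h2).1, fun η hη => ?_⟩
  obtain ⟨ε₁, hε₁, h₁⟩ := near (η / 2) (by linarith)
  refine ⟨min ε₁ (η / 2), lt_min hε₁ (by linarith), fun ε h1 h2 h3 => ?_⟩
  obtain ⟨q, hq1, hq2⟩ := h₁ ε h1 (h2.trans_le (min_le_left _ _))
  have := (hp ε h1 h3).2 q hq2
  have := h2.trans_le (min_le_right _ _)
  linarith

end Canard
end

/-- Under Assumptions 1–4, there exists `ε₀ > 0` such that for every
`ε ∈ (0, ε₀)` the slow–fast system has a non-constant periodic solution whose orbit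
contains a point `(x̂_ε, ŷ_ε, 0)` in the plane `z = 0`, and these periodic solutions
can be chosen so that `(x̂_ε, ŷ_ε) → (x*, y*)` as `ε → 0`. -/
theorem periodic_canard_through_plane
    (M lam : ℝ) (hM : 0 < M) (hlam : 0 ≤ lam)
    (f g : ℝ → ℝ → ℝ → ℝ)
    -- Assumption 1: global boundedness and global Lipschitz continuity
    (hbound : ∀ x y z : ℝ, |f x y z| < M ∧ |g x y z| < M)
    (hLipf : ∀ x₁ y₁ z₁ x₂ y₂ z₂ : ℝ,
      |f x₁ y₁ z₁ - f x₂ y₂ z₂| ≤ lam * (|x₁ - x₂| + |y₁ - y₂| + |z₁ - z₂|))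
    (hLipg : ∀ x₁ y₁ z₁ x₂ y₂ z₂ : ℝ,
      |g x₁ y₁ z₁ - g x₂ y₂ z₂| ≤ lam * (|x₁ - x₂| + |y₁ - y₂| + |z₁ - z₂|))
    -- Assumption 2
    (hf000 : f 0 0 0 = 0) (hg000 : 0 < g 0 0 0)
    (hyf : ∀ y : ℝ, y ≠ 0 → y * f 0 y 0 < 0)
    -- the solutions w*_a, w*_r of the attractive/repulsive reduced systems with
    -- initial condition x(0) = y(0) = 0
    (xa ya xr yr : ℝ → ℝ)
    (hxa : ∀ t : ℝ, HasDerivAt xa (f (xa t) (ya t) (xa t)) t)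
    (hya : ∀ t : ℝ, HasDerivAt ya (g (xa t) (ya t) (xa t)) t)
    (hxr : ∀ t : ℝ, HasDerivAt xr (f (xr t) (yr t) (-(xr t))) t)
    (hyr : ∀ t : ℝ, HasDerivAt yr (g (xr t) (yr t) (-(xr t))) t)
    (hxa0 : xa 0 = 0) (hya0 : ya 0 = 0) (hxr0 : xr 0 = 0) (hyr0 : yr 0 = 0)
    (Ta Tr : ℝ) (hTa : Ta < 0) (hTr : 0 < Tr)
    (hxaneg : ∀ t : ℝ, Ta < t → t < 0 → xa t < 0)
    (hxrneg : ∀ t : ℝ, 0 < t → t < Tr → xr t < 0)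
    -- Assumption 3: transversal intersection point (x*, y*)
    (τ σ xs ys : ℝ) (hτ₁ : Ta < τ) (hτ₂ : τ < 0) (hσ₁ : 0 < σ) (hσ₂ : σ < Tr)
    (hxaτ : xa τ = xs) (hxrσ : xr σ = xs) (hyaτ : ya τ = ys) (hyrσ : yr σ = ys)
    -- Assumption 4: transversality A ≠ 0
    (hA : f xs ys xs * g xs ys (-xs) - f xs ys (-xs) * g xs ys xs ≠ 0) :
    ∃ ε₀ > (0 : ℝ), ∃ xh yh : ℝ → ℝ,
      (∀ ε : ℝ, 0 < ε → ε < ε₀ → ∃ x y z : ℝ → ℝ, ∃ Tp : ℝ,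
        -- (x, y, z) is a solution of the slow–fast system on ℝ
        (∀ t : ℝ, HasDerivAt x (f (x t) (y t) (z t)) t) ∧
        (∀ t : ℝ, HasDerivAt y (g (x t) (y t) (z t)) t) ∧
        (∀ t : ℝ, HasDerivAt z ((x t + |z t|) / ε) t) ∧
        -- non-constant
        (∃ s t : ℝ, ¬ (x s = x t ∧ y s = y t ∧ z s = z t)) ∧
        -- periodic with some positive period Tp
        0 < Tp ∧
        (∀ t : ℝ, x (t + Tp) = x t ∧ y (t + Tp) = y t ∧ z (t + Tp) = z t) ∧
        -- the orbit contains the point (x̂_ε, ŷ_ε, 0) in the plane z = 0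
        (∃ t₀ : ℝ, x t₀ = xh ε ∧ y t₀ = yh ε ∧ z t₀ = 0)) ∧
      -- (x̂_ε, ŷ_ε) → (x*, y*) as ε → 0
      (∀ η > (0 : ℝ), ∃ ε₁ > (0 : ℝ), ∀ ε : ℝ, 0 < ε → ε < ε₁ → ε < ε₀ →
        |xh ε - xs| ≤ η ∧ |yh ε - ys| ≤ η) := by
  obtain ⟨ε₀, hε₀, p, h1, h2⟩ := Canard.main M lam hM hlam f g hbound hLipf hLipg hf000 hg000 hyf
    xa ya xr yr hxa hya hxr hyr hxa0 hya0 hxr0 hyr0 Ta Tr hxaneg hxrneg τ σ xs ys hτ₁ hτ₂ hσ₁ hσ₂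
    hxaτ hxrσ hyaτ hyrσ hA
  refine ⟨ε₀, hε₀, fun ε => (p ε).1, fun ε => (p ε).2, ?_, ?_⟩
  · intro ε e1 e2
    obtain ⟨x, y, z, Tp, hs, hn, hT, hper, hx, hy, hz⟩ := h1 ε e1 e2
    exact ⟨x, y, z, Tp, hs.dx, hs.dy, hs.dz, hn, hT, hper, 0, hx, hy, hz⟩
  · intro η hη
    obtain ⟨ε₁, hε₁, h⟩ := h2 η hη
    refine ⟨ε₁, hε₁, fun ε e1 e2 e3 => ?_⟩
    have := h ε e1 e2 e3
    exact ⟨(Canard.fst_le_dist (p ε) (xs, ys)).trans this,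
      (Canard.snd_le_dist (p ε) (xs, ys)).trans this⟩
end

section
/- Let (x, y, z) be a solution of the slow–fast system on an interval [t₀, T]. Then for every t ∈ [t₀, T] one has z(t) + x(t) ≥ (z(t₀) + x(t₀) − Mε) e^{(t − t₀)/ε} + Mε. In particular, if z(t₀) + x(t₀) > Mε, then z(t) + x(t) > Mε for all t ∈ [t₀, T]; that is, the set {(x,y,z) : z > −x + Mε} is forward invariant. -/
/-- For a solution of the slow–fast system on `[t₀, T]`,
`z(t) + x(t) ≥ (z(t₀) + x(t₀) - Mε) e^{(t - t₀)/ε} + Mε`; in particular the set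
`{z > -x + Mε}` is forward invariant. -/
theorem slowfast_phi_lower_bound
    (M lam ε t₀ T : ℝ) (hM : 0 < M) (hlam : 0 ≤ lam) (hε : 0 < ε) (hle : t₀ ≤ T)
    (f g : ℝ → ℝ → ℝ → ℝ)
    -- Assumption 1: global boundedness and global Lipschitz continuity
    (hbound : ∀ x y z : ℝ, |f x y z| < M ∧ |g x y z| < M)
    (hLipf : ∀ x₁ y₁ z₁ x₂ y₂ z₂ : ℝ,
      |f x₁ y₁ z₁ - f x₂ y₂ z₂| ≤ lam * (|x₁ - x₂| + |y₁ - y₂| + |z₁ - z₂|))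
    (hLipg : ∀ x₁ y₁ z₁ x₂ y₂ z₂ : ℝ,
      |g x₁ y₁ z₁ - g x₂ y₂ z₂| ≤ lam * (|x₁ - x₂| + |y₁ - y₂| + |z₁ - z₂|))
    -- (x, y, z) is a solution of the slow–fast system on [t₀, T]
    (x y z : ℝ → ℝ)
    (hx : ∀ t ∈ Set.Icc t₀ T, HasDerivAt x (f (x t) (y t) (z t)) t)
    (hy : ∀ t ∈ Set.Icc t₀ T, HasDerivAt y (g (x t) (y t) (z t)) t)
    (hz : ∀ t ∈ Set.Icc t₀ T, HasDerivAt z ((x t + |z t|) / ε) t) :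
    (∀ t ∈ Set.Icc t₀ T,
      z t + x t ≥ (z t₀ + x t₀ - M * ε) * Real.exp ((t - t₀) / ε) + M * ε) ∧
    (z t₀ + x t₀ > M * ε → ∀ t ∈ Set.Icc t₀ T, z t + x t > M * ε) := by
  have key : ∀ t ∈ Set.Icc t₀ T,
      z t + x t ≥ (z t₀ + x t₀ - M * ε) * Real.exp ((t - t₀) / ε) + M * ε := by
    have hd : ∀ t ∈ Set.Icc t₀ T, HasDerivAt
        (fun s => (z s + x s - M * ε) * Real.exp (-((s - t₀) / ε)))
        (((x t + |z t|) / ε + f (x t) (y t) (z t)) * Real.exp (-((t - t₀) / ε))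
          + (z t + x t - M * ε) * (Real.exp (-((t - t₀) / ε)) * (-(1 / ε)))) t := by
      intro t ht
      exact (((hz t ht).add (hx t ht)).sub_const (M * ε)).mul
        ((((hasDerivAt_id t).sub_const t₀).div_const ε).neg.exp)
    have hmono : MonotoneOn (fun s => (z s + x s - M * ε) * Real.exp (-((s - t₀) / ε)))
        (Set.Icc t₀ T) := by
      apply monotoneOn_of_deriv_nonneg (convex_Icc t₀ T)
      · exact fun t ht => (hd t ht).continuousAt.continuousWithinAt
      · exact fun t ht =>
          (hd t (interior_subset ht)).differentiableAt.differentiableWithinAt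
      · intro t ht
        rw [(hd t (interior_subset ht)).deriv]
        have h1 : 0 ≤ (|z t| - z t) / ε :=
          div_nonneg (sub_nonneg.2 (le_abs_self _)) hε.le
        have h2 := (abs_lt.1 (hbound (x t) (y t) (z t)).1).1
        have h3 : ((x t + |z t|) / ε + f (x t) (y t) (z t)) * Real.exp (-((t - t₀) / ε))
          + (z t + x t - M * ε) * (Real.exp (-((t - t₀) / ε)) * (-(1 / ε)))
          = ((|z t| - z t) / ε + (f (x t) (y t) (z t) + M)) *
            Real.exp (-((t - t₀) / ε)) := by
          field_simp
          ring
        rw [h3]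
        exact mul_nonneg (by linarith) (Real.exp_pos _).le
    intro t ht
    have h := hmono (Set.left_mem_Icc.2 hle) ht ht.1
    simp only [sub_self, zero_div, neg_zero, Real.exp_zero, mul_one] at h
    have h4 := mul_le_mul_of_nonneg_right h (Real.exp_pos ((t - t₀) / ε)).le
    rw [mul_assoc, ← Real.exp_add, neg_add_cancel, Real.exp_zero, mul_one] at h4
    linarith
  refine ⟨key, fun h0 t ht => ?_⟩
  have h := key t ht
  have h5 := mul_pos (sub_pos.2 h0) (Real.exp_pos ((t - t₀) / ε))
  linarith
end

section
/- Let (x, y, z) be a solution of the slow–fast system on an interval [t₀, T]. Then for every t ∈ [t₀, T] one has z(t) − x(t) ≥ (z(t₀) − x(t₀) + Mε) e^{−(t − t₀)/ε} − Mε. In particular, if z(t₀) − x(t₀) > −Mε, then z(t) − x(t) > −Mε for all t ∈ [t₀, T]; that is, the set {(x,y,z) : z > x − Mε} is forward invariant. -/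
/-- For a solution of the slow–fast system on `[t₀, T]`,
`z(t) - x(t) ≥ (z(t₀) - x(t₀) + Mε) e^{-(t - t₀)/ε} - Mε`; in particular the set
`{z > x - Mε}` is forward invariant. -/
theorem slowfast_psi_lower_bound
    (M lam ε t₀ T : ℝ) (hM : 0 < M) (hlam : 0 ≤ lam) (hε : 0 < ε) (hle : t₀ ≤ T)
    (f g : ℝ → ℝ → ℝ → ℝ)
    -- Assumption 1: global boundedness and global Lipschitz continuity
    (hbound : ∀ x y z : ℝ, |f x y z| < M ∧ |g x y z| < M)
    (hLipf : ∀ x₁ y₁ z₁ x₂ y₂ z₂ : ℝ,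
      |f x₁ y₁ z₁ - f x₂ y₂ z₂| ≤ lam * (|x₁ - x₂| + |y₁ - y₂| + |z₁ - z₂|))
    (hLipg : ∀ x₁ y₁ z₁ x₂ y₂ z₂ : ℝ,
      |g x₁ y₁ z₁ - g x₂ y₂ z₂| ≤ lam * (|x₁ - x₂| + |y₁ - y₂| + |z₁ - z₂|))
    -- (x, y, z) is a solution of the slow–fast system on [t₀, T]
    (x y z : ℝ → ℝ)
    (hx : ∀ t ∈ Set.Icc t₀ T, HasDerivAt x (f (x t) (y t) (z t)) t)
    (hy : ∀ t ∈ Set.Icc t₀ T, HasDerivAt y (g (x t) (y t) (z t)) t)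
    (hz : ∀ t ∈ Set.Icc t₀ T, HasDerivAt z ((x t + |z t|) / ε) t) :
    (∀ t ∈ Set.Icc t₀ T,
      z t - x t ≥ (z t₀ - x t₀ + M * ε) * Real.exp (-(t - t₀) / ε) - M * ε) ∧
    (z t₀ - x t₀ > -(M * ε) → ∀ t ∈ Set.Icc t₀ T, z t - x t > -(M * ε)) := by
  have key : ∀ t ∈ Set.Icc t₀ T,
      z t - x t ≥ (z t₀ - x t₀ + M * ε) * Real.exp (-(t - t₀) / ε) - M * ε := by
    have hd : ∀ t ∈ Set.Icc t₀ T, HasDerivAt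
        (fun s => (z s - x s + M * ε) * Real.exp ((s - t₀) / ε))
        (((x t + |z t|) / ε - f (x t) (y t) (z t)) * Real.exp ((t - t₀) / ε) +
          (z t - x t + M * ε) * (Real.exp ((t - t₀) / ε) * (1 / ε))) t := by
      intro t ht
      have h1 := ((hz t ht).sub (hx t ht)).add_const (M * ε)
      have h2 := (((hasDerivAt_id t).sub_const t₀).div_const ε).exp
      exact h1.mul h2
    have hmono : MonotoneOn (fun s => (z s - x s + M * ε) * Real.exp ((s - t₀) / ε))
        (Set.Icc t₀ T) := by
      apply monotoneOn_of_deriv_nonneg (convex_Icc t₀ T)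
      · exact fun t ht => (hd t ht).continuousAt.continuousWithinAt
      · exact fun t ht =>
          (hd t (interior_subset ht)).differentiableAt.differentiableWithinAt
      · intro t ht
        rw [(hd t (interior_subset ht)).deriv]
        have e : ((x t + |z t|) / ε - f (x t) (y t) (z t)) * Real.exp ((t - t₀) / ε) +
            (z t - x t + M * ε) * (Real.exp ((t - t₀) / ε) * (1 / ε)) =
            ((|z t| + z t) / ε + (M - f (x t) (y t) (z t))) * Real.exp ((t - t₀) / ε) := by
          field_simp
          ring
        rw [e]
        have h1 : 0 ≤ |z t| + z t := by linarith [neg_abs_le (z t)]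
        have h2 : 0 ≤ M - f (x t) (y t) (z t) := by
          linarith [le_abs_self (f (x t) (y t) (z t)), (hbound (x t) (y t) (z t)).1]
        positivity
    intro t ht
    have h := hmono (Set.left_mem_Icc.2 hle) ht ht.1
    simp only [sub_self, zero_div, Real.exp_zero, mul_one] at h
    have h3 := mul_le_mul_of_nonneg_right h (Real.exp_pos (-(t - t₀) / ε)).le
    rw [mul_assoc, ← Real.exp_add, neg_div, add_neg_cancel, Real.exp_zero, mul_one] at h3
    rw [neg_div]
    linarith
  refine ⟨key, fun h0 t ht => ?_⟩
  have h1 := key t ht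
  have h2 : 0 < (z t₀ - x t₀ + M * ε) * Real.exp (-(t - t₀) / ε) :=
    mul_pos (by linarith) (Real.exp_pos _)
  linarith
end

section
/- Let (x, y, z) be a solution of the slow–fast system on an interval [τ, T] with x(τ) < 0 and z(τ) = 0. Then z(t) > x(t) − Mε for all t ∈ [τ, T]. If, in addition, z(t₀) > −x(t₀) + Mε for some t₀ ∈ [τ, T], then z(t) > 0 for all t ∈ [t₀, T]. -/
theorem pos_of_deriv_ge_aux (u u' : ℝ → ℝ) (k a b : ℝ)
    (hu : ∀ t ∈ Set.Icc a b, HasDerivAt u (u' t) t)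
    (hk : ∀ t ∈ Set.Icc a b, k * u t ≤ u' t) (ha : 0 < u a) :
    ∀ t ∈ Set.Icc a b, 0 < u t := by
  intro t ht
  have hd : ∀ s ∈ Set.Icc a b, HasDerivAt (fun s => Real.exp (-k * s) * u s)
      (Real.exp (-k * s) * (-k) * u s + Real.exp (-k * s) * u' s) s := by
    intro s hs
    have h1 : HasDerivAt (fun s : ℝ => -k * s) (-k) s := by
      simpa using (hasDerivAt_id s).const_mul (-k)
    exact h1.exp.mul (hu s hs)
  have hmono : MonotoneOn (fun s => Real.exp (-k * s) * u s) (Set.Icc a b) := by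
    apply monotoneOn_of_deriv_nonneg (convex_Icc a b)
    · intro s hs
      exact (hd s hs).continuousAt.continuousWithinAt
    · intro s hs
      exact (hd s (interior_subset hs)).differentiableAt.differentiableWithinAt
    · intro s hs
      rw [(hd s (interior_subset hs)).deriv]
      have h2 := hk s (interior_subset hs)
      have h3 := mul_nonneg (Real.exp_pos (-k * s)).le (sub_nonneg.2 h2)
      linarith
  have h := hmono (Set.left_mem_Icc.2 (ht.1.trans ht.2)) ht ht.1
  have h0 : 0 < Real.exp (-k * a) * u a := mul_pos (Real.exp_pos _) ha
  exact pos_of_mul_pos_right (lt_of_lt_of_le h0 h) (Real.exp_pos _).le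

/-- For a solution of the slow–fast system on `[τ, T]` with
`x(τ) < 0` and `z(τ) = 0`, one has `z(t) > x(t) - Mε` for all `t ∈ [τ, T]`; and if
additionally `z(t₀) > -x(t₀) + Mε` at some `t₀ ∈ [τ, T]`, then `z(t) > 0` for all
`t ∈ [t₀, T]`. -/
theorem slowfast_invariant_sets
    (M lam ε τ T : ℝ) (hM : 0 < M) (hlam : 0 ≤ lam) (hε : 0 < ε) (hle : τ ≤ T)
    (f g : ℝ → ℝ → ℝ → ℝ)
    -- Assumption 1: global boundedness and global Lipschitz continuity
    (hbound : ∀ x y z : ℝ, |f x y z| < M ∧ |g x y z| < M)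
    (hLipf : ∀ x₁ y₁ z₁ x₂ y₂ z₂ : ℝ,
      |f x₁ y₁ z₁ - f x₂ y₂ z₂| ≤ lam * (|x₁ - x₂| + |y₁ - y₂| + |z₁ - z₂|))
    (hLipg : ∀ x₁ y₁ z₁ x₂ y₂ z₂ : ℝ,
      |g x₁ y₁ z₁ - g x₂ y₂ z₂| ≤ lam * (|x₁ - x₂| + |y₁ - y₂| + |z₁ - z₂|))
    -- (x, y, z) is a solution of the slow–fast system on [τ, T]
    (x y z : ℝ → ℝ)
    (hx : ∀ t ∈ Set.Icc τ T, HasDerivAt x (f (x t) (y t) (z t)) t)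
    (hy : ∀ t ∈ Set.Icc τ T, HasDerivAt y (g (x t) (y t) (z t)) t)
    (hz : ∀ t ∈ Set.Icc τ T, HasDerivAt z ((x t + |z t|) / ε) t)
    -- initial conditions
    (hxτ : x τ < 0) (hzτ : z τ = 0) :
    (∀ t ∈ Set.Icc τ T, z t > x t - M * ε) ∧
    (∀ t₀ ∈ Set.Icc τ T, z t₀ > -(x t₀) + M * ε →
      ∀ t ∈ Set.Icc t₀ T, z t > 0) := by
  have h1 : ∀ t ∈ Set.Icc τ T, 0 < z t - x t + M * ε := by
    apply pos_of_deriv_ge_aux (fun t => z t - x t + M * ε)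
      (fun t => (x t + |z t|) / ε - f (x t) (y t) (z t)) (-(1 / ε)) τ T
    · intro t ht
      exact ((hz t ht).sub (hx t ht)).add_const _
    · intro t ht
      have hf := (abs_lt.1 (hbound (x t) (y t) (z t)).1).2
      have h2 : (x t - z t) / ε ≤ (x t + |z t|) / ε := by
        gcongr
        linarith [neg_abs_le (z t)]
      have h3 : -(1 / ε) * (z t - x t + M * ε) = (x t - z t) / ε - M := by
        field_simp
        ring
      show -(1 / ε) * (z t - x t + M * ε) ≤ _
      rw [h3]
      linarith
    · have := mul_pos hM hε
      show 0 < z τ - x τ + M * ε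
      linarith
  refine ⟨fun t ht => by linarith [h1 t ht], ?_⟩
  intro t₀ ht₀ h0 t ht
  have hsub : ∀ s ∈ Set.Icc t₀ T, s ∈ Set.Icc τ T := fun s hs => ⟨ht₀.1.trans hs.1, hs.2⟩
  have h2 : ∀ t ∈ Set.Icc t₀ T, 0 < z t + x t - M * ε := by
    apply pos_of_deriv_ge_aux (fun t => z t + x t - M * ε)
      (fun t => (x t + |z t|) / ε + f (x t) (y t) (z t)) (1 / ε) t₀ T
    · intro t ht
      exact ((hz t (hsub t ht)).add (hx t (hsub t ht))).sub_const _
    · intro t ht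
      have hf := (abs_lt.1 (hbound (x t) (y t) (z t)).1).1
      have h2 : (x t + z t) / ε ≤ (x t + |z t|) / ε := by
        gcongr
        exact le_abs_self _
      have h3 : (1 / ε) * (z t + x t - M * ε) = (x t + z t) / ε - M := by
        field_simp
        ring
      show (1 / ε) * (z t + x t - M * ε) ≤ _
      rw [h3]
      linarith
    · show 0 < z t₀ + x t₀ - M * ε
      linarith
  linarith [h1 t (hsub t ht), h2 t ht]
end

section
/- Let (x, y, z) be a solution of the slow–fast system on [τ, T_r] with x(τ) = x₀ < −Mε and z(τ) = 0, and set t₁ = τ + ε ln(−x₀/(Mε)) (so t₁ > τ); assume t₁ ≤ T_r. Then z(t) < 0 for all t with τ < t ≤ t₁. -/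
/-- For a solution of the slow–fast system on `[τ, T_r]` with
`x(τ) = x₀ < -Mε` and `z(τ) = 0`, setting `t₁ = τ + ε ln(-x₀/(Mε))` (so `t₁ > τ`),
and assuming `t₁ ≤ T_r`, one has `z(t) < 0` for all `τ < t ≤ t₁`. -/
theorem slowfast_z_negative_initially
    (M lam ε τ Tr x₀ t₁ : ℝ) (hM : 0 < M) (hlam : 0 ≤ lam) (hε : 0 < ε)
    (f g : ℝ → ℝ → ℝ → ℝ)
    -- Assumption 1: global boundedness and global Lipschitz continuity
    (hbound : ∀ x y z : ℝ, |f x y z| < M ∧ |g x y z| < M)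
    (hLipf : ∀ x₁ y₁ z₁ x₂ y₂ z₂ : ℝ,
      |f x₁ y₁ z₁ - f x₂ y₂ z₂| ≤ lam * (|x₁ - x₂| + |y₁ - y₂| + |z₁ - z₂|))
    (hLipg : ∀ x₁ y₁ z₁ x₂ y₂ z₂ : ℝ,
      |g x₁ y₁ z₁ - g x₂ y₂ z₂| ≤ lam * (|x₁ - x₂| + |y₁ - y₂| + |z₁ - z₂|))
    -- (x, y, z) is a solution of the slow–fast system on [τ, T_r]
    (x y z : ℝ → ℝ)
    (hx : ∀ t ∈ Set.Icc τ Tr, HasDerivAt x (f (x t) (y t) (z t)) t)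
    (hy : ∀ t ∈ Set.Icc τ Tr, HasDerivAt y (g (x t) (y t) (z t)) t)
    (hz : ∀ t ∈ Set.Icc τ Tr, HasDerivAt z ((x t + |z t|) / ε) t)
    -- initial conditions
    (hxτ : x τ = x₀) (hx₀ : x₀ < -(M * ε)) (hzτ : z τ = 0)
    -- the time moment t₁
    (ht₁ : t₁ = τ + ε * Real.log (-x₀ / (M * ε))) (ht₁Tr : t₁ ≤ Tr) :
    τ < t₁ ∧ ∀ t : ℝ, τ < t → t ≤ t₁ → z t < 0 := by
  have hMe : 0 < M * ε := mul_pos hM hε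
  have ha : 1 < -x₀ / (M * ε) := by
    rw [lt_div_iff₀ hMe]; linarith
  have hlog : 0 < Real.log (-x₀ / (M * ε)) := Real.log_pos ha
  have hlog2 : Real.log (-x₀ / (M * ε)) < -x₀ / (M * ε) := by
    have := Real.log_le_sub_one_of_pos (by linarith : 0 < -x₀ / (M * ε))
    linarith
  have hτ : τ < t₁ := by
    have := mul_pos hε hlog
    linarith
  refine ⟨hτ, ?_⟩
  have hsub : ∀ t ∈ Set.Icc τ t₁, t ∈ Set.Icc τ Tr := fun t ht => ⟨ht.1, ht.2.trans ht₁Tr⟩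
  -- `x` stays negative on `[τ, t₁]`
  have hxneg : ∀ t ∈ Set.Icc τ t₁, x t < 0 := by
    intro t ht
    have h1 := norm_image_sub_le_of_norm_deriv_le_segment' (f := x) (C := M)
      (f' := fun t => f (x t) (y t) (z t)) (a := τ) (b := t₁)
      (fun s hs => (hx s (hsub s hs)).hasDerivWithinAt)
      (fun s _ => by rw [Real.norm_eq_abs]; exact (hbound _ _ _).1.le) t ht
    rw [Real.norm_eq_abs] at h1
    have h2 := (abs_le.1 h1).2
    have h3 : M * (t - τ) ≤ M * (ε * Real.log (-x₀ / (M * ε))) :=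
      mul_le_mul_of_nonneg_left (by linarith [ht.2]) hM.le
    have h4 := (lt_div_iff₀ hMe).1 hlog2
    nlinarith
  have hder : ∀ t ∈ Set.Icc τ t₁, z t = 0 → (x t + |z t|) / ε < 0 := by
    intro t ht h0
    apply div_neg_of_neg_of_pos _ hε
    rw [h0, abs_zero, add_zero]
    exact hxneg t ht
  have hle : ∀ t ∈ Set.Icc τ t₁, z t ≤ 0 := by
    intro t ht
    exact image_le_of_deriv_right_lt_deriv_boundary' (f := z)
      (f' := fun t => (x t + |z t|) / ε) (B := fun _ => 0) (B' := fun _ => 0)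
      (fun s hs => (hz s (hsub s hs)).continuousAt.continuousWithinAt)
      (fun s hs => (hz s (hsub s ⟨hs.1, hs.2.le⟩)).hasDerivWithinAt)
      hzτ.le continuousOn_const (fun s _ => hasDerivWithinAt_const _ _ _)
      (fun s hs h0 => hder s ⟨hs.1, hs.2.le⟩ h0) ht
  intro t h1 h2
  have ht : t ∈ Set.Icc τ t₁ := ⟨h1.le, h2⟩
  refine lt_of_le_of_ne (hle t ht) fun h0 => ?_
  have hs := (hasDerivAt_iff_tendsto_slope.1 (hz t (hsub t ht))).eventually
    (gt_mem_nhds (hder t ht h0))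
  have hs' := hs.filter_mono (nhdsWithin_mono t (fun s (hs : s < t) => hs.ne) :
    nhdsWithin t (Set.Iio t) ≤ nhdsWithin t {t}ᶜ)
  obtain ⟨s, hsl, hst⟩ := (hs'.and (Ioo_mem_nhdsLT h1)).exists
  rw [slope_def_field, h0, sub_zero] at hsl
  have := div_nonneg_of_nonpos (hle s ⟨hst.1.le, hst.2.le.trans h2⟩)
    (by linarith [hst.2] : s - t ≤ 0)
  linarith
end

section
/- Let T_a ≤ τ < T_r, T = T_r − T_a, ω = ε ln(T/ε), and L = 5M e^{4λT}. Let (x_ε, y_ε, z_ε) be a solution of the slow–fast system on [τ, T_r] with x_ε(τ) = x₀ satisfying −MT < x₀ < −Mε, y_ε(τ) = y₀, and z_ε(τ) = 0, and let (x_a, y_a) be the solution of the attractive reduced system with x_a(τ) = x₀, y_a(τ) = y₀. Let t̂ = T_r if z_ε(t) ≠ 0 for all t ∈ (τ, T_r], and t̂ = min{t ∈ (τ, T_r] : z_ε(t) = 0} otherwise. Then there exists ε₀ > 0, depending only on M, λ and T, such that for all ε ∈ (0, ε₀): |x_ε(t) − x_a(t)| ≤ Lω and |y_ε(t) − y_a(t)|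 ≤ Lω for all t ∈ [τ, t̂]. -/
/-- Let `T_a ≤ τ < T_r`, `T = T_r - T_a`, `ω = ε ln(T/ε)`,
`L = 5M e^{4λT}`. There exists `ε₀ > 0`, depending only on `M`, `λ` and `T`,
such that for all `ε ∈ (0, ε₀)`: every solution of the slow–fast system on
`[τ, T_r]` with `x_ε(τ) = x₀ ∈ (-MT, -Mε)`, `y_ε(τ) = y₀`, `z_ε(τ) = 0` stays
`Lω`-close to the solution of the attractive reduced system with the same initial
data, on the interval `[τ, t̂]`. -/
theorem slowfast_close_to_reduced_attractive
    (M lam Ta Tr τ T : ℝ)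
    (hM : 0 < M) (hlam : 0 ≤ lam)
    (hTaτ : Ta ≤ τ) (hτTr : τ < Tr) (hT : T = Tr - Ta) :
    ∃ ε₀ > (0 : ℝ),
      ∀ (f g : ℝ → ℝ → ℝ → ℝ),
        -- Assumption 1: global boundedness and global Lipschitz continuity
        (∀ x y z : ℝ, |f x y z| < M ∧ |g x y z| < M) →
        (∀ x₁ y₁ z₁ x₂ y₂ z₂ : ℝ,
          |f x₁ y₁ z₁ - f x₂ y₂ z₂| ≤ lam * (|x₁ - x₂| + |y₁ - y₂| + |z₁ - z₂|)) →
        (∀ x₁ y₁ z₁ x₂ y₂ z₂ : ℝ,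
          |g x₁ y₁ z₁ - g x₂ y₂ z₂| ≤ lam * (|x₁ - x₂| + |y₁ - y₂| + |z₁ - z₂|)) →
        ∀ (ε x₀ y₀ : ℝ), 0 < ε → ε < ε₀ →
        ∀ (xe ye ze xa ya : ℝ → ℝ),
          -- (x_ε, y_ε, z_ε) is a solution of the slow–fast system on [τ, T_r]
          (∀ t ∈ Set.Icc τ Tr, HasDerivAt xe (f (xe t) (ye t) (ze t)) t) →
          (∀ t ∈ Set.Icc τ Tr, HasDerivAt ye (g (xe t) (ye t) (ze t)) t) →
          (∀ t ∈ Set.Icc τ Tr, HasDerivAt ze ((xe t + |ze t|) / ε) t) →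
          -- (x_a, y_a) is the solution of the attractive reduced system
          (∀ t ∈ Set.Icc τ Tr, HasDerivAt xa (f (xa t) (ya t) (xa t)) t) →
          (∀ t ∈ Set.Icc τ Tr, HasDerivAt ya (g (xa t) (ya t) (xa t)) t) →
          -- initial conditions
          xe τ = x₀ → ye τ = y₀ → ze τ = 0 → xa τ = x₀ → ya τ = y₀ →
          -(M * T) < x₀ → x₀ < -(M * ε) →
          -- the time moment t̂
          ∀ th : ℝ,
            (((∀ t ∈ Set.Ioc τ Tr, ze t ≠ 0) ∧ th = Tr) ∨
              IsLeast {t | t ∈ Set.Ioc τ Tr ∧ ze t = 0} th) →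
            ∀ t ∈ Set.Icc τ th,
              |xe t - xa t| ≤ (5 * M * Real.exp (4 * lam * T)) * (ε * Real.log (T / ε)) ∧
              |ye t - ya t| ≤ (5 * M * Real.exp (4 * lam * T)) * (ε * Real.log (T / ε)) := by
  have hTpos : 0 < T := by linarith
  refine ⟨T / Real.exp 1, by positivity, ?_⟩
  intro f g hb hf hg ε x₀ y₀ hε hε0 xe ye ze xa ya hxe hye hze hxa hya ix iy iz ixa iya hx1 hx2 th hth
  have hthr : th ≤ Tr := by
    rcases hth with ⟨_, h⟩ | h
    · exact h.le
    · exact h.1.1.2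
  have hMε : 0 < M * ε := by positivity
  -- sign of ze
  have hz : ∀ t ∈ Set.Icc τ th, ze t ≤ 0 := by
    intro t ht
    by_contra hpos
    push Not at hpos
    have hτt : τ < t := by
      rcases eq_or_lt_of_le ht.1 with h | h
      · rw [← h, iz] at hpos; exact absurd hpos (lt_irrefl _)
      · exact h
    have hd := hze τ ⟨le_refl _, hτTr.le⟩
    have hneg : (xe τ + |ze τ|) / ε < 0 := by
      rw [ix, iz, abs_zero, add_zero]
      exact div_neg_of_neg_of_pos (by linarith) hε
    obtain ⟨t2, ht2, hzt2⟩ : ∃ t2 ∈ Set.Ioo τ t, ze t2 < 0 := by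
      have hs := (hasDerivAt_iff_tendsto_slope.1 hd)
      have hs' : Filter.Tendsto (slope ze τ) (nhdsWithin τ (Set.Ioi τ)) (nhds ((xe τ + |ze τ|) / ε)) :=
        hs.mono_left (nhdsWithin_mono _ (fun x hx => ne_of_gt hx))
      have h1 := hs'.eventually (gt_mem_nhds hneg)
      have h2 : ∀ᶠ s in nhdsWithin τ (Set.Ioi τ), s ∈ Set.Ioo τ t := Ioo_mem_nhdsGT hτt
      obtain ⟨s, hs1, hs2⟩ := (h1.and h2).exists
      refine ⟨s, hs2, ?_⟩
      rw [slope_def_field, iz, sub_zero] at hs1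
      by_contra hc
      push Not at hc
      have : 0 ≤ ze s / (s - τ) := div_nonneg hc (by linarith [hs2.1])
      linarith
    have hcont : ContinuousOn ze (Set.Icc t2 t) := fun s hs =>
      (hze s ⟨by linarith [hs.1, ht2.1], by linarith [hs.2, ht.2]⟩).continuousAt.continuousWithinAt
    obtain ⟨c, hc, hc0⟩ := intermediate_value_Ioo ht2.2.le hcont (show (0:ℝ) ∈ Set.Ioo (ze t2) (ze t) from ⟨hzt2, hpos⟩)
    have hcm : c ∈ Set.Ioc τ Tr := ⟨by linarith [hc.1, ht2.1], by linarith [hc.2, ht.2]⟩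
    rcases hth with ⟨h, _⟩ | h
    · exact h c hcm hc0
    · have := h.2 ⟨hcm, hc0⟩
      linarith [hc.2, ht.2]
  -- derivatives of the exponentials
  have hexp : ∀ k t : ℝ, HasDerivAt (fun t => Real.exp (k * (t - τ))) (Real.exp (k * (t - τ)) * k) t := by
    intro k t
    have := (((hasDerivAt_id t).sub_const τ).const_mul k).exp
    simpa using this
  -- bound on w = ze - xe
  have hw : ∀ t ∈ Set.Icc τ th, |ze t - xe t| ≤ M * T * Real.exp (-ε⁻¹ * (t - τ)) + M * ε := by
    have key : ∀ t ∈ Set.Icc τ th, ‖(ze t - xe t) * Real.exp (ε⁻¹ * (t - τ))‖ ≤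
        M * T + M * ε * Real.exp (ε⁻¹ * (t - τ)) := by
      have hD : ∀ t ∈ Set.Icc τ th, HasDerivAt (fun t => (ze t - xe t) * Real.exp (ε⁻¹ * (t - τ)))
          (-f (xe t) (ye t) (ze t) * Real.exp (ε⁻¹ * (t - τ))) t := by
        intro t ht
        have htr : t ∈ Set.Icc τ Tr := ⟨ht.1, ht.2.trans hthr⟩
        have h := ((hze t htr).sub (hxe t htr)).mul (hexp ε⁻¹ t)
        refine h.congr_deriv ?_
        rw [abs_of_nonpos (hz t ht)]
        simp only [Pi.sub_apply]
        field_simp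
        ring
      intro t ht
      refine image_norm_le_of_norm_deriv_right_le_deriv_boundary
        (f' := fun t => -f (xe t) (ye t) (ze t) * Real.exp (ε⁻¹ * (t - τ)))
        (B := fun t => M * T + M * ε * Real.exp (ε⁻¹ * (t - τ)))
        (B' := fun t => M * ε * (Real.exp (ε⁻¹ * (t - τ)) * ε⁻¹))
        (fun t ht => (hD t ht).continuousAt.continuousWithinAt)
        (fun t ht => (hD t ⟨ht.1, ht.2.le⟩).hasDerivWithinAt) ?_ ?_ ?_ ht
      · simp only [iz, ix, sub_self, mul_zero, Real.exp_zero, mul_one, zero_sub, Real.norm_eq_abs]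
        rw [abs_of_pos (by linarith)]
        linarith
      · intro t
        exact ((hexp ε⁻¹ t).const_mul (M * ε)).const_add (M * T)
      · intro t _
        rw [norm_mul, norm_neg, Real.norm_eq_abs, Real.norm_eq_abs, abs_of_pos (Real.exp_pos _)]
        have : M * ε * (Real.exp (ε⁻¹ * (t - τ)) * ε⁻¹) = M * Real.exp (ε⁻¹ * (t - τ)) := by
          field_simp
        rw [this]
        exact mul_le_mul_of_nonneg_right (hb _ _ _).1.le (Real.exp_pos _).le
    intro t ht
    have h := key t ht
    rw [norm_mul, Real.norm_eq_abs, Real.norm_eq_abs, abs_of_pos (Real.exp_pos _)] at h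
    have he : Real.exp (-ε⁻¹ * (t - τ)) * Real.exp (ε⁻¹ * (t - τ)) = 1 := by
      rw [← Real.exp_add, neg_mul, neg_add_cancel, Real.exp_zero]
    refine le_of_mul_le_mul_right (h.trans (le_of_eq ?_)) (Real.exp_pos (ε⁻¹ * (t - τ)))
    linear_combination (-(M * T)) * he
  -- main comparison
  let δ : ℝ := 3 * M * ε / T
  have hδ : 0 < δ := by positivity
  have main : ∀ t ∈ Set.Icc τ th, ‖((xe t - xa t, ye t - ya t) : ℝ × ℝ)‖ ≤
      Real.exp (3 * lam * (t - τ)) * (δ * (t - τ) + (lam * (M * T * ε) * (1 - Real.exp (-ε⁻¹ * (t - τ)))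
        + lam * (M * ε) * (t - τ))) := by
    have hD : ∀ t ∈ Set.Icc τ th, HasDerivAt (fun t => ((xe t - xa t, ye t - ya t) : ℝ × ℝ))
        (f (xe t) (ye t) (ze t) - f (xa t) (ya t) (xa t), g (xe t) (ye t) (ze t) - g (xa t) (ya t) (xa t)) t := by
      intro t ht
      have htr : t ∈ Set.Icc τ Tr := ⟨ht.1, ht.2.trans hthr⟩
      exact ((hxe t htr).sub (hxa t htr)).prodMk ((hye t htr).sub (hya t htr))
    have hB : ∀ t : ℝ, HasDerivAt (fun t => Real.exp (3 * lam * (t - τ)) * (δ * (t - τ) + (lam * (M * T * ε) * (1 - Real.exp (-ε⁻¹ * (t - τ)))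
        + lam * (M * ε) * (t - τ))))
        (3 * lam * (Real.exp (3 * lam * (t - τ)) * (δ * (t - τ) + (lam * (M * T * ε) * (1 - Real.exp (-ε⁻¹ * (t - τ)))
        + lam * (M * ε) * (t - τ)))) + Real.exp (3 * lam * (t - τ)) * (δ + lam * (M * T * Real.exp (-ε⁻¹ * (t - τ)) + M * ε))) t := by
      intro t
      have hl := (hasDerivAt_id' t).sub_const τ
      have h := (hexp (3 * lam) t).mul ((hl.const_mul δ).add
        ((((hexp (-ε⁻¹) t).const_sub 1).const_mul (lam * (M * T * ε))).add (hl.const_mul (lam * (M * ε)))))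
      refine h.congr_deriv ?_
      simp only [Pi.add_apply]
      field_simp
    intro t ht
    refine image_norm_le_of_norm_deriv_right_lt_deriv_boundary
      (fun t ht => (hD t ht).continuousAt.continuousWithinAt)
      (fun t ht => (hD t ⟨ht.1, ht.2.le⟩).hasDerivWithinAt) ?_ hB ?_ ht
    · simp [ix, ixa, iy, iya]
    · intro t ht heq
      rw [← heq]
      have ht' : t ∈ Set.Icc τ th := ⟨ht.1, ht.2.le⟩
      have h1 : |xe t - xa t| ≤ ‖((xe t - xa t, ye t - ya t) : ℝ × ℝ)‖ := norm_fst_le (xe t - xa t, ye t - ya t)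
      have h2 : |ye t - ya t| ≤ ‖((xe t - xa t, ye t - ya t) : ℝ × ℝ)‖ := norm_snd_le (xe t - xa t, ye t - ya t)
      set N := ‖((xe t - xa t, ye t - ya t) : ℝ × ℝ)‖
      have h3 : |ze t - xa t| ≤ |ze t - xe t| + |xe t - xa t| := abs_sub_le _ _ _
      have h4 := hw t ht'
      set W := M * T * Real.exp (-ε⁻¹ * (t - τ)) + M * ε
      have hW : 0 ≤ W := (abs_nonneg _).trans h4
      have h5 : lam * (|xe t - xa t| + |ye t - ya t| + |ze t - xa t|) ≤ 3 * lam * N + lam * W := by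
        have : lam * (|xe t - xa t| + |ye t - ya t| + |ze t - xa t|) ≤ lam * (3 * N + W) :=
          mul_le_mul_of_nonneg_left (by linarith) hlam
        linarith
      have h6 : 1 ≤ Real.exp (3 * lam * (t - τ)) :=
        Real.one_le_exp (mul_nonneg (by positivity) (by linarith [ht.1]))
      have h7 : 3 * lam * N + lam * W < 3 * lam * N + Real.exp (3 * lam * (t - τ)) * (δ + lam * W) := by
        have : 0 ≤ lam * W := mul_nonneg hlam hW
        nlinarith
      refine lt_of_le_of_lt ?_ h7
      rw [Prod.norm_def]
      exact max_le ((hf _ _ _ _ _ _).trans h5) ((hg _ _ _ _ _ _).trans h5)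
  intro t ht
  have h1 : |xe t - xa t| ≤ ‖((xe t - xa t, ye t - ya t) : ℝ × ℝ)‖ := norm_fst_le (xe t - xa t, ye t - ya t)
  have h2 : |ye t - ya t| ≤ ‖((xe t - xa t, ye t - ya t) : ℝ × ℝ)‖ := norm_snd_le (xe t - xa t, ye t - ya t)
  suffices h : ‖((xe t - xa t, ye t - ya t) : ℝ × ℝ)‖ ≤
      (5 * M * Real.exp (4 * lam * T)) * (ε * Real.log (T / ε)) from ⟨h1.trans h, h2.trans h⟩
  refine (main t ht).trans ?_
  have hs0 : 0 ≤ t - τ := by linarith [ht.1]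
  have hsT : t - τ ≤ T := by linarith [ht.2]
  have hlog : 1 ≤ Real.log (T / ε) := by
    rw [Real.le_log_iff_exp_le (by positivity), le_div_iff₀ hε]
    rw [lt_div_iff₀ (Real.exp_pos _)] at hε0
    linarith
  have e1 : δ * (t - τ) ≤ 3 * M * ε := by
    calc δ * (t - τ) ≤ δ * T := mul_le_mul_of_nonneg_left hsT hδ.le
      _ = 3 * M * ε := by simp only [δ]; field_simp
  have e2 : lam * (M * T * ε) * (1 - Real.exp (-ε⁻¹ * (t - τ))) ≤ lam * (M * T * ε) :=
    mul_le_of_le_one_right (by positivity) (by linarith [Real.exp_pos (-ε⁻¹ * (t - τ))])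
  have e3 : lam * (M * ε) * (t - τ) ≤ lam * (M * ε) * T := mul_le_mul_of_nonneg_left hsT (by positivity)
  have e4 : Real.exp (3 * lam * (t - τ)) ≤ Real.exp (3 * lam * T) :=
    Real.exp_le_exp.2 (mul_le_mul_of_nonneg_left hsT (by positivity))
  have e5 : lam * T + 1 ≤ Real.exp (lam * T) := Real.add_one_le_exp _
  have e6 : Real.exp (4 * lam * T) = Real.exp (3 * lam * T) * Real.exp (lam * T) := by
    rw [← Real.exp_add]; ring_nf
  have hlT : 0 ≤ lam * T := by positivity
  calc _ ≤ Real.exp (3 * lam * (t - τ)) * (M * ε * (5 * Real.exp (lam * T))) := by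
        refine mul_le_mul_of_nonneg_left ?_ (Real.exp_pos _).le
        have : M * ε * (3 + 2 * (lam * T)) ≤ M * ε * (5 * Real.exp (lam * T)) :=
          mul_le_mul_of_nonneg_left (by linarith) hMε.le
        linarith
    _ ≤ Real.exp (3 * lam * T) * (M * ε * (5 * Real.exp (lam * T))) :=
        mul_le_mul_of_nonneg_right e4 (by positivity)
    _ = (5 * M * Real.exp (4 * lam * T)) * (ε * 1) := by rw [e6]; ring
    _ ≤ _ := by gcongr
end

section
/- Fix τ < t̃ and a point (x₀, y₀) with x₀ < 0. Let (x_a, y_a) be the solution of the attractive reduced system with x_a(τ) = x₀, y_a(τ) = y₀, and assume x_a(t) < 0 for all τ ≤ t < t̃, x_a(t̃) = 0, y_a(t̃) < 0, and f(0, y_a(t̃), 0) > 0. For each ε > 0 let (x_ε, y_ε, z_ε) be the solution of the slow–fast system with x_ε(τ) = x₀, y_ε(τ) = y₀, z_ε(τ) = 0. Then for every sufficiently small ε > 0, the function z_ε has a smallest zero t̂_ε in (τ, ∞), z_ε(t) < 0 for τ < t < t̂_ε, z_ε(t) > 0 for all t > t̂_ε, and t̂_ε → t̃ as ε → 0. 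-/
/-- Mean value inequality. -/
lemma dbl_mvt {h h' : ℝ → ℝ} {a b k : ℝ} (hab : a ≤ b) (hd : ∀ t, HasDerivAt h (h' t) t)
    (hk : ∀ t, a ≤ t → t < b → k ≤ h' t) : k * (b - a) ≤ h b - h a := by
  rcases hab.eq_or_lt with rfl | hlt
  · simp
  obtain ⟨c, hc, he⟩ := exists_hasDerivAt_eq_slope h h' hlt
    (fun t _ => (hd t).continuousAt.continuousWithinAt) (fun t _ => hd t)
  have h1 := hk c hc.1.le hc.2
  rw [he, le_div_iff₀ (by linarith)] at h1
  exact h1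

/-- Differential Gronwall inequality. -/
lemma dbl_gron {F F' : ℝ → ℝ} {a b K : ℝ} (hab : a ≤ b) (hd : ∀ t, HasDerivAt F (F' t) t)
    (hk : ∀ t, a ≤ t → t < b → F' t ≤ K * F t) : F b ≤ F a * Real.exp (K * (b - a)) := by
  have hE : ∀ t, HasDerivAt (fun t => - (F t * Real.exp (-(K * t))))
      (- (F' t * Real.exp (-(K * t)) + F t * (Real.exp (-(K * t)) * (-(K * 1))))) t := by
    intro t
    exact ((hd t).mul (((hasDerivAt_id t).const_mul K).neg.exp)).neg
  have h := dbl_mvt (k := 0) hab hE (by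
    intro t h1 h2
    have := hk t h1 h2
    have hp := Real.exp_pos (-(K * t))
    nlinarith)
  have h2 : F b * Real.exp (-(K * b)) ≤ F a * Real.exp (-(K * a)) := by linarith
  have h3 := mul_le_mul_of_nonneg_right h2 (Real.exp_pos (K * b)).le
  rw [mul_assoc, mul_assoc, ← Real.exp_add, ← Real.exp_add] at h3
  have e1 : -(K * b) + K * b = 0 := by ring
  have e2 : -(K * a) + K * b = K * (b - a) := by ring
  rw [e1, e2, Real.exp_zero, mul_one] at h3
  exact h3

/-- First hitting time of a continuous function. -/
lemma dbl_hit {h : ℝ → ℝ} {a b : ℝ} (hab : a ≤ b) (hc : Continuous h) (ha : h a < 0)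
    (hb : 0 ≤ h b) : ∃ s, a < s ∧ s ≤ b ∧ h s = 0 ∧ ∀ t, a ≤ t → t < s → h t < 0 := by
  have hcomp : IsCompact (Set.Icc a b ∩ {t | 0 ≤ h t}) :=
    isCompact_Icc.inter_right (isClosed_le continuous_const hc)
  obtain ⟨s, hs⟩ := hcomp.exists_isLeast ⟨b, ⟨hab, le_rfl⟩, hb⟩
  have hlt : ∀ t, a ≤ t → t < s → h t < 0 := by
    intro t h1 h2
    by_contra hcon
    have := hs.2 ⟨⟨h1, h2.le.trans hs.1.1.2⟩, not_lt.mp hcon⟩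
    linarith
  have hs0 : 0 ≤ h s := hs.1.2
  have has : a < s := by
    rcases hs.1.1.1.eq_or_lt with e | e
    · rw [← e] at hs0; linarith
    · exact e
  refine ⟨s, has, hs.1.1.2, le_antisymm ?_ hs0, hlt⟩
  obtain ⟨u, hu, hu0⟩ := intermediate_value_Icc has.le hc.continuousOn (show (0:ℝ) ∈ Set.Icc (h a) (h s) from ⟨ha.le, hs0⟩)
  rcases hu.2.eq_or_lt with e | e
  · rw [← e, hu0]
  · have := hlt u hu.1 e
    linarith

/-- Estimates while `z ≤ 0`. -/
lemma dbl_est {M lam τ T x₀ y₀ ε t : ℝ} (hM : 0 < M) (hlam : 0 ≤ lam) {f g : ℝ → ℝ → ℝ → ℝ}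
    (hbound : ∀ x y z : ℝ, |f x y z| < M ∧ |g x y z| < M)
    (hLipf : ∀ x₁ y₁ z₁ x₂ y₂ z₂ : ℝ,
      |f x₁ y₁ z₁ - f x₂ y₂ z₂| ≤ lam * (|x₁ - x₂| + |y₁ - y₂| + |z₁ - z₂|))
    (hLipg : ∀ x₁ y₁ z₁ x₂ y₂ z₂ : ℝ,
      |g x₁ y₁ z₁ - g x₂ y₂ z₂| ≤ lam * (|x₁ - x₂| + |y₁ - y₂| + |z₁ - z₂|))
    {xa ya x y z : ℝ → ℝ}
    (hxa : ∀ t : ℝ, HasDerivAt xa (f (xa t) (ya t) (xa t)) t)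
    (hya : ∀ t : ℝ, HasDerivAt ya (g (xa t) (ya t) (xa t)) t)
    (hxaτ : xa τ = x₀) (hyaτ : ya τ = y₀)
    (hε : 0 < ε) (hε1 : ε ≤ 1)
    (hX : ∀ t : ℝ, HasDerivAt x (f (x t) (y t) (z t)) t)
    (hY : ∀ t : ℝ, HasDerivAt y (g (x t) (y t) (z t)) t)
    (hZ : ∀ t : ℝ, HasDerivAt z ((x t + |z t|) / ε) t)
    (hx : x τ = x₀) (hy : y τ = y₀) (hz : z τ = 0)
    (hτt : τ ≤ t) (htT : t ≤ T) (hneg : ∀ u, τ ≤ u → u < t → z u ≤ 0) :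
    (x t - xa t) ^ 2 + (y t - ya t) ^ 2
        ≤ ((lam * x₀ ^ 2 + M ^ 2) * Real.exp (10 * lam * (T - τ))) * ε ∧
      (z t - x t) ^ 2 ≤ x₀ ^ 2 * Real.exp (-(1 / ε) * (t - τ)) + ε ^ 2 * M ^ 2 := by
  have hv : ∀ u, HasDerivAt (fun u => (z u - x u) ^ 2)
      (2 * (z u - x u) * ((x u + |z u|) / ε - f (x u) (y u) (z u))) u := by
    intro u
    have := ((hZ u).sub (hX u)).pow 2
    exact this.congr_deriv (by simp)
  have hvb : ∀ u, τ ≤ u → u < t →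
      2 * (z u - x u) * ((x u + |z u|) / ε - f (x u) (y u) (z u)) ≤
        -(1 / ε) * (z u - x u) ^ 2 + ε * M ^ 2 := by
    intro u h1 h2
    rw [abs_of_nonpos (hneg u h1 h2)]
    have hb := (hbound (x u) (y u) (z u)).1
    set F := f (x u) (y u) (z u)
    set v := z u - x u with hvdef
    have e : (x u + -z u) / ε = -(v / ε) := by rw [hvdef]; ring
    rw [e]
    have hF : F ^ 2 ≤ M ^ 2 := by
      rw [← sq_abs F]; gcongr
    have hsq : 0 ≤ ε * (v / ε + F) ^ 2 := by positivity
    have e2 : ε * (v / ε + F) ^ 2 = v ^ 2 / ε + 2 * v * F + ε * F ^ 2 := by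
      field_simp
      ring
    have e3 : 2 * v * (-(v / ε) - F) = - 2 * (v ^ 2 / ε) - 2 * v * F := by ring
    have e4 : -(1 / ε) * v ^ 2 = - (v ^ 2 / ε) := by ring
    rw [e3, e4]
    have : ε * F ^ 2 ≤ ε * M ^ 2 := by gcongr
    linarith
  constructor
  · have hD : ∀ u, HasDerivAt (fun u => (x u - xa u) ^ 2 + (y u - ya u) ^ 2
        + lam * ε * (z u - x u) ^ 2 + ε ^ 2 * M ^ 2)
        (2 * (x u - xa u) * (f (x u) (y u) (z u) - f (xa u) (ya u) (xa u))
        + 2 * (y u - ya u) * (g (x u) (y u) (z u) - g (xa u) (ya u) (xa u))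
        + lam * ε * (2 * (z u - x u) * ((x u + |z u|) / ε - f (x u) (y u) (z u)))) u := by
      intro u
      have h1 := ((hX u).sub (hxa u)).pow 2
      have h2 := ((hY u).sub (hya u)).pow 2
      have h3 := (hv u).const_mul (lam * ε)
      have := ((h1.add h2).add h3).add_const (ε ^ 2 * M ^ 2)
      exact this.congr_deriv (by simp)
    have hg := dbl_gron (K := 10 * lam) hτt hD (by
      intro u h1 h2
      have hvb' := mul_le_mul_of_nonneg_left (hvb u h1 h2) (mul_nonneg hlam hε.le)
      have hf := hLipf (x u) (y u) (z u) (xa u) (ya u) (xa u)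
      have hg := hLipg (x u) (y u) (z u) (xa u) (ya u) (xa u)
      set P := f (x u) (y u) (z u) - f (xa u) (ya u) (xa u)
      set Q := g (x u) (y u) (z u) - g (xa u) (ya u) (xa u)
      have hza : |z u - xa u| ≤ |z u - x u| + |x u - xa u| := abs_sub_le _ _ _
      have s1 := sq_abs (x u - xa u)
      have s2 := sq_abs (y u - ya u)
      have s3 := sq_abs (z u - x u)
      have k1 : (x u - xa u) * P ≤ |x u - xa u| * |P| := by
        rw [← abs_mul]; exact le_abs_self _
      have k2 : (y u - ya u) * Q ≤ |y u - ya u| * |Q| := by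
        rw [← abs_mul]; exact le_abs_self _
      have n1 := abs_nonneg (x u - xa u)
      have n2 := abs_nonneg (y u - ya u)
      have n3 := abs_nonneg (z u - x u)
      set a := |x u - xa u|
      set b := |y u - ya u|
      set v := |z u - x u|
      have hf' : |P| ≤ lam * (2 * a + 2 * b + v) :=
        hf.trans (mul_le_mul_of_nonneg_left (by linarith) hlam)
      have hg' : |Q| ≤ lam * (2 * a + 2 * b + v) :=
        hg.trans (mul_le_mul_of_nonneg_left (by linarith) hlam)
      have k3 : a * |P| ≤ a * (lam * (2 * a + 2 * b + v)) := by gcongr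
      have k4 : b * |Q| ≤ b * (lam * (2 * a + 2 * b + v)) := by gcongr
      have e4 : lam * ε * (-(1 / ε) * (z u - x u) ^ 2 + ε * M ^ 2)
          = - lam * v ^ 2 + lam * (ε ^ 2 * M ^ 2) := by
        rw [s3]; field_simp
      rw [e4] at hvb'
      rw [← s1, ← s2, ← s3]
      have k5 : 2 * (a + b) * (2 * a + 2 * b + v) ≤ 10 * (a ^ 2 + b ^ 2) + v ^ 2 := by
        nlinarith [sq_nonneg (a + b - v), sq_nonneg (a - b)]
      have k6 := mul_le_mul_of_nonneg_left k5 hlam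
      have k7 : 0 ≤ lam * (ε ^ 2 * M ^ 2) := by positivity
      have k8 : 0 ≤ lam * (lam * ε * v ^ 2) := by positivity
      linarith)
    simp only [hx, hxaτ, hy, hyaτ, hz, sub_self] at hg
    have p1 : 0 ≤ lam * ε * (z t - x t) ^ 2 + ε ^ 2 * M ^ 2 := by positivity
    have p2 : Real.exp (10 * lam * (t - τ)) ≤ Real.exp (10 * lam * (T - τ)) := by
      gcongr
    have p3 : (0:ℝ) ^ 2 + 0 ^ 2 + lam * ε * (0 - x₀) ^ 2 + ε ^ 2 * M ^ 2
        ≤ (lam * x₀ ^ 2 + M ^ 2) * ε := by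
      have : ε ^ 2 * M ^ 2 ≤ ε * M ^ 2 := by
        gcongr; nlinarith
      nlinarith
    have p4 := mul_le_mul p3 p2 (Real.exp_pos _).le (by positivity)
    linarith
  · have hg := dbl_gron (K := -(1 / ε)) hτt (fun u => (hv u).sub_const (ε ^ 2 * M ^ 2)) (by
      intro u h1 h2
      have := hvb u h1 h2
      have e : -(1 / ε) * ((z u - x u) ^ 2 - ε ^ 2 * M ^ 2)
        = -(1 / ε) * (z u - x u) ^ 2 + ε * M ^ 2 := by field_simp; ring
      simp only [e]
      exact this)
    simp only [hx, hz] at hg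
    have hp := Real.exp_pos (-(1 / ε) * (t - τ))
    have : 0 ≤ ε ^ 2 * M ^ 2 * Real.exp (-(1 / ε) * (t - τ)) := by positivity
    linarith

/-- After the first zero. -/
lemma dbl_after {M ε s r c δ yt : ℝ} (hM : 0 < M) {f g : ℝ → ℝ → ℝ → ℝ}
    (hbound : ∀ x y z : ℝ, |f x y z| < M ∧ |g x y z| < M)
    {x y z : ℝ → ℝ} (hr : 0 < r) (hc : 0 < c) (hδ : 0 < δ) (hMδ : M * δ ≤ r / 2)
    (hbox : ∀ a b d, |a| ≤ r → |b - yt| ≤ r → |d| ≤ r → c ≤ f a b d)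
    (hε : 0 < ε)
    (hX : ∀ t : ℝ, HasDerivAt x (f (x t) (y t) (z t)) t)
    (hY : ∀ t : ℝ, HasDerivAt y (g (x t) (y t) (z t)) t)
    (hZ : ∀ t : ℝ, HasDerivAt z ((x t + |z t|) / ε) t)
    (hzs : z s = 0) (hxs : 0 ≤ x s) (hxs' : |x s| ≤ r / 2) (hys : |y s - yt| ≤ r / 2)
    (he1 : ε * M < r) (he2 : 4 * r * ε < c * δ ^ 2) :
    ∀ t, s < t → 0 < z t := by
  have zc : Continuous z := continuous_iff_continuousAt.mpr fun t => (hZ t).continuousAt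
  -- the box estimate in x, y
  have hxb : ∀ t, s ≤ t → t ≤ s + δ → |x t| ≤ r := by
    intro t h1 h2
    have u1 := dbl_mvt (k := -M) h1 hX (fun u _ _ => (abs_lt.mp (hbound _ _ _).1).1.le)
    have u2 := dbl_mvt (k := -M) h1 (fun u => (hX u).neg)
      (fun u _ _ => by have := (abs_lt.mp (hbound (x u) (y u) (z u)).1).2; linarith)
    simp only [Pi.neg_apply] at u2
    have u3 : M * (t - s) ≤ M * δ := by gcongr; linarith
    have := abs_le.mp hxs'
    rw [abs_le]; constructor <;> linarith
  have hyb : ∀ t, s ≤ t → t ≤ s + δ → |y t - yt| ≤ r := by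
    intro t h1 h2
    have u1 := dbl_mvt (k := -M) h1 hY (fun u _ _ => (abs_lt.mp (hbound _ _ _).2).1.le)
    have u2 := dbl_mvt (k := -M) h1 (fun u => (hY u).neg)
      (fun u _ _ => by have := (abs_lt.mp (hbound (x u) (y u) (z u)).2).2; linarith)
    simp only [Pi.neg_apply] at u2
    have u3 : M * (t - s) ≤ M * δ := by gcongr; linarith
    have := abs_le.mp hys
    rw [abs_le]; constructor <;> linarith
  -- growth while z is in the box
  have hgx : ∀ t, s ≤ t → t ≤ s + δ → (∀ u, s ≤ u → u < t → |z u| ≤ r) →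
      c * (t - s) ≤ x t := by
    intro t h1 h2 h3
    have := dbl_mvt (k := c) h1 hX (fun u v1 v2 =>
      hbox _ _ _ (hxb u v1 (by linarith)) (hyb u v1 (by linarith)) (h3 u v1 v2))
    linarith
  have hgz : ∀ t, s ≤ t → t ≤ s + δ → (∀ u, s ≤ u → u < t → |z u| ≤ r) →
      c * (t - s) ^ 2 / (2 * ε) ≤ z t := by
    intro t h1 h2 h3
    have hd : ∀ u, HasDerivAt (fun u => z u - c * (u - s) ^ 2 / (2 * ε))
        ((x u + |z u|) / ε - c * (u - s) / ε) u := by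
      intro u
      have := (hZ u).sub ((((((hasDerivAt_id u).sub_const s).pow 2).const_mul c).div_const (2 * ε)))
      exact this.congr_deriv (by simp; field_simp)
    have := dbl_mvt (k := 0) h1 hd (fun u v1 v2 => by
      have := hgx u v1 (by linarith) (fun w w1 w2 => h3 w w1 (by linarith))
      rw [← sub_div]
      apply div_nonneg _ hε.le
      have := abs_nonneg (z u)
      linarith)
    simp only [hzs, sub_self] at this
    norm_num at this
    exact this
  -- z reaches r
  obtain ⟨t1, ht1, ht1', hzt1, hlt⟩ : ∃ t1, s < t1 ∧ t1 ≤ s + δ ∧ |z t1| - r = 0 ∧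
      ∀ t, s ≤ t → t < t1 → |z t| - r < 0 := by
    by_cases hex : ∃ b, s ≤ b ∧ b ≤ s + δ ∧ 0 ≤ |z b| - r
    · obtain ⟨b, b1, b2, b3⟩ := hex
      obtain ⟨t1, h1, h2, h3, h4⟩ := dbl_hit (h := fun t => |z t| - r) b1
        (zc.abs.sub continuous_const) (by simp [hzs, hr]) b3
      exact ⟨t1, h1, h2.trans b2, h3, h4⟩
    · exfalso
      push Not at hex
      have h1 := hgz (s + δ) (by linarith) le_rfl
        (fun u v1 v2 => by have := hex u v1 v2.le; linarith)
      have h2 := hex (s + δ) (by linarith) le_rfl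
      have h3 := le_abs_self (z (s + δ))
      have h4 : c * (s + δ - s) ^ 2 / (2 * ε) < r := by linarith
      rw [div_lt_iff₀ (by positivity)] at h4
      have : c * (s + δ - s) ^ 2 = c * δ ^ 2 := by ring
      have : 0 < r * ε := by positivity
      linarith
  have hpos1 : ∀ t, s < t → t ≤ t1 → 0 < z t := by
    intro t h1 h2
    have := hgz t h1.le (by linarith) (fun u v1 v2 => by have := hlt u v1 (by linarith); linarith)
    have h3 : 0 < c * (t - s) ^ 2 / (2 * ε) := by
      have : 0 < t - s := by linarith
      positivity
    linarith
  have hz1 : z t1 = r := by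
    rw [abs_of_pos (hpos1 t1 ht1 le_rfl)] at hzt1; linarith
  have hx1 : 0 ≤ x t1 := by
    have := hgx t1 ht1.le ht1' (fun u v1 v2 => by have := hlt u v1 (by linarith); linarith)
    have : 0 ≤ c * (t1 - s) := mul_nonneg hc.le (by linarith)
    linarith
  have hw : ∀ t, t1 ≤ t → 0 < x t + z t := by
    intro t h1
    have hd : ∀ u, HasDerivAt (fun u => ε * M - (x u + z u))
        (- (f (x u) (y u) (z u) + (x u + |z u|) / ε)) u := fun u =>
      ((hX u).add (hZ u)).const_sub (ε * M)
    have := dbl_gron (K := 1 / ε) h1 hd (fun u _ _ => by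
      have h2 := (abs_lt.mp (hbound (x u) (y u) (z u)).1).1
      have h3 : (x u + z u) / ε ≤ (x u + |z u|) / ε := by
        gcongr; exact le_abs_self _
      have e : 1 / ε * (ε * M - (x u + z u)) = M - (x u + z u) / ε := by field_simp
      simp only [e]
      linarith)
    have h5 : (ε * M - (x t1 + z t1)) * Real.exp (1 / ε * (t - t1)) ≤ 0 :=
      mul_nonpos_of_nonpos_of_nonneg (by linarith) (Real.exp_pos _).le
    have : 0 < ε * M := by positivity
    linarith
  intro t ht
  rcases le_total t t1 with h | h
  · exact hpos1 t ht h
  · have := dbl_mvt (k := 0) h hZ (fun u v1 _ => by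
      have := hw u v1
      have h3 := le_abs_self (z u)
      apply div_nonneg _ hε.le
      linarith)
    linarith

set_option maxHeartbeats 1000000 in
/-- Core claim for a given tolerance. -/
lemma dbl_core
    (M lam τ ttil x₀ y₀ : ℝ) (hM : 0 < M) (hlam : 0 ≤ lam)
    (hτttil : τ < ttil) (hx₀ : x₀ < 0)
    (f g : ℝ → ℝ → ℝ → ℝ)
    -- Assumption 1: global boundedness and global Lipschitz continuity
    (hbound : ∀ x y z : ℝ, |f x y z| < M ∧ |g x y z| < M)
    (hLipf : ∀ x₁ y₁ z₁ x₂ y₂ z₂ : ℝ,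
      |f x₁ y₁ z₁ - f x₂ y₂ z₂| ≤ lam * (|x₁ - x₂| + |y₁ - y₂| + |z₁ - z₂|))
    (hLipg : ∀ x₁ y₁ z₁ x₂ y₂ z₂ : ℝ,
      |g x₁ y₁ z₁ - g x₂ y₂ z₂| ≤ lam * (|x₁ - x₂| + |y₁ - y₂| + |z₁ - z₂|))
    -- (x_a, y_a) is the solution of the attractive reduced system
    (xa ya : ℝ → ℝ)
    (hxa : ∀ t : ℝ, HasDerivAt xa (f (xa t) (ya t) (xa t)) t)
    (hya : ∀ t : ℝ, HasDerivAt ya (g (xa t) (ya t) (xa t)) t)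
    (hxaτ : xa τ = x₀) (hyaτ : ya τ = y₀)
    (hxaneg : ∀ t : ℝ, τ ≤ t → t < ttil → xa t < 0)
    (hxattil : xa ttil = 0) (hyattil : ya ttil < 0)
    (hfttil : 0 < f 0 (ya ttil) 0)
    -- for each ε > 0, (X ε, Y ε, Z ε) is the solution of the slow–fast system
    (X Y Z : ℝ → ℝ → ℝ)
    (hX : ∀ ε : ℝ, 0 < ε → ∀ t : ℝ,
      HasDerivAt (X ε) (f (X ε t) (Y ε t) (Z ε t)) t)
    (hY : ∀ ε : ℝ, 0 < ε → ∀ t : ℝ,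
      HasDerivAt (Y ε) (g (X ε t) (Y ε t) (Z ε t)) t)
    (hZ : ∀ ε : ℝ, 0 < ε → ∀ t : ℝ,
      HasDerivAt (Z ε) ((X ε t + |Z ε t|) / ε) t)
    (hIC : ∀ ε : ℝ, 0 < ε → X ε τ = x₀ ∧ Y ε τ = y₀ ∧ Z ε τ = 0) :
    ∀ η > (0 : ℝ), ∃ ε₁ > (0 : ℝ), ∀ ε : ℝ, 0 < ε → ε < ε₁ → ∃ s, τ < s ∧ |s - ttil| ≤ η ∧
      Z ε s = 0 ∧ (∀ t, τ < t → t < s → Z ε t < 0) ∧ (∀ t, s < t → 0 < Z ε t) := by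
  intro η₀ hη₀
  obtain ⟨c, hc, hcdef⟩ : ∃ c : ℝ, 0 < c ∧ f 0 (ya ttil) 0 = 2 * c :=
    ⟨f 0 (ya ttil) 0 / 2, by linarith, by ring⟩
  obtain ⟨r, hr, hrc⟩ : ∃ r : ℝ, 0 < r ∧ lam * (3 * r) ≤ c := by
    refine ⟨c / (3 * (lam + 1)), by positivity, ?_⟩
    rw [show lam * (3 * (c / (3 * (lam + 1)))) = (lam * c) / (lam + 1) by field_simp,
      div_le_iff₀ (by linarith)]
    nlinarith
  have hbox : ∀ a b d, |a| ≤ r → |b - ya ttil| ≤ r → |d| ≤ r → c ≤ f a b d := by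
    intro a b d h1 h2 h3
    have h := hLipf a b d 0 (ya ttil) 0
    rw [sub_zero, sub_zero] at h
    have h' : lam * (|a| + |b - ya ttil| + |d|) ≤ lam * (3 * r) :=
      mul_le_mul_of_nonneg_left (by linarith) hlam
    have := (abs_le.mp (h.trans h')).1
    linarith
  obtain ⟨η, hη, hηη₀, hη1, hηM, hητ⟩ : ∃ η : ℝ, 0 < η ∧ η ≤ η₀ ∧ η ≤ 1 ∧ M * η ≤ r / 4 ∧
      η < ttil - τ := by
    refine ⟨min (min η₀ 1) (min (r / 4 / M) ((ttil - τ) / 2)), ?_, ?_, ?_, ?_, ?_⟩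
    · have : 0 < ttil - τ := by linarith
      positivity
    · exact (min_le_left _ _).trans (min_le_left _ _)
    · exact (min_le_left _ _).trans (min_le_right _ _)
    · rw [mul_comm, ← le_div_iff₀ hM]
      exact (min_le_right _ _).trans (min_le_left _ _)
    · have : min (min η₀ 1) (min (r / 4 / M) ((ttil - τ) / 2)) ≤ (ttil - τ) / 2 :=
        (min_le_right _ _).trans (min_le_right _ _)
      linarith
  -- bounds for the reduced solution near ttil
  have hlip : ∀ {h h' : ℝ → ℝ}, (∀ t, HasDerivAt h (h' t) t) → (∀ t, |h' t| < M) →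
      ∀ t, |t - ttil| ≤ η → |h t - h ttil| ≤ r / 4 := by
    intro h h' hd hb t ht
    have ht' := abs_le.mp ht
    have b1 : ∀ u, -M ≤ h' u := fun u => (abs_lt.mp (hb u)).1.le
    have b2 : ∀ u, -M ≤ -h' u := fun u => by linarith [(abs_lt.mp (hb u)).2]
    rcases le_total t ttil with hle | hle
    · have u1 := dbl_mvt (k := -M) hle hd (fun u _ _ => b1 u)
      have u2 := dbl_mvt (k := -M) hle (fun u => (hd u).neg) (fun u _ _ => b2 u)
      simp only [Pi.neg_apply] at u2
      have u3 : M * (ttil - t) ≤ M * η := by gcongr; linarith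
      rw [abs_le]; constructor <;> linarith
    · have u1 := dbl_mvt (k := -M) hle hd (fun u _ _ => b1 u)
      have u2 := dbl_mvt (k := -M) hle (fun u => (hd u).neg) (fun u _ _ => b2 u)
      simp only [Pi.neg_apply] at u2
      have u3 : M * (t - ttil) ≤ M * η := by gcongr; linarith
      rw [abs_le]; constructor <;> linarith
  have hxan : ∀ t, |t - ttil| ≤ η → |xa t| ≤ r / 4 := by
    intro t ht
    have := hlip hxa (fun t => (hbound _ _ _).1) t ht
    rwa [hxattil, sub_zero] at this
  have hyan : ∀ t, |t - ttil| ≤ η → |ya t - ya ttil| ≤ r / 4 :=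
    hlip hya (fun t => (hbound _ _ _).2)
  have hxapos : c * η ≤ xa (ttil + η) := by
    have := dbl_mvt (k := c) (show ttil ≤ ttil + η by linarith) hxa (fun u v1 v2 => by
      have hu : |u - ttil| ≤ η := by rw [abs_le]; constructor <;> linarith
      have h1 := hxan u hu
      have h2 := hyan u hu
      exact hbox _ _ _ (by linarith) (by linarith) (by linarith))
    rw [hxattil] at this
    linarith
  obtain ⟨m, hm, hxam⟩ : ∃ m : ℝ, 0 < m ∧ ∀ t, τ ≤ t → t ≤ ttil - η → xa t ≤ -m := by
    have hcont : ContinuousOn xa (Set.Icc τ (ttil - η)) :=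
      fun t _ => (hxa t).continuousAt.continuousWithinAt
    obtain ⟨p, hp, hmax⟩ := isCompact_Icc.exists_isMaxOn
      (Set.nonempty_Icc.mpr (show τ ≤ ttil - η by linarith)) hcont
    refine ⟨-xa p, ?_, ?_⟩
    · have := hxaneg p hp.1 (by linarith [hp.2])
      linarith
    · intro t h1 h2
      have : xa t ≤ xa p := hmax ⟨h1, h2⟩
      linarith
  -- constants
  obtain ⟨κ, hκ, hκr, hκm, hκc⟩ : ∃ κ : ℝ, 0 < κ ∧ κ ≤ r / 4 ∧ κ ≤ m / 2 ∧ κ ≤ c * η / 4 :=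
    ⟨min (r / 4) (min (m / 2) (c * η / 4)), by positivity, min_le_left _ _,
      (min_le_right _ _).trans (min_le_left _ _), (min_le_right _ _).trans (min_le_right _ _)⟩
  obtain ⟨C₁, hC₁, hC₁def⟩ : ∃ C₁ : ℝ, 0 < C₁ ∧
      C₁ = (lam * x₀ ^ 2 + M ^ 2) * Real.exp (10 * lam * ((ttil + 1) - τ)) :=
    ⟨_, by positivity, rfl⟩
  have hL : 0 < ttil - τ := by linarith
  obtain ⟨C₂, hC₂, hC₂def⟩ : ∃ C₂ : ℝ, 0 < C₂ ∧ C₂ = x₀ ^ 2 / (ttil - τ) + M ^ 2 :=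
    ⟨_, by positivity, rfl⟩
  obtain ⟨δ, hδ, hMδ⟩ : ∃ δ : ℝ, 0 < δ ∧ M * δ ≤ r / 2 :=
    ⟨r / 2 / M, by positivity, by field_simp; rfl⟩
  refine ⟨min (min 1 (κ ^ 2 / C₁)) (min (κ ^ 2 / C₂) (min (r / M) (c * δ ^ 2 / (4 * r)))),
    by positivity, ?_⟩
  intro ε hε hlt
  simp only [lt_min_iff] at hlt
  obtain ⟨⟨e1, e2⟩, e3, e4, e5⟩ := hlt
  rw [lt_div_iff₀ hC₁] at e2
  rw [lt_div_iff₀ hC₂] at e3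
  rw [lt_div_iff₀ hM] at e4
  rw [lt_div_iff₀ (by positivity)] at e5
  obtain ⟨hx, hy, hz⟩ := hIC ε hε
  have hX' := hX ε hε
  have hY' := hY ε hε
  have hZ' := hZ ε hε
  generalize X ε = x at *
  generalize Y ε = y at *
  generalize Z ε = z at *
  have zc : Continuous z := continuous_iff_continuousAt.mpr fun t => (hZ' t).continuousAt
  have hest : ∀ t, τ ≤ t → t ≤ ttil + 1 → (∀ u, τ ≤ u → u < t → z u ≤ 0) →
      |x t - xa t| ≤ κ ∧ |y t - ya t| ≤ κ ∧
      (z t - x t) ^ 2 ≤ x₀ ^ 2 * Real.exp (-(1 / ε) * (t - τ)) + ε ^ 2 * M ^ 2 := by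
    intro t h1 h2 h3
    obtain ⟨q1, q2⟩ := dbl_est hM hlam hbound hLipf hLipg hxa hya hxaτ hyaτ hε e1.le hX' hY' hZ'
      hx hy hz h1 h2 h3
    rw [← hC₁def] at q1
    refine ⟨abs_le_of_sq_le_sq ?_ hκ.le, abs_le_of_sq_le_sq ?_ hκ.le, q2⟩
    · linarith [sq_nonneg (y t - ya t)]
    · linarith [sq_nonneg (x t - xa t)]
  -- z is positive somewhere before ttil + η
  obtain ⟨b, hb1, hb2, hb3⟩ : ∃ b, τ ≤ b ∧ b ≤ ttil + η ∧ 0 < z b := by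
    by_contra hcon
    push Not at hcon
    obtain ⟨q1, -, q3⟩ := hest (ttil + η) (by linarith) (by linarith)
      (fun u v1 v2 => hcon u v1 v2.le)
    have hz1 := hcon (ttil + η) (by linarith) le_rfl
    have hx1 := (abs_le.mp q1).1
    have hexp : Real.exp (-(1 / ε) * (ttil + η - τ)) ≤ ε / (ttil - τ) := by
      have h0 : 0 < (ttil - τ) / ε := by positivity
      have h1 : (ttil - τ) / ε ≤ Real.exp ((ttil - τ) / ε) := by
        have := Real.add_one_le_exp ((ttil - τ) / ε)
        linarith
      calc Real.exp (-(1 / ε) * (ttil + η - τ)) ≤ Real.exp (-((ttil - τ) / ε)) := by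
            apply Real.exp_le_exp.mpr
            have : 0 ≤ η / ε := by positivity
            have e : -(1 / ε) * (ttil + η - τ) = -((ttil - τ) / ε) - η / ε := by ring
            linarith
        _ = (Real.exp ((ttil - τ) / ε))⁻¹ := Real.exp_neg _
        _ ≤ ((ttil - τ) / ε)⁻¹ := inv_anti₀ h0 h1
        _ = ε / (ttil - τ) := inv_div _ _
    have h2 : x₀ ^ 2 * Real.exp (-(1 / ε) * (ttil + η - τ)) ≤ x₀ ^ 2 * (ε / (ttil - τ)) := by
      gcongr
    have h3 : ε ^ 2 * M ^ 2 ≤ ε * M ^ 2 := by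
      gcongr; exact pow_le_of_le_one hε.le e1.le two_ne_zero
    have h4 : x₀ ^ 2 * (ε / (ttil - τ)) + ε * M ^ 2 = ε * C₂ := by rw [hC₂def]; ring
    have h5 : (z (ttil + η) - x (ttil + η)) ^ 2 < κ ^ 2 := by linarith
    have h6 := (abs_lt.mp (abs_lt_of_sq_lt_sq h5 hκ.le)).1
    linarith [mul_pos hc hη]
  have hτb : τ < b := by
    rcases hb1.eq_or_lt with e | e
    · rw [← e, hz] at hb3; exact absurd hb3 (lt_irrefl _)
    · exact e
  -- z is negative right after τ
  obtain ⟨ρ, hρ, hρneg⟩ : ∃ ρ, τ < ρ ∧ ∀ t, τ < t → t ≤ ρ → z t < 0 := by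
    have hneg : (x τ + |z τ|) / ε < 0 := by
      rw [hx, hz, abs_zero, add_zero]; exact div_neg_of_neg_of_pos hx₀ hε
    have xc : Continuous x := continuous_iff_continuousAt.mpr fun t => (hX' t).continuousAt
    have hcd : Continuous fun t => (x t + |z t|) / ε := (xc.add zc.abs).div_const ε
    obtain ⟨d, hd, hball⟩ := Metric.eventually_nhds_iff.mp
      (hcd.continuousAt.eventually_lt (continuousAt_const (y := (0:ℝ))) hneg)
    refine ⟨τ + d / 2, by linarith, fun t h1 h2 => ?_⟩
    obtain ⟨w, hw, hwe⟩ := exists_hasDerivAt_eq_slope z _ h1 zc.continuousOn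
      (fun u _ => hZ' u)
    have : (x w + |z w|) / ε < 0 := hball (by
      rw [Real.dist_eq, abs_of_pos (by linarith [hw.1])]; linarith [hw.2])
    rw [hwe, hz, sub_zero, div_lt_iff₀ (by linarith)] at this
    linarith
  have hρb : ρ ≤ b := by
    by_contra hcon
    have := hρneg b hτb (by linarith)
    linarith
  obtain ⟨s, hs1, hs2, hs3, hs4⟩ := dbl_hit hρb zc (hρneg ρ hρ le_rfl) hb3.le
  have hsneg : ∀ t, τ < t → t < s → z t < 0 := by
    intro t h1 h2
    rcases le_total t ρ with h | h
    · exact hρneg t h1 h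
    · exact hs4 t h h2
  have hτs : τ < s := by linarith
  obtain ⟨q1, q2, -⟩ := hest s hτs.le (by linarith) (fun u v1 v2 => by
    rcases v1.eq_or_lt with e | e
    · rw [← e, hz]
    · exact (hsneg u e v2).le)
  have hxs : 0 ≤ x s := by
    by_contra hcon
    push Not at hcon
    have hneg : (x s + |z s|) / ε < 0 := by
      rw [hs3, abs_zero, add_zero]; exact div_neg_of_neg_of_pos hcon hε
    have xc : Continuous x := continuous_iff_continuousAt.mpr fun t => (hX' t).continuousAt
    have hcd : Continuous fun t => (x t + |z t|) / ε := (xc.add zc.abs).div_const ε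
    obtain ⟨d, hd, hball⟩ := Metric.eventually_nhds_iff.mp
      (hcd.continuousAt.eventually_lt (continuousAt_const (y := (0:ℝ))) hneg)
    have hmx : max (s - d / 2) ((τ + s) / 2) < s := max_lt (by linarith) (by linarith)
    have hl1 := le_max_left (s - d / 2) ((τ + s) / 2)
    have hl2 := le_max_right (s - d / 2) ((τ + s) / 2)
    obtain ⟨w, hw, hwe⟩ := exists_hasDerivAt_eq_slope z _ hmx zc.continuousOn
      (fun u _ => hZ' u)
    have h1 : (x w + |z w|) / ε < 0 := hball (by
      rw [Real.dist_eq, abs_of_neg (by linarith [hw.2])]; linarith [hw.1])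
    rw [hwe, hs3, div_lt_iff₀ (by linarith)] at h1
    have := hsneg _ (by linarith) hmx
    linarith
  have hslow : ttil - η < s := by
    by_contra hcon
    have h1 := hxam s hτs.le (by linarith)
    have h2 := (abs_le.mp q1).2
    linarith
  have hsη : |s - ttil| ≤ η := by rw [abs_le]; constructor <;> linarith
  have hxas := abs_le.mp (hxan s hsη)
  have hyas := abs_le.mp (hyan s hsη)
  have q1' := abs_le.mp q1
  have q2' := abs_le.mp q2
  refine ⟨s, hτs, hsη.trans hηη₀, hs3, hsneg, ?_⟩
  exact dbl_after hM hbound hr hc hδ hMδ hbox hε hX' hY' hZ' hs3 hxs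
    (by rw [abs_le]; constructor <;> linarith) (by rw [abs_le]; constructor <;> linarith)
    e4 (by linarith)



/-- (Destabilizing initial points.) If the attractive reduced
solution starting at `(x₀, y₀)` at time `τ` reaches the negative `y`-half-axis
transversally at time `t̃` (i.e. `x_a < 0` on `[τ, t̃)`, `x_a(t̃) = 0`,
`y_a(t̃) < 0`, `f(0, y_a(t̃), 0) > 0`), then for every sufficiently small `ε > 0`
the function `z_ε` has a smallest zero `t̂_ε` in `(τ, ∞)`, `z_ε < 0` on `(τ, t̂_ε)`,
`z_ε > 0` after `t̂_ε`, and `t̂_ε → t̃` as `ε → 0`. -/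
theorem destabilizing_blowup
    (M lam τ ttil x₀ y₀ : ℝ) (hM : 0 < M) (hlam : 0 ≤ lam)
    (hτttil : τ < ttil) (hx₀ : x₀ < 0)
    (f g : ℝ → ℝ → ℝ → ℝ)
    -- Assumption 1: global boundedness and global Lipschitz continuity
    (hbound : ∀ x y z : ℝ, |f x y z| < M ∧ |g x y z| < M)
    (hLipf : ∀ x₁ y₁ z₁ x₂ y₂ z₂ : ℝ,
      |f x₁ y₁ z₁ - f x₂ y₂ z₂| ≤ lam * (|x₁ - x₂| + |y₁ - y₂| + |z₁ - z₂|))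
    (hLipg : ∀ x₁ y₁ z₁ x₂ y₂ z₂ : ℝ,
      |g x₁ y₁ z₁ - g x₂ y₂ z₂| ≤ lam * (|x₁ - x₂| + |y₁ - y₂| + |z₁ - z₂|))
    -- (x_a, y_a) is the solution of the attractive reduced system
    (xa ya : ℝ → ℝ)
    (hxa : ∀ t : ℝ, HasDerivAt xa (f (xa t) (ya t) (xa t)) t)
    (hya : ∀ t : ℝ, HasDerivAt ya (g (xa t) (ya t) (xa t)) t)
    (hxaτ : xa τ = x₀) (hyaτ : ya τ = y₀)
    (hxaneg : ∀ t : ℝ, τ ≤ t → t < ttil → xa t < 0)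
    (hxattil : xa ttil = 0) (hyattil : ya ttil < 0)
    (hfttil : 0 < f 0 (ya ttil) 0)
    -- for each ε > 0, (X ε, Y ε, Z ε) is the solution of the slow–fast system
    (X Y Z : ℝ → ℝ → ℝ)
    (hX : ∀ ε : ℝ, 0 < ε → ∀ t : ℝ,
      HasDerivAt (X ε) (f (X ε t) (Y ε t) (Z ε t)) t)
    (hY : ∀ ε : ℝ, 0 < ε → ∀ t : ℝ,
      HasDerivAt (Y ε) (g (X ε t) (Y ε t) (Z ε t)) t)
    (hZ : ∀ ε : ℝ, 0 < ε → ∀ t : ℝ,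
      HasDerivAt (Z ε) ((X ε t + |Z ε t|) / ε) t)
    (hIC : ∀ ε : ℝ, 0 < ε → X ε τ = x₀ ∧ Y ε τ = y₀ ∧ Z ε τ = 0) :
    ∃ ε₀ > (0 : ℝ), ∃ th : ℝ → ℝ,
      (∀ ε : ℝ, 0 < ε → ε < ε₀ →
        IsLeast {t | τ < t ∧ Z ε t = 0} (th ε) ∧
        (∀ t : ℝ, τ < t → t < th ε → Z ε t < 0) ∧
        (∀ t : ℝ, th ε < t → 0 < Z ε t)) ∧
      (∀ η > (0 : ℝ), ∃ ε₁ > (0 : ℝ), ∀ ε : ℝ, 0 < ε → ε < ε₁ → ε < ε₀ →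
        |th ε - ttil| ≤ η) := by
  have hcore := dbl_core M lam τ ttil x₀ y₀ hM hlam hτttil hx₀ f g hbound hLipf hLipg xa ya hxa hya
    hxaτ hyaτ hxaneg hxattil hyattil hfttil X Y Z hX hY hZ hIC
  have hleast : ∀ ε s, τ < s → Z ε s = 0 → (∀ t, τ < t → t < s → Z ε t < 0) →
      IsLeast {t | τ < t ∧ Z ε t = 0} s := by
    intro ε s h1 h2 h3
    refine ⟨⟨h1, h2⟩, fun t ht => ?_⟩
    by_contra hcon
    have := h3 t ht.1 (not_le.mp hcon)
    rw [ht.2] at this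
    exact lt_irrefl _ this
  obtain ⟨ε₀, hε₀, h0⟩ := hcore 1 one_pos
  refine ⟨ε₀, hε₀, fun ε => sInf {t | τ < t ∧ Z ε t = 0}, ?_, ?_⟩
  · intro ε hε hlt
    obtain ⟨s, h1, -, h3, h4, h5⟩ := h0 ε hε hlt
    have hl := hleast ε s h1 h3 h4
    simp only [hl.csInf_eq]
    exact ⟨hl, h4, h5⟩
  · intro η hη
    obtain ⟨ε₁, hε₁, h⟩ := hcore η hη
    refine ⟨ε₁, hε₁, fun ε hε hlt _ => ?_⟩
    obtain ⟨s, h1, h2, h3, h4, -⟩ := h ε hε hlt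
    simp only [(hleast ε s h1 h3 h4).csInf_eq]
    exact h2
end
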